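/- Assume the standing hypotheses on μ. There exist ε > 0, an exponent β₁ = β₁(α) > 0, a constant C = C(C₀, α), a radius r₀ > 0 small enough that ϑ^C_Σ(x,r) < ε for all x ∈ Σ ∩ B(0,r₀) and 0 < r ≤ r₀, and a unique KP cone C based at the origin, such that for all 0 < r ≤ r₀ one has D^{0,1}((1/r)Σ, C) ≤ C·r^{β₁} (equivalently, D^{0,r}(Σ, C) ≤ C·r^{β₁}). -/

import Mathlib

open Metric Set MeasureTheory Filter Module
open scoped RealInnerProductSpace Topology Pointwise ENNReal

noncomputable section

/-- `ℝⁿ` as a Euclidean space. -/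
abbrev E (n : ℕ) : Type := EuclideanSpace ℝ (Fin n)

/-- `d(A,B) = sup_{a ∈ A} inf_{b ∈ B} |a - b|`. -/
def setD {n : ℕ} (A B : Set (E n)) : ℝ := ⨆ a ∈ A, Metric.infDist a B

/-- `d^{x,r}(A,B) = (1/r) d(A ∩ B(x,r), B ∩ B(x,r))`. -/
def dxr {n : ℕ} (x : E n) (r : ℝ) (A B : Set (E n)) : ℝ :=
  (1 / r) * setD (A ∩ closedBall x r) (B ∩ closedBall x r)

/-- `D^{x,r}(A,B) = max(d^{x,r}(A,B), d^{x,r}(B,A))`. -/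
def Dxr {n : ℕ} (x : E n) (r : ℝ) (A B : Set (E n)) : ℝ :=
  max (dxr x r A B) (dxr x r B A)

/-- `d̃^{x,r}(A,B) = (1/r) d(A ∩ B(x,r), B)`. -/
def dtxr {n : ℕ} (x : E n) (r : ℝ) (A B : Set (E n)) : ℝ :=
  (1 / r) * setD (A ∩ closedBall x r) B

/-- `D̃^{x,r}(A,B) = max(d̃^{x,r}(A,B), d̃^{x,r}(B,A))`. -/
def Dtxr {n : ℕ} (x : E n) (r : ℝ) (A B : Set (E n)) : ℝ :=
  max (dtxr x r A B) (dtxr x r B A)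

/-- `C` is a cone based at `y`: `y ∈ C` and `s • (C − y) = C − y` for all `s > 0`. -/
def IsConeAt {n : ℕ} (y : E n) (C : Set (E n)) : Prop :=
  y ∈ C ∧ ∀ s : ℝ, 0 < s → s • {z : E n | y + z ∈ C} = {z : E n | y + z ∈ C}

/-- The standard KP cone `{x₄² = x₁² + x₂² + x₃²}` in `ℝⁿ`, `n ≥ 4`. -/
def stdKP (n : ℕ) (hn : 4 ≤ n) : Set (E n) :=
  {x : E n | (x ⟨3, by omega⟩) ^ 2 =
    (x ⟨0, by omega⟩) ^ 2 + (x ⟨1, by omega⟩) ^ 2 + (x ⟨2, by omega⟩) ^ 2}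

/-- `C` is a KP cone based at `y`: in some orthonormal coordinates centered at the origin,
`C − y` is the standard KP cone. -/
def IsKPCone {n : ℕ} (hn : 4 ≤ n) (y : E n) (C : Set (E n)) : Prop :=
  ∃ f : E n ≃ₗᵢ[ℝ] E n, {z : E n | y + z ∈ C} = f ⁻¹' stdKP n hn

/-- `θ^P_Σ(x,r)` : best approximation of `S` in `B(x,r)` by affine `m`-planes through `x`. -/
def thetaP {n : ℕ} (m : ℕ) (S : Set (E n)) (x : E n) (r : ℝ) : ℝ :=
  ⨅ L : {L : AffineSubspace ℝ (E n) // x ∈ L ∧ Module.finrank ℝ L.direction = m},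
    Dxr x r S (L.1 : Set (E n))

/-- `θ^C_Σ(x,r)` : best approximation of `S` in `B(x,r)` by KP cones based at `x`. -/
def thetaC {n : ℕ} (hn : 4 ≤ n) (S : Set (E n)) (x : E n) (r : ℝ) : ℝ :=
  ⨅ C : {C : Set (E n) // IsKPCone hn x C}, Dxr x r S C.1

/-- `ϑ^C_Σ(x,r)` : best approximation of `S` in `B(x,r)` by KP cones containing `x`. -/
def varthetaC {n : ℕ} (hn : 4 ≤ n) (S : Set (E n)) (x : E n) (r : ℝ) : ℝ :=
  ⨅ C : {C : Set (E n) // (∃ y, IsKPCone hn y C) ∧ x ∈ C}, Dxr x r S C.1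

/-- The angle `∠(P₁,P₂) = arcsin Γ(P₁,P₂)` between two affine planes. -/
def planeAngle {n : ℕ} (P₁ P₂ : AffineSubspace ℝ (E n)) : ℝ :=
  Real.arcsin (dxr (0 : E n) 1 (P₁.direction : Set (E n)) (P₂.direction : Set (E n)))

/-- The support of a measure. -/
def msupp {n : ℕ} (μ : Measure (E n)) : Set (E n) :=
  {x : E n | ∀ r : ℝ, 0 < r → 0 < μ (closedBall x r)}

/-- Weak convergence of a sequence of measures in the sense of Radon measures. -/
def VagueTendsto {n : ℕ} (μs : ℕ → Measure (E n)) (ν : Measure (E n)) : Prop :=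
  ∀ f : E n → ℝ, Continuous f → HasCompactSupport f →
    Tendsto (fun i => ∫ y, f y ∂(μs i)) atTop (nhds (∫ y, f y ∂ν))

/-- `ν` is a tangent measure of `μ` at `x`: `ν ≠ 0` and for some `rᵢ ↓ 0`, `cᵢ > 0`,
`cᵢ (T_{x,rᵢ})₊μ → ν` weakly. -/
def IsTangentMeasure {n : ℕ} (μ ν : Measure (E n)) (x : E n) : Prop :=
  ν ≠ 0 ∧ ∃ r c : ℕ → ℝ, (∀ i, 0 < r i) ∧ Tendsto r atTop (nhds 0) ∧ (∀ i, 0 < c i) ∧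
    VagueTendsto (fun i => ENNReal.ofReal (c i) • Measure.map (fun y => (r i)⁻¹ • (y - x)) μ) ν

/-- `μ` is `m`-asymptotically optimally doubling. -/
def AOD {n : ℕ} (m : ℕ) (μ : Measure (E n)) : Prop :=
  ∀ K : Set (E n), K ⊆ msupp μ → IsCompact K → ∀ δ : ℝ, 0 < δ →
    ∃ r₀ : ℝ, 0 < r₀ ∧ ∀ x ∈ K, ∀ r : ℝ, 0 < r → r ≤ r₀ →
      ∀ τ : ℝ, τ ∈ Set.Icc (1/2 : ℝ) 1 →
        |(μ (closedBall x (τ * r))).toReal / (μ (closedBall x r)).toReal - τ ^ m| < δ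

/-- `ν` is `m`-flat: `m`-dimensional Hausdorff measure restricted to an affine `m`-plane. -/
def IsFlatMeasure {n : ℕ} (m : ℕ) (ν : Measure (E n)) : Prop :=
  ∃ L : AffineSubspace ℝ (E n), (L : Set (E n)).Nonempty ∧
    Module.finrank ℝ L.direction = m ∧
    ν = (Measure.hausdorffMeasure (m : ℝ)).restrict (L : Set (E n))

/-- Volume of the unit ball in `ℝᵐ`. -/
def unitBallVol (m : ℕ) : ℝ := (volume (Metric.ball (0 : EuclideanSpace ℝ (Fin m)) 1)).toReal

/-- `ω₃`, the volume of the unit `3`-ball. -/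
def omega3 : ℝ := unitBallVol 3

/-- The second moment `Q_{0,r}` of a measure on `ℝ⁴`. -/
def Qmom (μ : Measure (E 4)) (r : ℝ) (z : E 4) : ℝ :=
  (5 / (omega3 * r ^ 5)) * ∫ w in closedBall (0 : E 4) r, ⟪z, w⟫ ^ 2 ∂μ

/-- Entries `q_{ij}` of the second moment matrix in given directions. -/
def qmom (μ : Measure (E 4)) (r : ℝ) (u v : E 4) : ℝ :=
  (5 / (omega3 * r ^ 5)) * ∫ w in closedBall (0 : E 4) r, ⟪u, w⟫ * ⟪v, w⟫ ∂μ

/-- `μ` is `(α,m)`-Hölder asymptotically uniform. -/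
def HolderAsympUniform {n : ℕ} (α : ℝ) (m : ℕ) (μ : Measure (E n)) : Prop :=
  ∀ K : Set (E n), K ⊆ msupp μ → IsCompact K →
    ∃ C r₀ : ℝ, 0 < r₀ ∧ ∀ x ∈ K, ∀ r : ℝ, 0 < r → r ≤ r₀ →
      |(μ (closedBall x r)).toReal / (unitBallVol m * r ^ m) - 1| ≤ C * r ^ α

/-- `φ` is a `C^{1,β}` diffeomorphism from `U` onto `U'`: a continuously differentiable bijection
with `β`-Hölder derivative whose inverse is also `C^{1,β}`. -/
def IsC1HolderDiffeoOn (β : ℝ) (U U' : Set (E 4)) (φ : E 4 → E 4) : Prop :=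
  Set.BijOn φ U U' ∧
  (∀ x ∈ U, HasFDerivAt φ (fderiv ℝ φ x) x) ∧
  (∃ M : ℝ, ∀ x ∈ U, ∀ y ∈ U, ‖fderiv ℝ φ x - fderiv ℝ φ y‖ ≤ M * ‖x - y‖ ^ β) ∧
  ∃ ψ : E 4 → E 4, Set.BijOn ψ U' U ∧
    (∀ x ∈ U, ψ (φ x) = x) ∧ (∀ y ∈ U', φ (ψ y) = y) ∧
    (∀ y ∈ U', HasFDerivAt ψ (fderiv ℝ ψ y) y) ∧
    (∃ M : ℝ, ∀ x ∈ U', ∀ y ∈ U', ‖fderiv ℝ ψ x - fderiv ℝ ψ y‖ ≤ M * ‖x - y‖ ^ β)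

lemma omega3_pos : 0 < omega3 := by
  unfold omega3 unitBallVol
  exact ENNReal.toReal_pos (measure_ball_pos _ _ one_pos).ne' measure_ball_lt_top.ne

lemma msupp_closed {n : ℕ} (μ : Measure (E n)) : IsClosed (msupp μ) := by
  rw [← isOpen_compl_iff, Metric.isOpen_iff]
  intro x hx
  simp only [msupp, mem_compl_iff, mem_ofPred_eq, not_forall, not_lt, nonpos_iff_eq_zero] at hx
  obtain ⟨r, hr, h⟩ := hx
  refine ⟨r / 2, by positivity, fun y hy hy' => ?_⟩
  have := hy' (r / 2) (by positivity)
  have h2 : closedBall y (r / 2) ⊆ closedBall x r :=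
    closedBall_subset_closedBall' (by rw [mem_ball] at hy; linarith)
  exact absurd (measure_mono_null h2 h) this.ne'

lemma msupp_compl_null {n : ℕ} (μ : Measure (E n)) : μ (msupp μ)ᶜ = 0 := by
  refine measure_null_of_locally_null _ fun x hx => ?_
  simp only [msupp, mem_compl_iff, mem_ofPred_eq, not_forall, not_lt, nonpos_iff_eq_zero] at hx
  obtain ⟨r, hr, h⟩ := hx
  exact ⟨closedBall x r, mem_nhdsWithin_of_mem_nhds (closedBall_mem_nhds x hr), h⟩

lemma msupp_ae {n : ℕ} (μ : Measure (E n)) : ∀ᵐ w ∂μ, w ∈ msupp μ := msupp_compl_null μ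

lemma msupp_null_of_disj {n : ℕ} {μ : Measure (E n)} {A : Set (E n)}
    (h : ∀ w ∈ A, w ∉ msupp μ) : μ A = 0 :=
  measure_mono_null (fun w hw => h w hw) (msupp_compl_null μ)

/-- uniform measures -/
def Unif (ν : Measure (E 4)) : Prop :=
  IsLocallyFiniteMeasure ν ∧ ∀ x ∈ msupp ν, ∀ s : ℝ, 0 < s →
    (ν (closedBall x s)).toReal = omega3 * s ^ 3

def NU (ε R : ℝ) (μ : Measure (E 4)) : Prop :=
  ∀ y ∈ msupp μ, ‖y‖ ≤ R → ∀ s : ℝ, 0 < s → s ≤ R →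
    |(μ (closedBall y s)).toReal - omega3 * s ^ 3| ≤ ε * s ^ 3

def AU {ι : Type*} (U : Filter ι) (μs : ι → Measure (E 4)) : Prop :=
  (∀ i, IsLocallyFiniteMeasure (μs i)) ∧ ∀ R : ℝ, 0 < R → ∀ ε : ℝ, 0 < ε → ∀ᶠ i in U, NU ε R (μs i)

/-- cutoff -/
def cut (x : E 4) (s δ : ℝ) (w : E 4) : ℝ := max 0 (min 1 ((s + δ - dist w x) / δ))

lemma cut_cont (x : E 4) (s δ : ℝ) : Continuous (cut x s δ) := by
  unfold cut; fun_prop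

lemma cut_zero {x : E 4} {s δ : ℝ} (hδ : 0 < δ) {w : E 4} (hw : w ∉ closedBall x (s + δ)) :
    cut x s δ w = 0 := by
  rw [mem_closedBall, not_le] at hw
  unfold cut
  refine max_eq_left (min_le_of_right_le ?_)
  exact div_nonpos_of_nonpos_of_nonneg (by linarith) hδ.le

lemma cut_supp (x : E 4) (s : ℝ) {δ : ℝ} (hδ : 0 < δ) : HasCompactSupport (cut x s δ) :=
  HasCompactSupport.intro (isCompact_closedBall x (s + δ)) fun _ hw => cut_zero hδ hw

lemma cut_one {x : E 4} {s δ : ℝ} (hδ : 0 < δ) {w : E 4} (hw : w ∈ closedBall x s) :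
    cut x s δ w = 1 := by
  rw [mem_closedBall] at hw
  unfold cut
  have : 1 ≤ (s + δ - dist w x) / δ := by rw [le_div_iff₀ hδ]; linarith
  rw [min_eq_left this]; simp

lemma cut_nonneg (x : E 4) (s δ : ℝ) (w : E 4) : 0 ≤ cut x s δ w := le_max_left _ _
lemma cut_le (x : E 4) (s δ : ℝ) (w : E 4) : cut x s δ w ≤ 1 :=
  max_le zero_le_one (min_le_left _ _)

lemma cut_lower {μ : Measure (E 4)} [IsLocallyFiniteMeasure μ] (x : E 4) (s : ℝ) {δ : ℝ}
    (hδ : 0 < δ) : (μ (closedBall x s)).toReal ≤ ∫ w, cut x s δ w ∂μ := by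
  have h : ∫ w, (closedBall x s).indicator (fun _ => (1 : ℝ)) w ∂μ = (μ (closedBall x s)).toReal := by
    rw [integral_indicator measurableSet_closedBall]; simp [Measure.real]
  rw [← h]
  refine integral_mono ?_ ((cut_cont x s δ).integrable_of_hasCompactSupport (cut_supp x s hδ)) ?_
  · rw [integrable_indicator_iff measurableSet_closedBall]
    exact integrableOn_const measure_closedBall_lt_top.ne
  · intro w
    by_cases hw : w ∈ closedBall x s
    · simp [hw, cut_one hδ hw]
    · simp [hw, cut_nonneg]

lemma cut_upper {μ : Measure (E 4)} [IsLocallyFiniteMeasure μ] (x : E 4) (s : ℝ) {δ : ℝ}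
    (hδ : 0 < δ) : ∫ w, cut x s δ w ∂μ ≤ (μ (closedBall x (s + δ))).toReal := by
  have h : ∫ w, (closedBall x (s + δ)).indicator (fun _ => (1 : ℝ)) w ∂μ
      = (μ (closedBall x (s + δ))).toReal := by
    rw [integral_indicator measurableSet_closedBall]; simp [Measure.real]
  rw [← h]
  refine integral_mono ((cut_cont x s δ).integrable_of_hasCompactSupport (cut_supp x s hδ)) ?_ ?_
  · rw [integrable_indicator_iff measurableSet_closedBall]
    exact integrableOn_const measure_closedBall_lt_top.ne
  · intro w
    by_cases hw : w ∈ closedBall x (s + δ)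
    · simp [hw, cut_le]
    · simp [hw, cut_zero hδ hw]

lemma msupp_toReal_pos {μ : Measure (E 4)} [IsLocallyFiniteMeasure μ] {x : E 4} :
    x ∈ msupp μ ↔ ∀ s : ℝ, 0 < s → 0 < (μ (closedBall x s)).toReal := by
  refine forall₂_congr fun s hs => ?_
  rw [ENNReal.toReal_pos_iff]
  exact ⟨fun h => ⟨h, measure_closedBall_lt_top⟩, fun h => h.1⟩

/-- vague convergence along a filter -/
def VT {ι : Type*} (U : Filter ι) (μs : ι → Measure (E 4)) (ν : Measure (E 4)) : Prop :=
  ∀ f : E 4 → ℝ, Continuous f → HasCompactSupport f →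
    Tendsto (fun i => ∫ y, f y ∂(μs i)) U (𝓝 (∫ y, f y ∂ν))

lemma VT.ball_le {ι : Type*} {U : Filter ι} [U.NeBot] {μs : ι → Measure (E 4)} {ν : Measure (E 4)}
    [∀ i, IsLocallyFiniteMeasure (μs i)] [IsLocallyFiniteMeasure ν] (h : VT U μs ν)
    {x : E 4} {s t c : ℝ} (hst : s < t) (hc : ∀ᶠ i in U, (μs i (closedBall x t)).toReal ≤ c) :
    (ν (closedBall x s)).toReal ≤ c := by
  have hδ : 0 < t - s := by linarith
  refine (cut_lower x s hδ).trans ?_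
  refine le_of_tendsto (h _ (cut_cont x s _) (cut_supp x s hδ)) ?_
  filter_upwards [hc] with i hi
  refine (cut_upper x s hδ).trans ?_
  simpa using hi

lemma VT.le_ball {ι : Type*} {U : Filter ι} [U.NeBot] {μs : ι → Measure (E 4)} {ν : Measure (E 4)}
    [∀ i, IsLocallyFiniteMeasure (μs i)] [IsLocallyFiniteMeasure ν] (h : VT U μs ν)
    {x : E 4} {s t c : ℝ} (hst : s < t) (hc : ∀ᶠ i in U, c ≤ (μs i (closedBall x s)).toReal) :
    c ≤ (ν (closedBall x t)).toReal := by
  have hδ : 0 < t - s := by linarith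
  have := cut_upper (μ := ν) x s hδ
  rw [show s + (t - s) = t by ring] at this
  refine le_trans ?_ this
  refine ge_of_tendsto (h _ (cut_cont x s _) (cut_supp x s hδ)) ?_
  filter_upwards [hc] with i hi
  exact hi.trans (cut_lower x s hδ)

lemma toReal_mono_ball {μ : Measure (E 4)} [IsLocallyFiniteMeasure μ] {x y : E 4} {s t : ℝ}
    (h : s + dist x y ≤ t) : (μ (closedBall x s)).toReal ≤ (μ (closedBall y t)).toReal :=
  ENNReal.toReal_mono measure_closedBall_lt_top.ne
    (measure_mono (closedBall_subset_closedBall' h))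

lemma NU.mass {R : ℝ} {μ : Measure (E 4)} [IsLocallyFiniteMeasure μ] (hR : 0 < R)
    (h : NU 1 (2 * R) μ) : (μ (closedBall 0 R)).toReal ≤ (omega3 + 1) * (2 * R) ^ 3 := by
  by_cases hne : ∃ y ∈ msupp μ, ‖y‖ ≤ R
  · obtain ⟨y, hy, hyR⟩ := hne
    have h1 := (abs_le.1 (h y hy (by linarith) (2 * R) (by positivity) le_rfl)).2
    have h2 : (μ (closedBall 0 R)).toReal ≤ (μ (closedBall y (2 * R))).toReal :=
      toReal_mono_ball (by rw [dist_zero_left]; linarith)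
    linarith
  · push Not at hne
    rw [msupp_null_of_disj (μ := μ) (A := closedBall 0 R)]
    · simp; have := omega3_pos; positivity
    · intro w hw hw'
      exact absurd (hne w hw') (by simpa using hw)

open CompactlySupported CompactlySupportedContinuousMap in
lemma exists_vague {ι : Type*} (U : Ultrafilter ι) (μs : ι → Measure (E 4))
    [∀ i, IsLocallyFiniteMeasure (μs i)]
    (hM : ∀ R : ℝ, 0 < R → ∃ M : ℝ, ∀ᶠ i in (U : Filter ι), (μs i (closedBall 0 R)).toReal ≤ M) :
    ∃ ν : Measure (E 4), IsLocallyFiniteMeasure ν ∧ VT (U : Filter ι) μs ν := by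
  have key : ∀ f : C_c(E 4, ℝ), ∃ l : ℝ, Tendsto (fun i => ∫ y, f y ∂(μs i)) U (𝓝 l) := by
    intro f
    obtain ⟨R, hR0, hR⟩ : ∃ R : ℝ, 0 < R ∧ tsupport f ⊆ closedBall 0 R := by
      obtain ⟨R, hR⟩ := f.hasCompactSupport.isBounded.subset_closedBall 0
      exact ⟨max R 1, by positivity, hR.trans (closedBall_subset_closedBall (le_max_left _ _))⟩
    obtain ⟨M, hM⟩ := hM R hR0
    obtain ⟨B, hB⟩ := f.hasCompactSupport.exists_bound_of_continuous f.continuous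
    have hev : ∀ᶠ i in (U : Filter ι), (∫ y, f y ∂(μs i)) ∈ Icc (-(B * M)) (B * M) := by
      filter_upwards [hM] with i hi
      rw [← setIntegral_eq_integral_of_forall_compl_eq_zero (s := closedBall 0 R)
        (fun x hx => image_eq_zero_of_notMem_tsupport fun h => hx (hR h))]
      have h1 := norm_setIntegral_le_of_norm_le_const (μ := μs i) (s := closedBall (0 : E 4) R)
        (f := f) (C := B) measure_closedBall_lt_top (fun x _ => hB x)
      have hB0 : 0 ≤ B := (norm_nonneg _).trans (hB 0)
      have h2 : B * (μs i).real (closedBall 0 R) ≤ B * M := mul_le_mul_of_nonneg_left hi hB0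
      rw [Real.norm_eq_abs] at h1
      exact abs_le.1 (h1.trans h2)
    obtain ⟨l, -, hl⟩ := (isCompact_Icc (a := -(B * M)) (b := B * M)).ultrafilter_le_nhds
      (U.map fun i => ∫ y, f y ∂(μs i)) (by rw [Ultrafilter.coe_map, le_principal_iff]; exact hev)
    exact ⟨l, hl⟩
  choose Λ hΛ using key
  have hint : ∀ (i : ι) (f : C_c(E 4, ℝ)), Integrable f (μs i) := fun i f =>
    f.continuous.integrable_of_hasCompactSupport f.hasCompactSupport
  let L : C_c(E 4, ℝ) →ₗ[ℝ] ℝ :=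
    { toFun := Λ
      map_add' := fun f g => by
        refine tendsto_nhds_unique (hΛ (f + g)) ?_
        refine ((hΛ f).add (hΛ g)).congr fun i => ?_
        rw [← integral_add (hint i f) (hint i g)]; rfl
      map_smul' := fun c f => by
        refine tendsto_nhds_unique (hΛ (c • f)) ?_
        refine ((hΛ f).const_smul c).congr fun i => ?_
        rw [← integral_smul]; rfl }
  let P : C_c(E 4, ℝ) →ₚ[ℝ] ℝ := PositiveLinearMap.mk₀ L (fun f hf =>
    ge_of_tendsto' (hΛ f) fun i => integral_nonneg hf)
  refine ⟨RealRMK.rieszMeasure P, inferInstance, fun f hf hfs => ?_⟩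
  let g : C_c(E 4, ℝ) := ⟨⟨f, hf⟩, hfs⟩
  have h1 := RealRMK.integral_rieszMeasure P g
  have h2 : Tendsto (fun i => ∫ y, g y ∂(μs i)) U (𝓝 (P g)) := hΛ g
  rw [← h1] at h2
  exact h2

lemma AU.mass {ι : Type*} {U : Filter ι} {μs : ι → Measure (E 4)} (h : AU U μs) {R : ℝ}
    (hR : 0 < R) : ∀ᶠ i in U, (μs i (closedBall 0 R)).toReal ≤ (omega3 + 1) * (2 * R) ^ 3 := by
  filter_upwards [h.2 (2 * R) (by positivity) 1 one_pos] with i hi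
  have := h.1 i
  exact hi.mass hR

/-- compactness of asymptotically uniform families -/
theorem BU {ι : Type*} (U : Ultrafilter ι) (μs : ι → Measure (E 4)) (h : AU (U : Filter ι) μs) :
    ∃ ν : Measure (E 4), VT (U : Filter ι) μs ν ∧ Unif ν ∧
      ∀ y, y ∈ msupp ν ↔ ∀ s : ℝ, 0 < s → ∀ᶠ i in (U : Filter ι), ∃ z ∈ msupp (μs i), dist z y < s := by
  have hlf := h.1
  have hw := omega3_pos
  obtain ⟨ν, hν, hV⟩ := exists_vague U μs fun R hR => ⟨_, h.mass hR⟩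
  have hsup : ∀ y, y ∈ msupp ν ↔
      ∀ s : ℝ, 0 < s → ∀ᶠ i in (U : Filter ι), ∃ z ∈ msupp (μs i), dist z y < s := by
    intro y
    constructor
    · intro hy s hs
      by_contra hcon
      rw [← Ultrafilter.eventually_not] at hcon
      have : (ν (closedBall y (s / 4))).toReal ≤ 0 := by
        refine hV.ball_le (t := s / 2) (by linarith) ?_
        filter_upwards [hcon] with i hi
        push Not at hi
        rw [msupp_null_of_disj]; · simp
        intro w hw hw'
        have := hi w hw'
        rw [mem_closedBall] at hw; linarith
      exact absurd (msupp_toReal_pos.1 hy (s / 4) (by positivity)) (not_lt.2 this)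
    · intro hy
      rw [msupp_toReal_pos]
      intro s hs
      have : omega3 / 2 * (s / 4) ^ 3 ≤ (ν (closedBall y s)).toReal := by
        refine hV.le_ball (s := s / 2) (by linarith) ?_
        filter_upwards [hy (s / 4) (by positivity),
          h.2 (‖y‖ + s) (by positivity) (omega3 / 2) (by positivity)] with i ⟨z, hz, hzy⟩ hN
        have h1 : ‖z‖ ≤ ‖y‖ + s := by
          have := norm_le_norm_add_norm_sub y z
          rw [← dist_eq_norm, dist_comm] at this; linarith
        have h2 := (abs_le.1 (hN z hz h1 (s / 4) (by positivity)
          (by have := norm_nonneg y; linarith))).1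
        have h3 : (μs i (closedBall z (s / 4))).toReal ≤ (μs i (closedBall y (s / 2))).toReal :=
          toReal_mono_ball (by linarith)
        linarith
      exact lt_of_lt_of_le (by positivity) this
  refine ⟨ν, hV, ⟨hν, fun x hx s hs => ?_⟩, hsup⟩
  have hx' := (hsup x).1 hx
  have hup : ∀ δ : ℝ, 0 < δ → (ν (closedBall x s)).toReal ≤ (omega3 + δ) * (s + 2 * δ) ^ 3 := by
    intro δ hδ
    refine hV.ball_le (t := s + δ) (by linarith) ?_
    filter_upwards [hx' δ hδ, h.2 (‖x‖ + s + 2 * δ) (by positivity) δ hδ] with i ⟨z, hz, hzx⟩ hN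
    have h1 : ‖z‖ ≤ ‖x‖ + s + 2 * δ := by
      have := norm_le_norm_add_norm_sub x z
      rw [← dist_eq_norm, dist_comm] at this; linarith
    have h2 := (abs_le.1 (hN z hz h1 (s + 2 * δ) (by positivity)
      (by have := norm_nonneg x; linarith))).2
    have h3 : (μs i (closedBall x (s + δ))).toReal ≤ (μs i (closedBall z (s + 2 * δ))).toReal :=
      toReal_mono_ball (by rw [dist_comm]; linarith)
    linarith
  have hlo : ∀ δ : ℝ, 0 < δ → 2 * δ < s →
      (omega3 - δ) * (s - 2 * δ) ^ 3 ≤ (ν (closedBall x s)).toReal := by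
    intro δ hδ hδs
    refine hV.le_ball (s := s - δ) (by linarith) ?_
    filter_upwards [hx' δ hδ, h.2 (‖x‖ + s + 2 * δ) (by positivity) δ hδ] with i ⟨z, hz, hzx⟩ hN
    have h1 : ‖z‖ ≤ ‖x‖ + s + 2 * δ := by
      have := norm_le_norm_add_norm_sub x z
      rw [← dist_eq_norm, dist_comm] at this; linarith
    have h2 := (abs_le.1 (hN z hz h1 (s - 2 * δ) (by linarith)
      (by have := norm_nonneg x; linarith))).1
    have h3 : (μs i (closedBall z (s - 2 * δ))).toReal ≤ (μs i (closedBall x (s - δ))).toReal :=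
      toReal_mono_ball (by linarith)
    linarith
  have hT : Tendsto (fun δ : ℝ => (omega3 + δ) * (s + 2 * δ) ^ 3) (𝓝[>] 0) (𝓝 (omega3 * s ^ 3)) := by
    have : Continuous (fun δ : ℝ => (omega3 + δ) * (s + 2 * δ) ^ 3) := by fun_prop
    have := this.tendsto 0
    simp only [add_zero, mul_zero] at this
    exact this.mono_left nhdsWithin_le_nhds
  have hT2 : Tendsto (fun δ : ℝ => (omega3 - δ) * (s - 2 * δ) ^ 3) (𝓝[>] 0) (𝓝 (omega3 * s ^ 3)) := by
    have : Continuous (fun δ : ℝ => (omega3 - δ) * (s - 2 * δ) ^ 3) := by fun_prop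
    have := this.tendsto 0
    simp only [sub_zero, mul_zero] at this
    exact this.mono_left nhdsWithin_le_nhds
  refine le_antisymm (ge_of_tendsto hT ?_) (le_of_tendsto hT2 ?_)
  · filter_upwards [self_mem_nhdsWithin] with δ hδ using hup δ hδ
  · filter_upwards [self_mem_nhdsWithin, mem_nhdsWithin_of_mem_nhds (Iio_mem_nhds
      (show (0 : ℝ) < s / 2 by positivity))] with δ hδ hδ2
    exact hlo δ hδ (by rw [mem_Iio] at hδ2; linarith)

/-- blow-up -/
def blow (μ : Measure (E 4)) (p : E 4) (h : ℝ) : Measure (E 4) :=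
  ENNReal.ofReal ((h ^ 3)⁻¹) • μ.map (fun w => h⁻¹ • (w - p))

lemma blow_meas (p : E 4) (h : ℝ) : Measurable (fun w : E 4 => h⁻¹ • (w - p)) := by fun_prop

lemma blow_ball (μ : Measure (E 4)) (p : E 4) {h : ℝ} (hh : 0 < h) (y : E 4) (s : ℝ) :
    blow μ p h (closedBall y s) =
      ENNReal.ofReal ((h ^ 3)⁻¹) * μ (closedBall (p + h • y) (h * s)) := by
  rw [blow, Measure.smul_apply, Measure.map_apply (blow_meas p h) measurableSet_closedBall,
    smul_eq_mul]
  congr 2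
  ext w
  rw [mem_preimage, mem_closedBall, mem_closedBall, dist_eq_norm, dist_eq_norm]
  have : h⁻¹ • (w - p) - y = h⁻¹ • (w - (p + h • y)) := by
    rw [← sub_sub, smul_sub h⁻¹ (w - p), smul_smul, inv_mul_cancel₀ hh.ne', one_smul]
  rw [this, norm_smul, Real.norm_eq_abs, abs_of_pos (inv_pos.2 hh), inv_mul_le_iff₀ hh]

lemma blow_ball_toReal (μ : Measure (E 4)) (p : E 4) {h : ℝ} (hh : 0 < h) (y : E 4) (s : ℝ) :
    (blow μ p h (closedBall y s)).toReal =
      (h ^ 3)⁻¹ * (μ (closedBall (p + h • y) (h * s))).toReal := by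
  rw [blow_ball μ p hh, ENNReal.toReal_mul, ENNReal.toReal_ofReal (by positivity)]

lemma blow_msupp (μ : Measure (E 4)) (p : E 4) {h : ℝ} (hh : 0 < h) (y : E 4) :
    y ∈ msupp (blow μ p h) ↔ p + h • y ∈ msupp μ := by
  have h3 : 0 < ENNReal.ofReal ((h ^ 3)⁻¹) := by rw [ENNReal.ofReal_pos]; positivity
  constructor
  · intro hy r hr
    have := hy (h⁻¹ * r) (by positivity)
    rw [blow_ball μ p hh, mul_inv_cancel_left₀ hh.ne'] at this
    exact pos_of_ne_zero fun h0 => by simp [h0] at this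
  · intro hy r hr
    rw [blow_ball μ p hh]
    exact ENNReal.mul_pos h3.ne' (hy (h * r) (by positivity)).ne'

lemma blow_lf (μ : Measure (E 4)) [IsLocallyFiniteMeasure μ] (p : E 4) {h : ℝ} (hh : 0 < h) :
    IsLocallyFiniteMeasure (blow μ p h) := by
  refine ⟨fun x => ⟨closedBall x 1, closedBall_mem_nhds x one_pos, ?_⟩⟩
  rw [blow_ball μ p hh]
  exact ENNReal.mul_lt_top ENNReal.ofReal_lt_top measure_closedBall_lt_top

lemma blow_integral (μ : Measure (E 4)) (p : E 4) {h : ℝ} (hh : 0 < h) (f : E 4 → ℝ) :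
    ∫ y, f y ∂(blow μ p h) = (h ^ 3)⁻¹ * ∫ w, f (h⁻¹ • (w - p)) ∂μ := by
  have he : MeasurableEmbedding (fun w : E 4 => h⁻¹ • (w - p)) :=
    ((Homeomorph.subRight p).trans
      (Homeomorph.smulOfNeZero h⁻¹ (inv_ne_zero hh.ne'))).measurableEmbedding
  rw [blow, integral_smul_measure, he.integral_map, ENNReal.toReal_ofReal (by positivity),
    smul_eq_mul]

lemma Unif.blow {ν : Measure (E 4)} (h : Unif ν) (p : E 4) {t : ℝ} (ht : 0 < t) :
    Unif (blow ν p t) := by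
  have := h.1
  refine ⟨blow_lf ν p ht, fun x hx s hs => ?_⟩
  rw [blow_ball_toReal ν p ht, h.2 _ ((blow_msupp ν p ht x).1 hx) _ (by positivity)]
  field_simp

lemma Unif.NU {ν : Measure (E 4)} (h : Unif ν) {ε : ℝ} (hε : 0 ≤ ε) (R : ℝ) : NU ε R ν := by
  intro y hy _ s hs _
  rw [h.2 y hy s hs, sub_self, abs_zero]; positivity

lemma AU.of_unif {ι : Type*} {U : Filter ι} {μs : ι → Measure (E 4)} (h : ∀ i, Unif (μs i)) :
    AU U μs := ⟨fun i => (h i).1, fun R _ _ hε => .of_forall fun i => (h i).NU hε.le R⟩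

/-- the standing regularity assumption, at unit scale -/
def HReg (μ : Measure (E 4)) (C α : ℝ) : Prop :=
  IsLocallyFiniteMeasure μ ∧ 0 ∈ msupp μ ∧ 0 < α ∧ 0 ≤ C ∧
  ∀ x ∈ msupp μ, ‖x‖ ≤ 1 → ∀ r : ℝ, 0 < r → r ≤ 1 →
    |(μ (closedBall x r)).toReal - omega3 * r ^ 3| ≤ C * r ^ α * r ^ 3

lemma AU.of_reg {ι : Type*} {U : Filter ι} {μ : Measure (E 4)} {C α : ℝ} (H : HReg μ C α)
    {p : ι → E 4} {t : ι → ℝ} (ht : ∀ i, 0 < t i) (hp : Tendsto p U (𝓝 0))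
    (ht0 : Tendsto t U (𝓝 0)) : AU U fun i => _root_.blow μ (p i) (t i) := by
  obtain ⟨hlf, h0, hα, hC, H⟩ := H
  refine ⟨fun i => blow_lf μ _ (ht i), fun R hR ε hε => ?_⟩
  have h1 : ∀ᶠ i in U, ‖p i‖ + t i * R < 1 := by
    have : Tendsto (fun i => ‖p i‖ + t i * R) U (𝓝 (‖(0 : E 4)‖ + 0 * R)) :=
      hp.norm.add (ht0.mul_const R)
    simp only [norm_zero, zero_mul, add_zero] at this
    exact this.eventually_lt_const one_pos
  have h2 : ∀ᶠ i in U, C * (t i * R) ^ α < ε := by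
    have : Tendsto (fun i => C * (t i * R) ^ α) U (𝓝 (C * (0 * R) ^ α)) :=
      ((ht0.mul_const R).rpow_const (Or.inr hα.le)).const_mul C
    rw [zero_mul, Real.zero_rpow hα.ne', mul_zero] at this
    exact this.eventually_lt_const hε
  filter_upwards [h1, h2] with i hi1 hi2 y hy hyR s hs hsR
  have hti := ht i
  have hy' := (blow_msupp μ _ hti y).1 hy
  have hn : ‖p i + t i • y‖ ≤ 1 := by
    refine (norm_add_le _ _).trans ?_
    rw [norm_smul, Real.norm_eq_abs, abs_of_pos hti]
    nlinarith
  have hsR' : t i * s ≤ t i * R := by gcongr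
  have := H _ hy' hn (t i * s) (by positivity) (by have := norm_nonneg (p i); linarith)
  rw [blow_ball_toReal μ _ hti]
  have h3 : (t i ^ 3)⁻¹ * (μ (closedBall (p i + t i • y) (t i * s))).toReal - omega3 * s ^ 3
     = (t i ^ 3)⁻¹ * ((μ (closedBall (p i + t i • y) (t i * s))).toReal - omega3 * (t i * s) ^ 3) := by
    field_simp
  rw [h3, abs_mul, abs_of_pos (by positivity), inv_mul_le_iff₀ (by positivity)]
  refine this.trans ?_
  have h4 : (t i * s) ^ α ≤ (t i * R) ^ α := Real.rpow_le_rpow (by positivity) hsR' hα.le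
  have h5 : C * (t i * s) ^ α ≤ ε := (mul_le_mul_of_nonneg_left h4 hC).trans hi2.le
  calc C * (t i * s) ^ α * (t i * s) ^ 3 ≤ ε * (t i * s) ^ 3 := by gcongr
    _ = t i ^ 3 * (ε * s ^ 3) := by ring

lemma rn_le {n : ℕ} {κ ρ : Measure (E n)} [IsLocallyFiniteMeasure κ] [IsLocallyFiniteMeasure ρ]
    {T : Set (E n)} (h0 : κ Tᶜ = 0) {s0 : ℝ} (hs0 : 0 < s0)
    (hpos : ∀ x ∈ T, ∀ s : ℝ, 0 < s → κ (closedBall x s) ≠ 0)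
    (h : ∀ x ∈ T, ∀ s : ℝ, 0 < s → s ≤ s0 → κ (closedBall x s) = ρ (closedBall x s)) :
    κ ≤ ρ := by
  have h1 : ∀ᵐ x ∂κ, ρ.rnDeriv κ x = 1 := by
    have hT : ∀ᵐ x ∂κ, x ∈ T := h0
    filter_upwards [Besicovitch.ae_tendsto_rnDeriv ρ κ, hT] with x hx hxT
    refine tendsto_nhds_unique hx ?_
    refine tendsto_const_nhds.congr' ?_
    filter_upwards [Ioc_mem_nhdsGT hs0] with s hs
    rw [← h x hxT s hs.1 hs.2, ENNReal.div_self (hpos x hxT s hs.1) measure_closedBall_lt_top.ne]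
  calc κ = κ.withDensity 1 := withDensity_one.symm
    _ = κ.withDensity (ρ.rnDeriv κ) := withDensity_congr_ae (by
        filter_upwards [h1] with x hx; simp [hx])
    _ ≤ ρ := Measure.withDensity_rnDeriv_le ρ κ

theorem LFL {n : ℕ} {κ : Measure (E n)} [IsLocallyFiniteMeasure κ] {T : Set (E n)}
    (hT : IsClosed T) (hne : T.Nonempty) (h0 : κ Tᶜ = 0) {s0 : ℝ} (hs0 : 0 < s0)
    (h : ∀ x ∈ T, ∀ s : ℝ, 0 < s → s ≤ s0 → κ (closedBall x s) = volume (closedBall x s)) :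
    T = univ ∧ κ = volume := by
  have hle : κ ≤ volume := by
    refine rn_le h0 hs0 (fun x hx s hs hz => ?_) h
    have h1 := h x hx (min s s0) (by positivity) (min_le_right _ _)
    have h2 : κ (closedBall x (min s s0)) = 0 :=
      measure_mono_null (closedBall_subset_closedBall (min_le_left _ _)) hz
    rw [h2] at h1
    exact (measure_closedBall_pos (volume : Measure (E n)) x (lt_min hs hs0)).ne h1
  have hop : IsOpen T := by
    rw [Metric.isOpen_iff]
    refine fun x hx => ⟨s0, hs0, ?_⟩
    have h1 : volume (closedBall x s0 \ T) = 0 := by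
      have e1 : κ (closedBall x s0) = κ (closedBall x s0 ∩ T) := by
        have e0 : κ (closedBall x s0 \ T) = 0 := measure_mono_null (fun w hw => hw.2) h0
        rw [← measure_inter_add_sdiff (closedBall x s0) hT.measurableSet, e0, add_zero]
      have e2 := measure_inter_add_sdiff (μ := volume) (closedBall x s0) hT.measurableSet
      have e3 : volume (closedBall x s0) ≤ volume (closedBall x s0 ∩ T) := by
        rw [← h x hx s0 hs0 le_rfl, e1]; exact hle _
      have hfin : volume (closedBall x s0 ∩ T) ≠ ⊤ :=
        ((measure_mono inter_subset_left).trans_lt measure_closedBall_lt_top).ne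
      have e4 : volume (closedBall x s0 ∩ T) + volume (closedBall x s0 \ T) ≤
          volume (closedBall x s0 ∩ T) + 0 := by rw [e2, add_zero]; exact e3
      exact nonpos_iff_eq_zero.1 ((ENNReal.add_le_add_iff_left hfin).1 e4)
    have h2 : volume (ball x s0 \ T) = 0 :=
      measure_mono_null (sdiff_subset_sdiff_left ball_subset_closedBall) h1
    have h3 := (isOpen_ball.sdiff hT).measure_eq_zero_iff (volume : Measure (E n)) |>.1 h2
    exact sdiff_eq_empty.1 h3
  have hu : T = univ := IsClopen.eq_univ ⟨hT, hop⟩ hne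
  refine ⟨hu, le_antisymm hle ?_⟩
  refine rn_le (T := T) (by simp [hu]) hs0
    (fun x _ s hs => (measure_closedBall_pos _ x hs).ne') fun x hx s hs hs' => (h x hx s hs hs').symm

lemma vol3 (x : E 3) {s : ℝ} (hs : 0 ≤ s) : volume (closedBall x s) = ENNReal.ofReal (omega3 * s ^ 3) := by
  rw [Measure.addHaar_closedBall _ _ hs, finrank_euclideanSpace_fin, mul_comm,
    ENNReal.ofReal_mul omega3_pos.le]
  congr 1
  unfold omega3 unitBallVol
  rw [ENNReal.ofReal_toReal measure_ball_lt_top.ne]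

lemma exists_hyper_emb (n : E 4) (hn : n ≠ 0) : ∃ J : E 3 →ₗᵢ[ℝ] E 4, ∀ x, ⟪n, x⟫ = 0 ↔ ∃ y, J y = x := by
  have hf : finrank ℝ (ℝ ∙ n)ᗮ = 3 := by
    have : Fact (finrank ℝ (E 4) = 3 + 1) := ⟨by simp⟩
    exact Submodule.finrank_orthogonal_span_singleton hn
  let b := (stdOrthonormalBasis ℝ (ℝ ∙ n)ᗮ).reindex (finCongr hf)
  refine ⟨((ℝ ∙ n)ᗮ.subtypeₗᵢ).comp b.repr.symm.toLinearIsometry, fun x => ?_⟩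
  rw [← Submodule.mem_orthogonal_singleton_iff_inner_right]
  constructor
  · intro hx
    exact ⟨b.repr ⟨x, hx⟩, by simp⟩
  · rintro ⟨y, rfl⟩
    exact (b.repr.symm y).2

theorem FLloc {ν : Measure (E 4)} [IsLocallyFiniteMeasure ν] {n : E 4} (hn : n ≠ 0)
    {s0 : ℝ} (hs0 : 0 < s0) (hne : ∃ x ∈ msupp ν, ⟪n, x⟫ = 0)
    (h : ∀ x ∈ msupp ν, ⟪n, x⟫ = 0 → ∀ s : ℝ, 0 < s → s ≤ s0 →
      ν (closedBall x s ∩ {w | ⟪n, w⟫ = 0}) = ENNReal.ofReal (omega3 * s ^ 3)) :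
    (∀ x, ⟪n, x⟫ = 0 → x ∈ msupp ν) ∧ ∀ x, ⟪n, x⟫ = 0 → ∀ s : ℝ, 0 < s →
      ν (closedBall x s ∩ {w | ⟪n, w⟫ = 0}) = ENNReal.ofReal (omega3 * s ^ 3) := by
  obtain ⟨J, hJ⟩ := exists_hyper_emb n hn
  have hme : MeasurableEmbedding J := J.isometry.isClosedEmbedding.measurableEmbedding
  have him : ∀ (x : E 3) (s : ℝ), J '' closedBall x s = closedBall (J x) s ∩ {w | ⟪n, w⟫ = 0} := by
    intro x s
    ext w
    constructor
    · rintro ⟨y, hy, rfl⟩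
      exact ⟨by rw [mem_closedBall, J.isometry.dist_eq]; exact hy, (hJ _).2 ⟨y, rfl⟩⟩
    · rintro ⟨hw, hw2⟩
      obtain ⟨y, rfl⟩ := (hJ w).1 hw2
      exact ⟨y, by rw [mem_closedBall, J.isometry.dist_eq] at hw; exact hw, rfl⟩
  have hap : ∀ A, ν.comap J A = ν (J '' A) := fun A => hme.comap_apply ν A
  have hlf : IsLocallyFiniteMeasure (ν.comap J) := by
    refine ⟨fun x => ⟨closedBall x 1, closedBall_mem_nhds x one_pos, ?_⟩⟩
    rw [hap, him]
    exact (measure_mono inter_subset_left).trans_lt measure_closedBall_lt_top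
  obtain ⟨x0, hx0, hx0n⟩ := hne
  obtain ⟨y0, rfl⟩ := (hJ x0).1 hx0n
  obtain ⟨hu, hv⟩ := LFL (κ := ν.comap J) (T := J ⁻¹' msupp ν)
    ((msupp_closed ν).preimage J.continuous) ⟨y0, hx0⟩
    (by
      rw [hap]
      refine measure_mono_null ?_ (msupp_compl_null ν)
      rintro _ ⟨y, hy, rfl⟩; exact hy) hs0
    (fun x hx s hs hs' => by
      rw [hap, him, h _ hx ((hJ _).2 ⟨x, rfl⟩) s hs hs', vol3 x hs.le])
  refine ⟨fun x hx => ?_, fun x hx s hs => ?_⟩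
  · obtain ⟨y, rfl⟩ := (hJ x).1 hx
    have : y ∈ J ⁻¹' msupp ν := hu ▸ mem_univ y
    exact this
  · obtain ⟨y, rfl⟩ := (hJ x).1 hx
    rw [← him, ← hap, hv, vol3 y hs.le]

lemma Unif.ball {ν : Measure (E 4)} (h : Unif ν) {x : E 4} (hx : x ∈ msupp ν) {s : ℝ} (hs : 0 < s) :
    ν (closedBall x s) = ENNReal.ofReal (omega3 * s ^ 3) := by
  have := h.1
  rw [← h.2 x hx s hs, ENNReal.ofReal_toReal measure_closedBall_lt_top.ne]

lemma measure_inter_msupp {n : ℕ} {ν : Measure (E n)} {A B : Set (E n)}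
    (h : ∀ w ∈ A, w ∈ msupp ν → w ∈ B) : ν (A ∩ B) = ν A := by
  refine le_antisymm (measure_mono inter_subset_left) ?_
  calc ν A ≤ ν ((A ∩ B) ∪ (msupp ν)ᶜ) := measure_mono fun w hw => by
        by_cases h2 : w ∈ msupp ν
        · exact Or.inl ⟨hw, h w hw h2⟩
        · exact Or.inr h2
    _ ≤ ν (A ∩ B) + ν (msupp ν)ᶜ := measure_union_le _ _
    _ = ν (A ∩ B) := by rw [msupp_compl_null, add_zero]

theorem FL {ν : Measure (E 4)} (hν : Unif ν) {n : E 4} (hn : n ≠ 0) (hne : (msupp ν).Nonempty)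
    (h : ∀ x ∈ msupp ν, ⟪n, x⟫ = 0) : ∀ x, ⟪n, x⟫ = 0 → x ∈ msupp ν := by
  have := hν.1
  obtain ⟨x, hx⟩ := hne
  refine (FLloc hn one_pos ⟨x, hx, h x hx⟩ fun x hx _ s hs _ => ?_).1
  rw [measure_inter_msupp (B := {w | ⟪n, w⟫ = 0}) fun w _ hw => h w hw, hν.ball hx hs]

lemma ultra_lim {ι : Type*} (U : Ultrafilter ι) (y : ι → E 4) {R : ℝ}
    (h : ∀ᶠ i in (U : Filter ι), ‖y i‖ ≤ R) : ∃ y0, Tendsto y U (𝓝 y0) := by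
  obtain ⟨l, -, hl⟩ := (isCompact_closedBall (0 : E 4) R).ultrafilter_le_nhds
    (U.map y) (by
      rw [Ultrafilter.coe_map, le_principal_iff]
      exact h.mono fun i hi => by simpa using hi)
  exact ⟨l, hl⟩

theorem NH {ι : Type*} (U : Ultrafilter ι) (μs : ι → Measure (E 4)) (h : AU (U : Filter ι) μs)
    (h1 : ∀ᶠ i in (U : Filter ι), ∀ y ∈ msupp (μs i), 1 ≤ ‖y‖)
    (h2 : ∀ᶠ i in (U : Filter ι), ∃ y ∈ msupp (μs i), ‖y‖ ≤ 1)
    (n : ι → E 4) (hn : ∀ᶠ i in (U : Filter ι), ‖n i‖ = 1)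
    (h3 : ∀ R : ℝ, 0 < R → ∀ η : ℝ, 0 < η → ∀ᶠ i in (U : Filter ι), ∀ y ∈ msupp (μs i), ‖y‖ ≤ R →
      |⟪n i, y⟫| ≤ η) : False := by
  obtain ⟨ν, hV, hU, hS⟩ := BU U μs h
  obtain ⟨n0, hn0⟩ := ultra_lim U n (R := 1) (hn.mono fun i hi => hi.le)
  have hn1 : ‖n0‖ = 1 := tendsto_nhds_unique hn0.norm
    (tendsto_const_nhds.congr' (hn.mono fun i hi => hi.symm))
  have hne : ∃ y, y ∈ msupp ν := by
    have : ∃ y : ι → E 4, ∀ᶠ i in (U : Filter ι), y i ∈ msupp (μs i) ∧ ‖y i‖ ≤ 1 := by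
      classical
      refine ⟨fun i => if hi : ∃ y ∈ msupp (μs i), ‖y‖ ≤ 1 then hi.choose else 0, ?_⟩
      filter_upwards [h2] with i hi
      rw [dif_pos hi]
      exact hi.choose_spec
    obtain ⟨y, hy⟩ := this
    obtain ⟨y0, hy0⟩ := ultra_lim U y (R := 1) (hy.mono fun i hi => hi.2)
    refine ⟨y0, (hS y0).2 fun s hs => ?_⟩
    filter_upwards [hy, (Metric.tendsto_nhds.1 hy0) s hs] with i hi hi'
    exact ⟨y i, hi.1, hi'⟩
  have hperp : ∀ x ∈ msupp ν, ⟪n0, x⟫ = 0 := by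
    intro x hx
    by_contra hx0
    have hpos : 0 < |⟪n0, x⟫| := abs_pos.2 hx0
    set η := |⟪n0, x⟫| / 4 with hη
    have hηp : 0 < η := by positivity
    have hlim : Tendsto (fun i => ⟪n i, x⟫) U (𝓝 ⟪n0, x⟫) := hn0.inner tendsto_const_nhds
    obtain ⟨i, ⟨z, hz, hzx⟩, hi2, hi3, hi4⟩ := (((hS x).1 hx (min η 1) (by positivity)).and
      ((h3 (‖x‖ + 1) (by positivity) η hηp).and
        ((Metric.tendsto_nhds.1 hlim η hηp).and hn))).exists
    have hzn : ‖z‖ ≤ ‖x‖ + 1 := by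
      have := norm_le_norm_add_norm_sub x z
      rw [← dist_eq_norm, dist_comm] at this
      linarith [lt_min_iff.1 hzx]
    have e1 := hi2 z hz hzn
    have e2 : |⟪n i, z - x⟫| ≤ η := by
      refine (abs_real_inner_le_norm _ _).trans ?_
      rw [hi4, one_mul, ← dist_eq_norm]; linarith [lt_min_iff.1 hzx]
    rw [Real.dist_eq] at hi3
    rw [inner_sub_right] at e2
    have := abs_sub_abs_le_abs_sub ⟪n0, x⟫ ⟪n i, x⟫
    rw [abs_sub_comm ⟪n0, x⟫] at this
    have h5 := abs_sub_abs_le_abs_sub ⟪n i, x⟫ ⟪n i, z⟫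
    rw [abs_sub_comm ⟪n i, x⟫] at h5
    linarith
  have h0 : (0 : E 4) ∈ msupp ν :=
    FL hU (by rw [← norm_ne_zero_iff, hn1]; exact one_ne_zero) hne hperp 0 (by simp)
  obtain ⟨i, hi, z, hz, hz0⟩ := (h1.and ((hS 0).1 h0 1 one_pos)).exists
  have := hi z hz
  rw [dist_zero_right] at hz0
  linarith

lemma blow_gap {μ : Measure (E 4)} (hne : (msupp μ).Nonempty) {p : E 4} {t : ℝ} (ht : 0 < t)
    (h : infDist p (msupp μ) = t) :
    (∀ y ∈ msupp (blow μ p t), 1 ≤ ‖y‖) ∧ ∃ y ∈ msupp (blow μ p t), ‖y‖ ≤ 1 := by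
  constructor
  · intro y hy
    have h1 := infDist_le_dist_of_mem (x := p) ((blow_msupp μ p ht y).1 hy)
    rw [h, dist_self_add_right, norm_smul, Real.norm_eq_abs, abs_of_pos ht] at h1
    exact le_of_mul_le_mul_left (by linarith) ht
  · obtain ⟨q, hq, hpq⟩ := (msupp_closed μ).exists_infDist_eq_dist hne p
    refine ⟨t⁻¹ • (q - p), ?_, ?_⟩
    · rw [blow_msupp μ p ht, smul_inv_smul₀ ht.ne']; simpa using hq
    · rw [norm_smul, Real.norm_eq_abs, abs_of_pos (inv_pos.2 ht), ← dist_eq_norm, dist_comm, ← hpq, h,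
        inv_mul_cancel₀ ht.ne']

theorem NHloc {ν : Measure (E 4)} (hν : Unif ν) {x0 : E 4} (hx0 : x0 ∈ msupp ν) {M : Set (E 4)}
    {ε0 : ℝ} (hε0 : 0 < ε0) (hM : ∀ x ∈ msupp ν, dist x x0 < ε0 → x ∈ M) {n : E 4} (hn : ‖n‖ = 1)
    (hflat : ∀ η : ℝ, 0 < η → ∃ ε : ℝ, 0 < ε ∧ ∀ p ∈ M, ∀ y ∈ M, dist p x0 < ε → dist y x0 < ε →
      |⟪n, y - p⟫| ≤ η * ‖y - p‖) : ∃ ε : ℝ, 0 < ε ∧ ∀ p ∈ M, dist p x0 < ε → p ∈ msupp ν := by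
  by_contra hcon
  push Not at hcon
  choose p hpM hpx hpS using fun k : ℕ => hcon (1 / ((k : ℝ) + 1)) (by positivity)
  have hne : (msupp ν).Nonempty := ⟨x0, hx0⟩
  have ht : ∀ k, 0 < infDist (p k) (msupp ν) := fun k =>
    ((msupp_closed ν).notMem_iff_infDist_pos hne).1 (hpS k)
  have hp0 : Tendsto (fun k => dist (p k) x0) (hyperfilter ℕ : Filter ℕ) (𝓝 0) := by
    refine Tendsto.mono_left ?_ Nat.hyperfilter_le_atTop
    exact squeeze_zero (fun _ => dist_nonneg) (fun k => (hpx k).le) tendsto_one_div_add_atTop_nhds_zero_nat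
  have ht0 : Tendsto (fun k => infDist (p k) (msupp ν)) (hyperfilter ℕ : Filter ℕ) (𝓝 0) :=
    squeeze_zero (fun _ => infDist_nonneg) (fun k => infDist_le_dist_of_mem hx0) hp0
  refine NH (hyperfilter ℕ) (fun k => blow ν (p k) (infDist (p k) (msupp ν)))
    (AU.of_unif fun k => hν.blow _ (ht k)) (.of_forall fun k => (blow_gap hne (ht k) rfl).1)
    (.of_forall fun k => (blow_gap hne (ht k) rfl).2) (fun _ => n) (.of_forall fun _ => hn) ?_
  intro R hR η hη
  obtain ⟨ε, hε, hfl⟩ := hflat (η / R) (by positivity)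
  have hlim : Tendsto (fun k => dist (p k) x0 + infDist (p k) (msupp ν) * R)
      (hyperfilter ℕ : Filter ℕ) (𝓝 0) := by
    simpa using hp0.add (ht0.mul_const R)
  filter_upwards [hlim.eventually_lt_const (lt_min hε hε0)] with k hk y hy hyR
  have htk := ht k
  set t := infDist (p k) (msupp ν)
  have hq := (blow_msupp ν (p k) htk y).1 hy
  have hqx : dist (p k + t • y) x0 < min ε ε0 := by
    refine lt_of_le_of_lt ?_ hk
    refine (dist_triangle _ (p k) _).trans ?_
    rw [dist_self_add_left, norm_smul, Real.norm_eq_abs, abs_of_pos htk, add_comm]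
    gcongr
  have := hfl (p k) (hpM k) _ (hM _ hq (lt_min_iff.1 hqx).2)
    (by have : 0 ≤ t * R := by positivity
        linarith [lt_min_iff.1 hk]) (lt_min_iff.1 hqx).1
  rw [add_sub_cancel_left, inner_smul_right, abs_mul, abs_of_pos htk, norm_smul, Real.norm_eq_abs,
    abs_of_pos htk] at this
  have h6 : |⟪n, y⟫| ≤ η / R * ‖y‖ := le_of_mul_le_mul_left (by linarith) htk
  calc |⟪n, y⟫| ≤ η / R * ‖y‖ := h6
    _ ≤ η / R * R := by gcongr
    _ = η := by field_simp

lemma superlevel {φ : ℝ → ℝ} (hc : Continuous φ) (hanti : AntitoneOn φ (Ici 0)) {t R : ℝ}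
    (hR : ∀ s, R < s → φ s < t) :
    (∀ s, 0 ≤ s → φ s < t) ∨ ∃ ρ, 0 ≤ ρ ∧ ρ ≤ R ∧ ∀ s, 0 ≤ s → (t ≤ φ s ↔ s ≤ ρ) := by
  by_cases hne : ∃ s, 0 ≤ s ∧ t ≤ φ s
  · right
    have hcl : IsClosed {s | 0 ≤ s ∧ t ≤ φ s} :=
      (isClosed_le continuous_const continuous_id).inter (isClosed_le continuous_const hc)
    have hbd : BddAbove {s | 0 ≤ s ∧ t ≤ φ s} := ⟨R, fun s hs => by
      by_contra h; push Not at h; exact absurd hs.2 (not_le.2 (hR s h))⟩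
    have hm := hcl.csSup_mem hne hbd
    refine ⟨sSup {s | 0 ≤ s ∧ t ≤ φ s}, hm.1, ?_, fun s hs => ⟨fun h => le_csSup hbd ⟨hs, h⟩, fun h => ?_⟩⟩
    · by_contra h; push Not at h; exact absurd hm.2 (not_le.2 (hR _ h))
    · exact hm.2.trans (hanti hs hm.1 h)
  · left
    push Not at hne
    exact hne

def BE (μ : Measure (E 4)) (y : E 4) (ε R : ℝ) : Prop :=
  ∀ s : ℝ, 0 < s → s ≤ R → |(μ (closedBall y s)).toReal - omega3 * s ^ 3| ≤ ε * s ^ 3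

lemma BE.point {μ : Measure (E 4)} [IsLocallyFiniteMeasure μ] {y : E 4} {ε R : ℝ} (hR : 0 < R)
    (h : BE μ y ε R) : μ (closedBall y 0) = 0 := by
  have h1 : (μ (closedBall y 0)).toReal ≤ 0 := by
    have hT : Tendsto (fun s : ℝ => (omega3 + ε) * s ^ 3) (𝓝[>] 0) (𝓝 0) := by
      have : Continuous (fun s : ℝ => (omega3 + ε) * s ^ 3) := by fun_prop
      have := this.tendsto 0
      simp only [ne_eq, OfNat.ofNat_ne_zero, not_false_eq_true, zero_pow, mul_zero] at this
      exact this.mono_left nhdsWithin_le_nhds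
    refine ge_of_tendsto hT ?_
    filter_upwards [Ioc_mem_nhdsGT hR] with s hs
    have h2 := (abs_le.1 (h s hs.1 hs.2)).2
    have h3 : (μ (closedBall y 0)).toReal ≤ (μ (closedBall y s)).toReal :=
      toReal_mono_ball (by rw [dist_self]; linarith [hs.1])
    linarith
  have h2 := le_antisymm h1 ENNReal.toReal_nonneg
  rw [ENNReal.toReal_eq_zero_iff] at h2
  exact h2.resolve_right measure_closedBall_lt_top.ne

theorem RAD {μ : Measure (E 4)} [IsLocallyFiniteMeasure μ] {y : E 4} {ε : ℝ} (hε : 0 ≤ ε)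
    {φ : ℝ → ℝ} (hc : Continuous φ) (hanti : AntitoneOn φ (Ici 0)) (h0 : ∀ s, 0 ≤ φ s)
    (hb : ∀ t : ℝ, 0 < t → ∃ R, 0 < R ∧ (∀ s, R < s → φ s < t) ∧ BE μ y ε R)
    (hint : Integrable (fun v : E 3 => φ ‖v‖)) :
    Integrable (fun w => φ (dist w y)) μ ∧
      |∫ w, φ (dist w y) ∂μ - ∫ v : E 3, φ ‖v‖| ≤ ε / omega3 * ∫ v : E 3, φ ‖v‖ := by
  have hw := omega3_pos
  set e := ε / omega3 with he
  have he0 : 0 ≤ e := by positivity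
  have hlev : ∀ t : ℝ, 0 < t →
      μ {w | t ≤ φ (dist w y)} ≤ ENNReal.ofReal (1 + e) * volume {v : E 3 | t ≤ φ ‖v‖} ∧
      volume {v : E 3 | t ≤ φ ‖v‖} ≤ μ {w | t ≤ φ (dist w y)} +
        ENNReal.ofReal e * volume {v : E 3 | t ≤ φ ‖v‖} := by
    intro t ht
    obtain ⟨R, hR0, hR, hBE⟩ := hb t ht
    rcases superlevel hc hanti hR with h | ⟨ρ, hρ0, hρR, h⟩
    · have e1 : {w | t ≤ φ (dist w y)} = ∅ := by
        ext w; simp [h _ dist_nonneg]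
      have e2 : {v : E 3 | t ≤ φ ‖v‖} = ∅ := by
        ext w; simp [h _ (norm_nonneg _)]
      simp [e1, e2]
    · have e1 : {w | t ≤ φ (dist w y)} = closedBall y ρ := by
        ext w; simp [h _ dist_nonneg]
      have e2 : {v : E 3 | t ≤ φ ‖v‖} = closedBall 0 ρ := by
        ext w; simp [h _ (norm_nonneg _)]
      rw [e1, e2, vol3 0 hρ0]
      rcases hρ0.eq_or_lt with hz | hpos
      · rw [← hz, hBE.point hR0]; simp
      · have h3 := abs_le.1 (hBE ρ hpos hρR)
        have e3 : μ (closedBall y ρ) = ENNReal.ofReal (μ (closedBall y ρ)).toReal :=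
          (ENNReal.ofReal_toReal measure_closedBall_lt_top.ne).symm
        have e4 : ε * ρ ^ 3 = e * (omega3 * ρ ^ 3) := by rw [he]; field_simp
        rw [e3, ← ENNReal.ofReal_mul (by positivity), ← ENNReal.ofReal_mul he0,
          ← ENNReal.ofReal_add ENNReal.toReal_nonneg (by positivity)]
        constructor <;> apply ENNReal.ofReal_le_ofReal <;> nlinarith
  have m1 : Measurable (fun w : E 4 => φ (dist w y)) := by fun_prop
  have m2 : Measurable (fun v : E 3 => φ ‖v‖) := by fun_prop
  have l1 := lintegral_eq_lintegral_meas_le μ (f := fun w => φ (dist w y))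
    (.of_forall fun w => h0 _) m1.aemeasurable
  have l2 := lintegral_eq_lintegral_meas_le volume (f := fun v : E 3 => φ ‖v‖)
    (.of_forall fun w => h0 _) m2.aemeasurable
  have meas2 : Measurable fun t : ℝ => volume {v : E 3 | t ≤ φ ‖v‖} :=
    Antitone.measurable fun a b hab => measure_mono fun v (hv : b ≤ φ ‖v‖) => hab.trans hv
  have meas1 : Measurable fun t : ℝ => μ {w : E 4 | t ≤ φ (dist w y)} :=
    Antitone.measurable fun a b hab => measure_mono fun v (hv : b ≤ φ (dist v y)) => hab.trans hv
  have u1 : ∫⁻ w, ENNReal.ofReal (φ (dist w y)) ∂μ ≤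
      ENNReal.ofReal (1 + e) * ∫⁻ v : E 3, ENNReal.ofReal (φ ‖v‖) := by
    rw [l1, l2, ← lintegral_const_mul _ meas2]
    exact setLIntegral_mono' measurableSet_Ioi fun t ht => (hlev t ht).1
  have u2 : ∫⁻ v : E 3, ENNReal.ofReal (φ ‖v‖) ≤ ∫⁻ w, ENNReal.ofReal (φ (dist w y)) ∂μ +
      ENNReal.ofReal e * ∫⁻ v : E 3, ENNReal.ofReal (φ ‖v‖) := by
    rw [l1, l2, ← lintegral_const_mul _ meas2, ← lintegral_add_left meas1]
    exact setLIntegral_mono' measurableSet_Ioi fun t ht => (hlev t ht).2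
  have fin2 : ∫⁻ v : E 3, ENNReal.ofReal (φ ‖v‖) ≠ ⊤ := by
    have := hint.lintegral_lt_top
    exact this.ne
  have fin1 : ∫⁻ w, ENNReal.ofReal (φ (dist w y)) ∂μ ≠ ⊤ :=
    (u1.trans_lt (ENNReal.mul_lt_top ENNReal.ofReal_lt_top fin2.lt_top)).ne
  refine ⟨(lintegral_ofReal_ne_top_iff_integrable m1.aestronglyMeasurable
    (.of_forall fun w => h0 _)).1 fin1, ?_⟩
  rw [integral_eq_lintegral_of_nonneg_ae (.of_forall fun w => h0 _) m1.aestronglyMeasurable,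
    integral_eq_lintegral_of_nonneg_ae (.of_forall fun w => h0 _) m2.aestronglyMeasurable]
  have v1 := ENNReal.toReal_mono (ENNReal.mul_ne_top ENNReal.ofReal_ne_top fin2) u1
  have v2 := ENNReal.toReal_mono (ENNReal.add_ne_top.2
    ⟨fin1, ENNReal.mul_ne_top ENNReal.ofReal_ne_top fin2⟩) u2
  rw [ENNReal.toReal_add fin1 (ENNReal.mul_ne_top ENNReal.ofReal_ne_top fin2)] at v2
  rw [ENNReal.toReal_mul, ENNReal.toReal_ofReal (by positivity)] at v1 v2
  rw [abs_le]; constructor <;> linarith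

/-- the kernel -/
def ap (r : ℝ) (s : ℝ) : ℝ := max (r ^ 2 - s ^ 2) 0

lemma ap_cont (r : ℝ) : Continuous (ap r) := by unfold ap; fun_prop
lemma ap_nonneg (r s : ℝ) : 0 ≤ ap r s := le_max_right _ _
lemma ap_le (r s : ℝ) : ap r s ≤ r ^ 2 := max_le (by nlinarith) (by positivity)
lemma ap_zero {r s : ℝ} (hr : 0 ≤ r) (h : r ≤ s) : ap r s = 0 :=
  max_eq_right (by nlinarith)
lemma ap_eq {r s : ℝ} (hs : 0 ≤ s) (h : s ≤ r) : ap r s = r ^ 2 - s ^ 2 :=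
  max_eq_left (by nlinarith)
lemma ap_anti (r : ℝ) : AntitoneOn (ap r) (Ici 0) := fun a ha b hb hab =>
  max_le_max (by have : a ^ 2 ≤ b ^ 2 := pow_le_pow_left₀ ha hab 2
                 linarith) le_rfl

lemma ap_int3 {r : ℝ} (hr : 0 < r) {k : ℕ} (hk : k ≠ 0) :
    ∫ v : E 3, ap r ‖v‖ ^ k = 3 * omega3 * ∫ y in (0 : ℝ)..r, y ^ 2 * (r ^ 2 - y ^ 2) ^ k := by
  have h := integral_fun_norm_addHaar (volume : Measure (E 3)) (fun s => ap r s ^ k)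
  rw [h, finrank_euclideanSpace_fin, intervalIntegral.integral_of_le hr.le]
  have : ∫ y in Ioi (0 : ℝ), y ^ (3 - 1) • ap r y ^ k = ∫ y in Ioc 0 r, y ^ 2 * (r ^ 2 - y ^ 2) ^ k := by
    rw [setIntegral_eq_of_subset_of_forall_sdiff_eq_zero (s := Ioc 0 r) measurableSet_Ioi
      Ioc_subset_Ioi_self]
    · refine setIntegral_congr_fun measurableSet_Ioc fun y hy => ?_
      simp [ap_eq hy.1.le hy.2]
    · intro y hy
      have h2 : r ≤ y := by
        by_contra h3; push Not at h3; exact hy.2 ⟨hy.1, h3.le⟩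
      simp [ap_zero hr.le h2, hk]
  rw [this]
  have h2 : (volume : Measure (E 3)).real (ball 0 1) = omega3 := rfl
  rw [h2]; simp [mul_assoc]

lemma ap_supp3 {r : ℝ} (hr : 0 < r) {k : ℕ} (hk : k ≠ 0) : Integrable (fun v : E 3 => ap r ‖v‖ ^ k) := by
  refine Continuous.integrable_of_hasCompactSupport (((ap_cont r).comp continuous_norm).pow k) ?_
  refine HasCompactSupport.intro (isCompact_closedBall 0 r) fun v hv => ?_
  have : r ≤ ‖v‖ := by simp at hv; exact hv.le
  simp [ap_zero hr.le this, hk]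

def c2 : ℝ := 8 * omega3 / 35
lemma c2_pos : 0 < c2 := by have := omega3_pos; unfold c2; positivity

lemma ap_val {r : ℝ} (hr : 0 < r) : ∫ v : E 3, ap r ‖v‖ ^ 1 = 7 / 4 * c2 * r ^ 5 ∧
    ∫ v : E 3, ap r ‖v‖ ^ 2 = c2 * r ^ 7 ∧ ∫ v : E 3, ap r ‖v‖ ^ 3 = 2 / 3 * c2 * r ^ 9 := by
  refine ⟨?_, ?_, ?_⟩
  · rw [ap_int3 hr one_ne_zero]
    have : ∀ y : ℝ, y ^ 2 * (r ^ 2 - y ^ 2) ^ 1 = r ^ 2 * y ^ 2 - y ^ 4 := fun y => by ring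
    simp_rw [this]
    rw [intervalIntegral.integral_sub (Continuous.intervalIntegrable (by fun_prop) _ _)
      (Continuous.intervalIntegrable (by fun_prop) _ _)]
    simp [integral_pow]; unfold c2; ring
  · rw [ap_int3 hr two_ne_zero]
    have : ∀ y : ℝ, y ^ 2 * (r ^ 2 - y ^ 2) ^ 2 = r ^ 4 * y ^ 2 - (2 * r ^ 2 * y ^ 4 - y ^ 6) := fun y => by ring
    simp_rw [this]
    rw [intervalIntegral.integral_sub (Continuous.intervalIntegrable (by fun_prop) _ _)
      (Continuous.intervalIntegrable (by fun_prop) _ _),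
      intervalIntegral.integral_sub (Continuous.intervalIntegrable (by fun_prop) _ _)
      (Continuous.intervalIntegrable (by fun_prop) _ _)]
    simp [integral_pow]; unfold c2; ring
  · rw [ap_int3 hr three_ne_zero]
    have : ∀ y : ℝ, y ^ 2 * (r ^ 2 - y ^ 2) ^ 3 =
      r ^ 6 * y ^ 2 - (3 * r ^ 4 * y ^ 4 - (3 * r ^ 2 * y ^ 6 - y ^ 8)) := fun y => by ring
    simp_rw [this]
    rw [intervalIntegral.integral_sub (Continuous.intervalIntegrable (by fun_prop) _ _)
      (Continuous.intervalIntegrable (by fun_prop) _ _),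
      intervalIntegral.integral_sub (Continuous.intervalIntegrable (by fun_prop) _ _)
      (Continuous.intervalIntegrable (by fun_prop) _ _),
      intervalIntegral.integral_sub (Continuous.intervalIntegrable (by fun_prop) _ _)
      (Continuous.intervalIntegrable (by fun_prop) _ _)]
    simp [integral_pow]; unfold c2; ring

lemma ap_mom {μ : Measure (E 4)} [IsLocallyFiniteMeasure μ] {y : E 4} {ε r : ℝ} (hε : 0 ≤ ε)
    (hr : 0 < r) (h : BE μ y ε r) {k : ℕ} (hk : k ≠ 0) :
    |∫ w, ap r (dist w y) ^ k ∂μ - ∫ v : E 3, ap r ‖v‖ ^ k| ≤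
      ε / omega3 * ∫ v : E 3, ap r ‖v‖ ^ k := by
  refine (RAD hε ((ap_cont r).pow k) (fun a ha b hb hab =>
    pow_le_pow_left₀ (ap_nonneg _ _) (ap_anti r ha hb hab) k) (fun s => pow_nonneg (ap_nonneg r s) k)
    (fun t ht => ⟨r, hr, fun s hs => by simp [ap_zero hr.le hs.le, hk, ht], h⟩) (ap_supp3 hr hk)).2

def bt (μ : Measure (E 4)) (r : ℝ) : E 4 := (c2 * r ^ 7)⁻¹ • ∫ w, ap r ‖w‖ ^ 2 • w ∂μ

def Aop (μ : Measure (E 4)) (r : ℝ) : E 4 →L[ℝ] E 4 :=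
  (4 * (c2 * r ^ 7)⁻¹) • ∫ w, ap r ‖w‖ • (innerSL ℝ w).smulRight w ∂μ

lemma ap_supp4 {F : Type*} [NormedAddCommGroup F] {r : ℝ} (hr : 0 < r) {f : E 4 → F}
    (hf : ∀ w, ap r ‖w‖ = 0 → f w = 0) : HasCompactSupport f := by
  refine HasCompactSupport.intro (isCompact_closedBall 0 r) fun v hv => hf v ?_
  have : r ≤ ‖v‖ := by simp at hv; exact hv.le
  exact ap_zero hr.le this

lemma ap_int4 {F : Type*} [NormedAddCommGroup F] [NormedSpace ℝ F] {μ : Measure (E 4)}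
    [IsLocallyFiniteMeasure μ] {r : ℝ} (hr : 0 < r) {f : E 4 → F} (hc : Continuous f)
    (hf : ∀ w, ap r ‖w‖ = 0 → f w = 0) : Integrable f μ :=
  hc.integrable_of_hasCompactSupport (ap_supp4 hr hf)

@[fun_prop]
lemma ap_cont4 (r : ℝ) : Continuous (fun w : E 4 => ap r ‖w‖) := (ap_cont r).comp continuous_norm

lemma inner_bt {μ : Measure (E 4)} [IsLocallyFiniteMeasure μ] {r : ℝ} (hr : 0 < r) (x : E 4) :
    ⟪x, bt μ r⟫ = (c2 * r ^ 7)⁻¹ * ∫ w, ap r ‖w‖ ^ 2 * ⟪x, w⟫ ∂μ := by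
  rw [bt, inner_smul_right, ← integral_inner (ap_int4 hr (by fun_prop) (by simp +contextual))]
  simp_rw [inner_smul_right]

lemma smulRight_cont : Continuous (fun w : E 4 => (innerSL ℝ w).smulRight w) := by
  have h : (fun w : E 4 => (innerSL ℝ w).smulRight w) =
    fun w => (ContinuousLinearMap.smulRightL ℝ (E 4) (E 4) (innerSL ℝ w)) w := rfl
  rw [h]
  fun_prop

lemma inner_A {μ : Measure (E 4)} [IsLocallyFiniteMeasure μ] {r : ℝ} (hr : 0 < r) (x y : E 4) :
    ⟪Aop μ r x, y⟫ = 4 * (c2 * r ^ 7)⁻¹ * ∫ w, ap r ‖w‖ * (⟪x, w⟫ * ⟪y, w⟫) ∂μ := by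
  have hi : Integrable (fun w : E 4 => ap r ‖w‖ • (innerSL ℝ w).smulRight w) μ :=
    ap_int4 hr ((ap_cont4 r).smul smulRight_cont) (by simp +contextual)
  rw [Aop, smul_apply, ContinuousLinearMap.integral_apply hi, inner_smul_left,
    real_inner_comm, ← integral_inner (ap_int4 hr (by simp; fun_prop) (by simp +contextual))]
  simp [inner_smul_right, real_inner_comm x, mul_assoc]

lemma A_symm {μ : Measure (E 4)} [IsLocallyFiniteMeasure μ] {r : ℝ} (hr : 0 < r) (x y : E 4) :
    ⟪Aop μ r x, y⟫ = ⟪x, Aop μ r y⟫ := by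
  rw [inner_A hr, real_inner_comm, inner_A hr]
  simp_rw [mul_comm ⟪x, _⟫]

lemma A_nonneg {μ : Measure (E 4)} [IsLocallyFiniteMeasure μ] {r : ℝ} (hr : 0 < r) (x : E 4) :
    0 ≤ ⟪Aop μ r x, x⟫ := by
  rw [inner_A hr]
  have := c2_pos
  refine mul_nonneg (by positivity) (integral_nonneg fun w => mul_nonneg (ap_nonneg _ _) ?_)
  exact mul_self_nonneg _

lemma A_mono {μ : Measure (E 4)} [IsLocallyFiniteMeasure μ] {r τ : ℝ} (hr : 0 < r) (hτ : 0 < τ)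
    (hτ1 : τ ≤ 1) (x : E 4) : ⟪Aop μ (τ * r) x, x⟫ ≤ (τ ^ 7)⁻¹ * ⟪Aop μ r x, x⟫ := by
  have hτr : 0 < τ * r := by positivity
  rw [inner_A hr, inner_A hτr]
  have := c2_pos
  have h1 : ∫ w, ap (τ * r) ‖w‖ * (⟪x, w⟫ * ⟪x, w⟫) ∂μ ≤ ∫ w, ap r ‖w‖ * (⟪x, w⟫ * ⟪x, w⟫) ∂μ := by
    refine integral_mono (ap_int4 hτr (by fun_prop) (by simp +contextual))
      (ap_int4 hr (by fun_prop) (by simp +contextual)) fun w => ?_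
    refine mul_le_mul_of_nonneg_right (max_le_max ?_ le_rfl) (mul_self_nonneg _)
    have : τ * r ≤ r := by nlinarith
    have := pow_le_pow_left₀ hτr.le this 2
    linarith
  calc _ ≤ 4 * (c2 * (τ * r) ^ 7)⁻¹ * ∫ w, ap r ‖w‖ * (⟪x, w⟫ * ⟪x, w⟫) ∂μ := by gcongr
    _ = _ := by field_simp

lemma A_scale {μ : Measure (E 4)} [IsLocallyFiniteMeasure μ] {r R : ℝ} (hr : 0 < r) (hR : 0 < R) :
    Aop (blow μ 0 R) r = Aop μ (R * r) := by
  have := blow_lf μ 0 hR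
  ext1 x
  refine ext_inner_right ℝ fun y => ?_
  rw [inner_A hr, inner_A (by positivity), blow_integral μ 0 hR]
  have h : ∀ w : E 4, ap r ‖R⁻¹ • (w - 0)‖ * (⟪x, R⁻¹ • (w - 0)⟫ * ⟪y, R⁻¹ • (w - 0)⟫) =
      (R ^ 4)⁻¹ * (ap (R * r) ‖w‖ * (⟪x, w⟫ * ⟪y, w⟫)) := by
    intro w
    have e : ap r ‖R⁻¹ • (w - 0)‖ = (R ^ 2)⁻¹ * ap (R * r) ‖w‖ := by
      unfold ap
      rw [mul_max_of_nonneg _ _ (by positivity), sub_zero, norm_smul, Real.norm_eq_abs,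
        abs_of_pos (inv_pos.2 hR), mul_zero]
      congr 1; field_simp
    rw [e, sub_zero, inner_smul_right, inner_smul_right]; field_simp
  simp_rw [h]
  rw [integral_const_mul]; field_simp

lemma bt_scale {μ : Measure (E 4)} [IsLocallyFiniteMeasure μ] {r R : ℝ} (hr : 0 < r) (hR : 0 < R) :
    bt (blow μ 0 R) r = R⁻¹ • bt μ (R * r) := by
  have := blow_lf μ 0 hR
  refine ext_inner_left ℝ fun x => ?_
  rw [inner_smul_right, inner_bt hr, inner_bt (by positivity), blow_integral μ 0 hR]
  have h : ∀ w : E 4, ap r ‖R⁻¹ • (w - 0)‖ ^ 2 * ⟪x, R⁻¹ • (w - 0)⟫ =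
      (R ^ 5)⁻¹ * (ap (R * r) ‖w‖ ^ 2 * ⟪x, w⟫) := by
    intro w
    have e : ap r ‖R⁻¹ • (w - 0)‖ = (R ^ 2)⁻¹ * ap (R * r) ‖w‖ := by
      unfold ap
      rw [mul_max_of_nonneg _ _ (by positivity), sub_zero, norm_smul, Real.norm_eq_abs,
        abs_of_pos (inv_pos.2 hR), mul_zero]
      congr 1; field_simp
    rw [e, sub_zero, inner_smul_right]; field_simp
  simp_rw [h]
  rw [integral_const_mul]; field_simp

lemma VT.A {ι : Type*} {U : Filter ι} {μs : ι → Measure (E 4)} {ν : Measure (E 4)}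
    [∀ i, IsLocallyFiniteMeasure (μs i)] [IsLocallyFiniteMeasure ν] (h : VT U μs ν)
    {r : ℝ} (hr : 0 < r) (x y : E 4) :
    Tendsto (fun i => ⟪Aop (μs i) r x, y⟫) U (𝓝 ⟪Aop ν r x, y⟫) := by
  simp_rw [inner_A hr]
  exact (h _ (by fun_prop) (ap_supp4 hr (by simp +contextual))).const_mul _

lemma VT.b {ι : Type*} {U : Filter ι} {μs : ι → Measure (E 4)} {ν : Measure (E 4)}
    [∀ i, IsLocallyFiniteMeasure (μs i)] [IsLocallyFiniteMeasure ν] (h : VT U μs ν)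
    {r : ℝ} (hr : 0 < r) (x : E 4) :
    Tendsto (fun i => ⟪x, bt (μs i) r⟫) U (𝓝 ⟪x, bt ν r⟫) := by
  simp_rw [inner_bt hr]
  exact (h _ (by fun_prop) (ap_supp4 hr (by simp +contextual))).const_mul _

lemma A_trace {μ : Measure (E 4)} [IsLocallyFiniteMeasure μ] {ε r : ℝ} (hε : 0 ≤ ε)
    (hr : 0 < r) (h : BE μ 0 ε r) (e : OrthonormalBasis (Fin 4) ℝ (E 4)) :
    |∑ i, ⟪Aop μ r (e i), e i⟫ - 3| ≤ 11 / omega3 * ε := by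
  have hw := omega3_pos
  have hc := c2_pos
  have h1 := ap_mom hε hr h one_ne_zero
  have h2 := ap_mom hε hr h two_ne_zero
  obtain ⟨v1, v2, -⟩ := ap_val hr
  rw [v1] at h1
  rw [v2] at h2
  simp_rw [dist_zero_right] at h1 h2
  have hs : ∑ i, ⟪Aop μ r (e i), e i⟫ = 4 * (c2 * r ^ 7)⁻¹ *
      (r ^ 2 * ∫ w, ap r ‖w‖ ^ 1 ∂μ - ∫ w, ap r ‖w‖ ^ 2 ∂μ) := by
    simp_rw [inner_A hr]
    have e0 : r ^ 2 * ∫ w, ap r ‖w‖ ^ 1 ∂μ - ∫ w, ap r ‖w‖ ^ 2 ∂μ =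
        ∫ w, (r ^ 2 * ap r ‖w‖ ^ 1 - ap r ‖w‖ ^ 2) ∂μ := by
      rw [integral_sub, integral_const_mul]
      · exact ap_int4 hr (by fun_prop) (by simp +contextual)
      · exact ap_int4 hr (by fun_prop) (by simp +contextual)
    rw [← Finset.mul_sum, ← integral_finsetSum _ fun i _ =>
      ap_int4 hr (by fun_prop) (by simp +contextual), e0]
    · congr 2
      ext w
      rw [← Finset.mul_sum]
      have : ∑ i, ⟪e i, w⟫ * ⟪e i, w⟫ = ‖w‖ ^ 2 := by
        rw [← e.sum_sq_inner_right w]; simp_rw [pow_two]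
      rw [this]
      unfold ap
      rcases le_total (r ^ 2 - ‖w‖ ^ 2) 0 with hh | hh
      · rw [max_eq_right hh]; ring
      · rw [max_eq_left hh]; ring
  rw [hs]
  set I1 := ∫ w, ap r ‖w‖ ^ 1 ∂μ
  set I2 := ∫ w, ap r ‖w‖ ^ 2 ∂μ
  have e1 : 4 * (c2 * r ^ 7)⁻¹ * (r ^ 2 * I1 - I2) - 3 =
     4 * (c2 * r ^ 7)⁻¹ * (r ^ 2 * (I1 - 7 / 4 * c2 * r ^ 5) - (I2 - c2 * r ^ 7)) := by
    field_simp; ring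
  rw [e1, abs_mul, abs_of_pos (by positivity)]
  calc _ ≤ 4 * (c2 * r ^ 7)⁻¹ * (r ^ 2 * (ε / omega3 * (7 / 4 * c2 * r ^ 5)) +
        ε / omega3 * (c2 * r ^ 7)) := by
        gcongr
        refine (abs_sub _ _).trans (add_le_add ?_ h2)
        rw [abs_mul, abs_of_nonneg (by positivity : (0 : ℝ) ≤ r ^ 2)]
        gcongr
    _ = 11 / omega3 * ε := by field_simp; ring

lemma cube_taylor (a h : ℝ) :
    |max (a + h) 0 ^ 3 - max a 0 ^ 3 - 3 * max a 0 ^ 2 * h - 3 * max a 0 * h ^ 2| ≤ |h| ^ 3 := by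
  have key : ∀ b : ℝ, b ^ 3 ≤ |b| ^ 3 ∧ -|b| ^ 3 ≤ b ^ 3 := fun b => by
    rw [← abs_pow]; exact ⟨le_abs_self _, neg_abs_le _⟩
  rcases le_total a 0 with ha | ha <;> rcases le_total (a + h) 0 with hb | hb
  · rw [max_eq_right ha, max_eq_right hb]; simp
  · rw [max_eq_right ha, max_eq_left hb]
    have : 0 ≤ h := by linarith
    rw [abs_of_nonneg this]
    have h1 : a + h ≤ h := by linarith
    have := pow_le_pow_left₀ hb h1 3
    have := pow_nonneg hb 3
    rw [abs_le]; constructor <;> nlinarith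
  · rw [max_eq_left ha, max_eq_right hb]
    have hh : h ≤ 0 := by linarith
    obtain ⟨g, rfl⟩ : ∃ g, h = -g := ⟨-h, by ring⟩
    rw [abs_neg, abs_of_nonneg (by linarith : 0 ≤ g)]
    have h1 : 0 ≤ g - a := by linarith
    have h2 := pow_le_pow_left₀ h1 (by linarith : g - a ≤ g) 3
    have h3 := pow_nonneg h1 3
    have e : 0 ^ 3 - a ^ 3 - 3 * a ^ 2 * -g - 3 * a * (-g) ^ 2 = (g - a) ^ 3 - g ^ 3 := by ring
    rw [e, abs_le]; constructor
    · linarith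
    · have : 0 ≤ g ^ 3 := by have : 0 ≤ g := by linarith
                             positivity
      linarith
  · rw [max_eq_left ha, max_eq_left hb]
    have e : (a + h) ^ 3 - a ^ 3 - 3 * a ^ 2 * h - 3 * a * h ^ 2 = h ^ 3 := by ring
    rw [e, abs_pow]

lemma int_bd {μ : Measure (E 4)} [IsLocallyFiniteMeasure μ] {f : E 4 → ℝ} {R C : ℝ}
    (h0 : ∀ w, R < ‖w‖ → f w = 0) (hC : ∀ w, ‖w‖ ≤ R → |f w| ≤ C) :
    |∫ w, f w ∂μ| ≤ C * (μ (closedBall 0 R)).toReal := by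
  have h1 : ∫ w in closedBall (0 : E 4) R, f w ∂μ = ∫ w, f w ∂μ :=
    setIntegral_eq_integral_of_forall_compl_eq_zero (fun x hx => h0 x (by simpa using hx))
  rw [← h1, ← Real.norm_eq_abs]
  exact norm_setIntegral_le_of_norm_le_const (μ := μ) (f := f) (s := closedBall (0 : E 4) R) (C := C)
    measure_closedBall_lt_top fun x hx => hC x (by simpa using hx)

def KE : ℝ := (c2)⁻¹ * (500 * (omega3 + 1) + c2 / omega3 + 1)

lemma KE_pos : 0 < KE := by
  have := omega3_pos; have := c2_pos; unfold KE; positivity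

set_option maxHeartbeats 1000000 in
/-- the second moment estimate -/
theorem ME {μ : Measure (E 4)} [IsLocallyFiniteMeasure μ] {ε r : ℝ} {x : E 4} (hε : 0 ≤ ε)
    (hε1 : ε ≤ 1) (hr : 0 < r) (h0 : BE μ 0 ε (2 * r)) (hx : BE μ x ε (2 * r)) (hxr : ‖x‖ ≤ r) :
    |2 * ⟪x, bt μ r⟫ + ⟪Aop μ r x, x⟫ - ‖x‖ ^ 2| ≤ KE * (‖x‖ ^ 3 / r + 2 * ε * r ^ 2) := by
  have hw := omega3_pos
  have hc := c2_pos
  have h0' : BE μ 0 ε r := fun s hs hs' => h0 s hs (by linarith)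
  have hx' : BE μ x ε r := fun s hs hs' => hx s hs (by linarith)
  obtain ⟨-, v2, v3⟩ := ap_val hr
  have m2 := ap_mom hε hr h0' two_ne_zero
  have m3 := ap_mom hε hr h0' three_ne_zero
  have m3x := ap_mom hε hr hx' three_ne_zero
  rw [v2] at m2
  rw [v3] at m3 m3x
  simp_rw [dist_zero_right] at m2 m3
  rw [inner_bt hr, inner_A hr]
  have i2 : Integrable (fun w : E 4 => ap r ‖w‖ ^ 2) μ := ap_int4 hr (by fun_prop) (by simp +contextual)
  have i3 : Integrable (fun w : E 4 => ap r ‖w‖ ^ 3) μ := ap_int4 hr (by fun_prop) (by simp +contextual)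
  have ib : Integrable (fun w : E 4 => ap r ‖w‖ ^ 2 * ⟪x, w⟫) μ :=
    ap_int4 hr (by fun_prop) (by simp +contextual)
  have iq : Integrable (fun w : E 4 => ap r ‖w‖ * (⟪x, w⟫ * ⟪x, w⟫)) μ :=
    ap_int4 hr (by fun_prop) (by simp +contextual)
  have cx : Continuous (fun w : E 4 => ap r (dist w x) ^ 3) := by
    have := ap_cont r
    fun_prop
  have i3x : Integrable (fun w : E 4 => ap r (dist w x) ^ 3) μ := by
    refine cx.integrable_of_hasCompactSupport ?_
    refine HasCompactSupport.intro (isCompact_closedBall x r) fun v hv => ?_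
    simp only [mem_closedBall, not_le] at hv
    simp [ap_zero hr.le hv.le]
  have hbd := int_bd (μ := μ) (R := 2 * r) (C := 152 * r ^ 3 * ‖x‖ ^ 3)
    (f := fun w => ap r (dist w x) ^ 3 - ap r ‖w‖ ^ 3 - 6 * (ap r ‖w‖ ^ 2 * ⟪x, w⟫)
      + 3 * ‖x‖ ^ 2 * ap r ‖w‖ ^ 2 - 12 * (ap r ‖w‖ * (⟪x, w⟫ * ⟪x, w⟫)))
    (fun w hww => by
      have e1 : ap r ‖w‖ = 0 := ap_zero hr.le (by linarith)
      have e2 : ap r (dist w x) = 0 := ap_zero hr.le (by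
        rw [dist_eq_norm]; have := norm_sub_norm_le w x; linarith)
      simp [e1, e2])
    (fun w hww => by
      have hin : |⟪x, w⟫| ≤ ‖x‖ * ‖w‖ := abs_real_inner_le_norm x w
      set g := ⟪x, w⟫ with hg
      have hd : dist w x ^ 2 = ‖w‖ ^ 2 - 2 * g + ‖x‖ ^ 2 := by
        rw [dist_eq_norm, norm_sub_sq_real, real_inner_comm]
      have hT := cube_taylor (r ^ 2 - ‖w‖ ^ 2) (2 * g - ‖x‖ ^ 2)
      have e1 : ap r (dist w x) = max (r ^ 2 - ‖w‖ ^ 2 + (2 * g - ‖x‖ ^ 2)) 0 := by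
        unfold ap; rw [hd]; congr 1; ring
      have e2 : max (r ^ 2 - ‖w‖ ^ 2) 0 = ap r ‖w‖ := rfl
      rw [← e1, e2] at hT
      have a0 := ap_nonneg r ‖w‖
      have a1 := ap_le r ‖w‖
      set a := ap r ‖w‖
      have nx := norm_nonneg x
      have hgb : |g| ≤ 2 * r * ‖x‖ := by nlinarith [norm_nonneg w]
      have hh : |2 * g - ‖x‖ ^ 2| ≤ 5 * r * ‖x‖ := by
        refine (abs_sub _ _).trans ?_
        rw [abs_mul, abs_two, abs_of_nonneg (by positivity : 0 ≤ ‖x‖ ^ 2)]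
        nlinarith
      have hh3 : |2 * g - ‖x‖ ^ 2| ^ 3 ≤ 125 * r ^ 3 * ‖x‖ ^ 3 := by
        refine (pow_le_pow_left₀ (abs_nonneg _) hh 3).trans (le_of_eq ?_); ring
      have e3 : ap r (dist w x) ^ 3 - a ^ 3 - 6 * (a ^ 2 * g) + 3 * ‖x‖ ^ 2 * a ^ 2 - 12 * (a * (g * g))
        = (ap r (dist w x) ^ 3 - a ^ 3 - 3 * a ^ 2 * (2 * g - ‖x‖ ^ 2) - 3 * a * (2 * g - ‖x‖ ^ 2) ^ 2)
          + a * (‖x‖ ^ 2 * (3 * ‖x‖ ^ 2 - 12 * g)) := by ring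
      rw [e3]
      refine (abs_add_le _ _).trans ?_
      have h4 : |a * (‖x‖ ^ 2 * (3 * ‖x‖ ^ 2 - 12 * g))| ≤ r ^ 2 * (‖x‖ ^ 2 * (27 * r * ‖x‖)) := by
        rw [abs_mul, abs_mul, abs_of_nonneg a0, abs_of_nonneg (by positivity : 0 ≤ ‖x‖ ^ 2)]
        gcongr
        refine (abs_sub _ _).trans ?_
        rw [abs_mul, abs_mul, abs_of_nonneg (by positivity : 0 ≤ ‖x‖ ^ 2)]
        norm_num
        nlinarith
      calc _ ≤ 125 * r ^ 3 * ‖x‖ ^ 3 + r ^ 2 * (‖x‖ ^ 2 * (27 * r * ‖x‖)) := add_le_add (hT.trans hh3) h4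
        _ = _ := by ring)
  have hsplit : ∫ w, (ap r (dist w x) ^ 3 - ap r ‖w‖ ^ 3 - 6 * (ap r ‖w‖ ^ 2 * ⟪x, w⟫)
      + 3 * ‖x‖ ^ 2 * ap r ‖w‖ ^ 2 - 12 * (ap r ‖w‖ * (⟪x, w⟫ * ⟪x, w⟫))) ∂μ =
      ∫ w, ap r (dist w x) ^ 3 ∂μ - ∫ w, ap r ‖w‖ ^ 3 ∂μ - 6 * ∫ w, ap r ‖w‖ ^ 2 * ⟪x, w⟫ ∂μ
      + 3 * ‖x‖ ^ 2 * ∫ w, ap r ‖w‖ ^ 2 ∂μ - 12 * ∫ w, ap r ‖w‖ * (⟪x, w⟫ * ⟪x, w⟫) ∂μ := by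
    have j1 : Integrable (fun w => ap r (dist w x) ^ 3 - ap r ‖w‖ ^ 3) μ := i3x.sub i3
    have j2 : Integrable (fun w => ap r (dist w x) ^ 3 - ap r ‖w‖ ^ 3 - 6 * (ap r ‖w‖ ^ 2 * ⟪x, w⟫)) μ :=
      j1.sub (ib.const_mul _)
    have j3 : Integrable (fun w => ap r (dist w x) ^ 3 - ap r ‖w‖ ^ 3 - 6 * (ap r ‖w‖ ^ 2 * ⟪x, w⟫)
      + 3 * ‖x‖ ^ 2 * ap r ‖w‖ ^ 2) μ := j2.add (i2.const_mul _)
    rw [integral_sub j3 (iq.const_mul _), integral_add j2 (i2.const_mul _),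
      integral_sub j1 (ib.const_mul _), integral_sub i3x i3, integral_const_mul,
      integral_const_mul, integral_const_mul]
  rw [hsplit] at hbd
  have hm : (μ (closedBall 0 (2 * r))).toReal ≤ (omega3 + 1) * (8 * r ^ 3) := by
    have := (abs_le.1 (h0 (2 * r) (by positivity) le_rfl)).2
    have h8 : ε * (2 * r) ^ 3 ≤ 1 * (2 * r) ^ 3 := by gcongr
    nlinarith
  have hbd2 := hbd.trans (mul_le_mul_of_nonneg_left hm (by positivity))
  clear hbd
  set B := ∫ w, ap r ‖w‖ ^ 2 * ⟪x, w⟫ ∂μ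
  set Q := ∫ w, ap r ‖w‖ * (⟪x, w⟫ * ⟪x, w⟫) ∂μ
  set I2 := ∫ w, ap r ‖w‖ ^ 2 ∂μ
  set I3 := ∫ w, ap r ‖w‖ ^ 3 ∂μ
  set I3x := ∫ w, ap r (dist w x) ^ 3 ∂μ
  have nx := norm_nonneg x
  have hx2 : ‖x‖ ^ 2 ≤ r ^ 2 := pow_le_pow_left₀ nx hxr 2
  have main : |6 * B + 12 * Q - 3 * ‖x‖ ^ 2 * (c2 * r ^ 7)| ≤
      1216 * (omega3 + 1) * r ^ 6 * ‖x‖ ^ 3 + 5 * (ε / omega3 * (c2 * r ^ 9)) := by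
    have e1 : 6 * B + 12 * Q - 3 * ‖x‖ ^ 2 * (c2 * r ^ 7) =
      -(I3x - I3 - 6 * B + 3 * ‖x‖ ^ 2 * I2 - 12 * Q) + (I3x - 2 / 3 * c2 * r ^ 9)
      - (I3 - 2 / 3 * c2 * r ^ 9) + 3 * ‖x‖ ^ 2 * (I2 - c2 * r ^ 7) := by ring
    have e2 : |3 * ‖x‖ ^ 2 * (I2 - c2 * r ^ 7)| ≤ 3 * r ^ 2 * (ε / omega3 * (c2 * r ^ 7)) := by
      rw [abs_mul, abs_of_nonneg (by positivity : 0 ≤ 3 * ‖x‖ ^ 2)]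
      gcongr
    have hp : 0 ≤ ε / omega3 * (c2 * r ^ 9) := by positivity
    rw [e1]
    obtain ⟨a1, a2⟩ := abs_le.1 hbd2
    obtain ⟨b1, b2⟩ := abs_le.1 m3
    obtain ⟨d1, d2⟩ := abs_le.1 m3x
    obtain ⟨f1, f2⟩ := abs_le.1 e2
    rw [abs_le]
    clear hbd2 m3 m3x e2 m2 hsplit
    constructor <;> linarith
  have e5 : 2 * ((c2 * r ^ 7)⁻¹ * B) + 4 * (c2 * r ^ 7)⁻¹ * Q - ‖x‖ ^ 2 =
      (3 * (c2 * r ^ 7))⁻¹ * (6 * B + 12 * Q - 3 * ‖x‖ ^ 2 * (c2 * r ^ 7)) := by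
    field_simp; ring
  rw [e5, abs_mul, abs_of_pos (by positivity), inv_mul_le_iff₀ (by positivity)]
  refine main.trans ?_
  have e6 : 3 * (c2 * r ^ 7) * (KE * (‖x‖ ^ 3 / r + 2 * ε * r ^ 2)) =
    (500 * (omega3 + 1) + c2 / omega3 + 1) * (3 * (r ^ 6 * ‖x‖ ^ 3) + 6 * ε * r ^ 9) := by
    unfold KE; field_simp; ring
  rw [e6]
  have e7 : ε / omega3 * (c2 * r ^ 9) = (c2 / omega3) * (ε * r ^ 9) := by field_simp
  rw [e7]
  set k := c2 / omega3
  have hk : 0 < k := by positivity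
  have p1 : 0 ≤ r ^ 6 * ‖x‖ ^ 3 := by positivity
  have p2 : 0 ≤ ε * r ^ 9 := by positivity
  clear main e6 e5 hbd2 m3 m3x m2 hsplit
  linarith [mul_nonneg hk.le p1, mul_nonneg hk.le p2, mul_nonneg hw.le p1, mul_nonneg hw.le p2]

def SymL (L : E 4 →L[ℝ] E 4) : Prop := ∀ x y, ⟪L x, y⟫ = ⟪L y, x⟫

lemma K1 {ν : Measure (E 4)} (hν : Unif ν) {L : E 4 →L[ℝ] E 4} (hs : SymL L)
    (hF : ∀ x ∈ msupp ν, ⟪L x, x⟫ = 0) {x : E 4} (hx : x ∈ msupp ν) (hne : L x ≠ 0) :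
    ∃ ε, 0 < ε ∧ ∀ p, ⟪L p, p⟫ = 0 → dist p x < ε → p ∈ msupp ν := by
  have hpos : 0 < ‖L x‖ := norm_pos_iff.2 hne
  refine NHloc hν hx (M := {p | ⟪L p, p⟫ = 0}) one_pos (fun y hy _ => hF y hy)
    (n := ‖L x‖⁻¹ • L x) (by rw [norm_smul, norm_inv, norm_norm]; field_simp) ?_
  intro η hη
  refine ⟨η * ‖L x‖ / (‖L‖ + 1), by positivity, fun p hp y hy hpx hyx => ?_⟩
  simp only [mem_ofPred_eq] at hp hy
  have key : 2 * ⟪L x, y - p⟫ = ⟪L ((x - y) + (x - p)), y - p⟫ := by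
    have := hs y p
    simp only [map_add, map_sub, inner_add_left, inner_sub_left, inner_sub_right] at *
    linarith
  have h1 : |⟪L ((x - y) + (x - p)), y - p⟫| ≤ ‖L‖ * (dist y x + dist p x) * ‖y - p‖ := by
    refine (abs_real_inner_le_norm _ _).trans (mul_le_mul_of_nonneg_right ?_ (norm_nonneg _))
    refine (L.le_opNorm _).trans (mul_le_mul_of_nonneg_left ?_ (norm_nonneg _))
    rw [dist_comm y x, dist_comm p x, dist_eq_norm, dist_eq_norm]; exact norm_add_le _ _
  have h2 : ‖L‖ * (dist y x + dist p x) ≤ 2 * (η * ‖L x‖) := by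
    have hd : dist y x + dist p x ≤ 2 * (η * ‖L x‖ / (‖L‖ + 1)) := by linarith
    calc _ ≤ (‖L‖ + 1) * (2 * (η * ‖L x‖ / (‖L‖ + 1))) := by gcongr; linarith
      _ = _ := by field_simp
  rw [inner_smul_left, abs_mul]
  simp only [conj_trivial, abs_inv, abs_norm]
  have h3 : |⟪L x, y - p⟫| ≤ (η * ‖L x‖) * ‖y - p‖ := by
    have : |2 * ⟪L x, y - p⟫| ≤ 2 * (η * ‖L x‖) * ‖y - p‖ := by
      rw [key]; exact h1.trans (by gcongr)
    rw [abs_mul, abs_two] at this; nlinarith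
  rw [inv_mul_le_iff₀ hpos]; nlinarith

lemma preconn_sub {X : Type*} [TopologicalSpace X] {s u : Set X} (hs : IsPreconnected s)
    (hne : (s ∩ u).Nonempty) (ho : ∀ x ∈ s ∩ u, u ∈ 𝓝 x) (hc : IsClosed u) : s ⊆ u := by
  have := hs.subset_of_closure_inter_subset (u := interior u) isOpen_interior
    (by obtain ⟨x, hx⟩ := hne; exact ⟨x, hx.1, mem_interior_iff_mem_nhds.2 (ho x hx)⟩)
    (fun x hx => mem_interior_iff_mem_nhds.2 (ho x ⟨hx.2, closure_minimal interior_subset hc hx.1⟩))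
  exact this.trans interior_subset

def Spans (ν : Measure (E 4)) : Prop := ∀ n : E 4, n ≠ 0 → ∃ x ∈ msupp ν, ⟪n, x⟫ ≠ 0

/-- Rays: the support is a cone. -/
lemma K3 {ν : Measure (E 4)} (hν : Unif ν) {L : E 4 →L[ℝ] E 4} (hs : SymL L)
    (hF : ∀ x ∈ msupp ν, ⟪L x, x⟫ = 0) {u v : E 4} (hu : ‖u‖ = 1) (huv : ⟪u, v⟫ = 0) (hv : L v ≠ 0)
    (hk : ∀ x, L x = 0 → ⟪u, x⟫ = 0) {x : E 4} (hx : x ∈ msupp ν) {t : ℝ} (ht : 0 < t) :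
    t • x ∈ msupp ν := by
  have main : ∀ x ∈ msupp ν, L x ≠ 0 → ∀ t : ℝ, 0 < t → t • x ∈ msupp ν := by
    intro x hx hne t ht
    have hc : Continuous fun t : ℝ => t • x := by fun_prop
    have := preconn_sub (s := Ioi (0:ℝ)) (u := {t : ℝ | t • x ∈ msupp ν}) isPreconnected_Ioi
      ⟨1, by simp, by simpa using hx⟩ ?_ ((msupp_closed ν).preimage hc)
    · exact this ht
    · rintro τ ⟨hτ, hτx⟩
      obtain ⟨ε, hε, h⟩ := K1 hν hs hF (x := τ • x) hτx (by
        rw [map_smul]; exact smul_ne_zero (ne_of_gt hτ) hne)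
      filter_upwards [hc.continuousAt.preimage_mem_nhds (ball_mem_nhds _ hε)] with σ hσ
      refine h _ ?_ hσ
      rw [map_smul, inner_smul_left, inner_smul_right, hF x hx]; simp
  by_cases h0 : L x = 0
  · have dense : ∀ ε > 0, ∃ y ∈ msupp ν, dist y x < ε ∧ L y ≠ 0 := by
      by_contra! hcon
      obtain ⟨ε, hε, hcon⟩ := hcon
      obtain ⟨δ, hδ, h⟩ := NHloc hν hx (M := {p | ⟪u, p⟫ = 0}) hε
        (fun y hy hyx => hk y (hcon y hy hyx)) hu (by
          intro η hη; refine ⟨1, one_pos, fun p hp y hy _ _ => ?_⟩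
          simp only [mem_ofPred_eq] at hp hy
          rw [inner_sub_right, hp, hy]; simp; positivity)
      have hvn : v ≠ 0 := by rintro rfl; simp at hv
      set τ := min δ ε / (2 * ‖v‖) with hτ
      have hvp : 0 < ‖v‖ := norm_pos_iff.2 hvn
      have hm : 0 < min δ ε := lt_min hδ hε
      have hτp : 0 < τ := by positivity
      have hd : dist (x + τ • v) x < min δ ε := by
        rw [dist_self_add_left, norm_smul, Real.norm_of_nonneg hτp.le, hτ]
        field_simp; linarith
      have h1 := h (x + τ • v) (by simp [inner_add_right, inner_smul_right, hk x h0, huv])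
        (hd.trans_le (min_le_left _ _))
      have h2 := hcon _ h1 (hd.trans_le (min_le_right _ _))
      rw [map_add, h0, map_smul, zero_add] at h2
      exact smul_ne_zero hτp.ne' hv h2
    rw [← (msupp_closed ν).closure_eq, Metric.mem_closure_iff]
    intro ε hε
    obtain ⟨y, hy, hyx, hL⟩ := dense (ε / t) (by positivity)
    refine ⟨t • y, main y hy hL t ht, ?_⟩
    rw [dist_smul₀, Real.norm_of_nonneg ht.le, dist_comm]
    rwa [lt_div_iff₀' ht] at hyx
  · exact main x hx h0 t ht

/-- Analytic homogeneous functions vanishing on the support vanish on the quadric. -/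
lemma K5 {ν : Measure (E 4)} (hν : Unif ν) {L : E 4 →L[ℝ] E 4} (hs : SymL L)
    (hF : ∀ x ∈ msupp ν, ⟪L x, x⟫ = 0) (hsp : Spans ν) (hL : L ≠ 0) {P : E 4 → ℝ} {d : ℕ}
    (hP : AnalyticOnNhd ℝ P univ) (hd : ∀ (a : ℝ) x, P (a • x) = a ^ d * P x)
    (h0 : ∀ x ∈ msupp ν, P x = 0) {z : E 4} (hz : ⟪L z, z⟫ = 0) : P z = 0 := by
  have main : ∀ z, ⟪L z, z⟫ = 0 → L z ≠ 0 → P z = 0 := by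
    intro z hz hne
    obtain ⟨x0, hx0, hb⟩ := hsp _ hne
    have hLx : L x0 ≠ 0 := by
      intro h; rw [hs, h] at hb; simp at hb
    obtain ⟨z0, hz0, hb0⟩ := hsp _ hLx
    have hLz0 : L z0 ≠ 0 := by
      intro h; rw [hs, h] at hb0; simp at hb0
    set Y : E 4 → E 4 := fun u => ⟪L u, u⟫ • x0 - (2 * ⟪L x0, u⟫) • u with hY
    have e1 := hF x0 hx0
    have hYF : ∀ u, ⟪L (Y u), Y u⟫ = 0 := by
      intro u
      have := hs u x0
      simp only [hY, map_sub, map_smul, inner_sub_left, inner_sub_right, inner_smul_left,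
        inner_smul_right, conj_trivial, e1, this]
      ring
    have hval : ∀ w, ⟪L w, w⟫ = 0 → Y (x0 - w) = (-2 * ⟪L x0, w⟫) • w := by
      intro w hw
      have := hs w x0
      simp only [hY, map_sub, inner_sub_left, inner_sub_right, e1, hw, this]
      module
    have hYan : AnalyticOnNhd ℝ Y univ := by
      intro u _
      have h1 : AnalyticAt ℝ (fun u => ⟪L u, u⟫) u :=
        AnalyticAt.comp (f := fun u => (L u, u)) ((innerSL ℝ (E := E 4)).analyticAt_bilinear _)
          ((L.analyticAt u).prod analyticAt_id)
      have h2 : AnalyticAt ℝ (fun u => 2 * ⟪L x0, u⟫) u :=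
        analyticAt_const.mul ((innerSL ℝ (L x0)).analyticAt u)
      exact (h1.smul analyticAt_const).sub (h2.smul analyticAt_id)
    have hYc : Continuous Y := continuousOn_univ.1 hYan.continuousOn
    obtain ⟨ε, hε, hε2⟩ := K1 hν hs hF hz0 hLz0
    set b := -2 * ⟪L x0, z0⟫ with hbd
    have hb1 : b ≠ 0 := by rw [hbd]; simpa using hb0
    have hcomp : AnalyticOnNhd ℝ (fun u => P (Y u)) univ := fun u _ =>
      (hP (Y u) (mem_univ _)).comp (hYan u (mem_univ _))
    have hzero : (fun u => P (Y u)) =ᶠ[𝓝 (x0 - z0)] 0 := by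
      have hc : Continuous fun u => b⁻¹ • Y u := by fun_prop
      have he : b⁻¹ • Y (x0 - z0) = z0 := by
        rw [hval z0 (hF z0 hz0), smul_smul, inv_mul_cancel₀ hb1, one_smul]
      filter_upwards [hc.continuousAt.preimage_mem_nhds (ball_mem_nhds _ hε)] with u hu
      simp only [mem_preimage, mem_ball] at hu
      rw [he] at hu
      have := h0 _ (hε2 _ (by
        rw [map_smul, inner_smul_left, inner_smul_right, hYF]; simp) hu)
      rw [hd] at this
      simpa [hb1] using this
    have := hcomp.eqOn_zero_of_preconnected_of_eventuallyEq_zero isPreconnected_univ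
      (mem_univ _) hzero (mem_univ (x0 - z))
    simp only [hval z hz, hd, Pi.zero_apply] at this
    rcases mul_eq_zero.1 this with h | h
    · exfalso; apply hb; rw [hs]
      simpa using eq_zero_of_pow_eq_zero h
    · exact h
  by_cases hne : L z = 0
  · obtain ⟨u, hu⟩ : ∃ u, L u ≠ 0 := by
      by_contra! h; exact hL (ContinuousLinearMap.ext h)
    obtain ⟨x0, hx0, hb⟩ := hsp _ hu
    have hLx : L x0 ≠ 0 := by
      intro h; rw [hs, h] at hb; simp at hb
    have hc : Continuous fun τ : ℝ => P (z + τ • x0) :=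
      (continuousOn_univ.1 hP.continuousOn).comp (by fun_prop)
    have ht : Tendsto (fun τ : ℝ => P (z + τ • x0)) (𝓝[≠] 0) (𝓝 (P z)) := by
      have := hc.tendsto 0
      simp only [zero_smul, add_zero] at this
      exact this.mono_left nhdsWithin_le_nhds
    have ht2 : Tendsto (fun τ : ℝ => P (z + τ • x0)) (𝓝[≠] 0) (𝓝 0) := by
      refine tendsto_const_nhds.congr' ?_
      filter_upwards [self_mem_nhdsWithin] with τ hτ
      symm; apply main
      · have := hs x0 z
        simp [map_add, map_smul, hne, inner_add_right, inner_smul_left, inner_smul_right, hF x0 hx0, this]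
      · rw [map_add, hne, zero_add, map_smul]; exact smul_ne_zero hτ hLx
    exact tendsto_nhds_unique ht ht2
  · exact main z hz hne

def cg : ℝ := Real.pi ^ (3 / 2 : ℝ)
lemma cg_pos : 0 < cg := Real.rpow_pos_of_pos Real.pi_pos _

lemma gauss {ν : Measure (E 4)} (hν : Unif ν) {x : E 4} (hx : x ∈ msupp ν) {s : ℝ} (hs : 0 < s) :
    Integrable (fun w => Real.exp (-s * dist w x ^ 2)) ν ∧
      ∫ w, Real.exp (-s * dist w x ^ 2) ∂ν = cg * s ^ (-(3 / 2) : ℝ) := by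
  have := hν.1
  have hV := GaussianFourier.integral_rexp_neg_mul_sq_norm (V := E 3) hs
  have hI : Integrable (fun v : E 3 => Real.exp (-s * ‖v‖ ^ 2)) := by
    by_contra h
    rw [integral_undef h] at hV
    exact absurd hV (ne_of_lt (by have := Real.pi_pos; positivity))
  have hlim : Tendsto (fun t : ℝ => Real.exp (-s * t ^ 2)) atTop (𝓝 0) := by
    refine Real.tendsto_exp_atBot.comp ?_
    exact (tendsto_pow_atTop two_ne_zero).const_mul_atTop_of_neg (by linarith)
  obtain ⟨h1, h2⟩ := RAD (μ := ν) (y := x) (ε := 0) le_rfl (φ := fun t => Real.exp (-s * t ^ 2))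
    (by fun_prop) (fun a ha b hb hab => by
      simp only [mem_Ici] at ha hb; simp only [Real.exp_le_exp]
      nlinarith [mul_le_mul hab hab ha hb]) (fun _ => (Real.exp_pos _).le) (fun t ht => by
      obtain ⟨R, hR⟩ := (hlim.eventually (gt_mem_nhds ht)).exists_forall_of_atTop
      refine ⟨max R 1, by positivity, fun s' hs' => hR s' ((le_max_left _ _).trans hs'.le), ?_⟩
      intro s hs _; rw [hν.2 x hx s hs]; simp) hI
  refine ⟨h1, ?_⟩
  simp only [zero_div, zero_mul, abs_nonpos_iff, sub_eq_zero] at h2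
  rw [h2, hV, finrank_euclideanSpace, Fintype.card_fin, Real.div_rpow Real.pi_pos.le hs.le,
    Real.rpow_neg hs.le, cg]
  norm_num; rw [div_eq_mul_inv]

lemma gint {ν : Measure (E 4)} (hν : Unif ν) (h0 : 0 ∈ msupp ν) {s : ℝ} (hs : 0 < s) {f : E 4 → ℝ}
    (hf : Continuous f) {C : ℝ} (hb : ∀ w, |f w| ≤ C * (1 + ‖w‖ ^ 4)) :
    Integrable (fun w => f w * Real.exp (-s * ‖w‖ ^ 2)) ν := by
  have h1 := (gauss hν h0 (half_pos hs)).1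
  simp only [dist_zero_right] at h1
  have hC : 0 ≤ C := by have := (abs_nonneg _).trans (hb 0); simpa using this
  refine (h1.const_mul (C * (1 + 8 / s ^ 2))).mono' (by fun_prop) (Eventually.of_forall fun w => ?_)
  have h2 : ‖w‖ ^ 4 ≤ 8 / s ^ 2 * Real.exp (s / 2 * ‖w‖ ^ 2) := by
    have := Real.quadratic_le_exp_of_nonneg (x := s / 2 * ‖w‖ ^ 2) (by positivity)
    rw [div_mul_eq_mul_div, le_div_iff₀ (by positivity)]
    nlinarith [sq_nonneg (‖w‖), mul_nonneg hs.le (sq_nonneg ‖w‖)]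
  have h3 : 1 ≤ Real.exp (s / 2 * ‖w‖ ^ 2) := Real.one_le_exp (by positivity)
  rw [Real.norm_eq_abs, abs_mul, Real.abs_exp]
  have he : Real.exp (s / 2 * ‖w‖ ^ 2) * Real.exp (-s * ‖w‖ ^ 2) = Real.exp (-(s/2) * ‖w‖ ^ 2) := by
    rw [← Real.exp_add]; congr 1; ring
  calc _ ≤ C * (1 + ‖w‖ ^ 4) * Real.exp (-s * ‖w‖ ^ 2) := by gcongr; exact hb w
    _ ≤ C * (Real.exp (s / 2 * ‖w‖ ^ 2) + 8 / s ^ 2 * Real.exp (s / 2 * ‖w‖ ^ 2)) * Real.exp (-s * ‖w‖ ^ 2) := by gcongr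
    _ = C * (1 + 8 / s ^ 2) * (Real.exp (s / 2 * ‖w‖ ^ 2) * Real.exp (-s * ‖w‖ ^ 2)) := by ring
    _ = _ := by rw [he]

def dn (ν : Measure (E 4)) (ρ : E 4 → ℝ) : Measure (E 4) := ν.withDensity fun w => ENNReal.ofReal (ρ w)

lemma dn_int {ν : Measure (E 4)} {ρ : E 4 → ℝ} (hρ : Continuous ρ) (h0 : ∀ w, 0 ≤ ρ w) (f : E 4 → ℝ) :
    ∫ w, f w ∂(dn ν ρ) = ∫ w, ρ w * f w ∂ν := by
  rw [dn, integral_withDensity_eq_integral_toReal_smul (by fun_prop) (Eventually.of_forall fun _ => ENNReal.ofReal_lt_top)]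
  simp [ENNReal.toReal_ofReal (h0 _)]

lemma dn_integrable {ν : Measure (E 4)} {ρ : E 4 → ℝ} (hρ : Continuous ρ) (h0 : ∀ w, 0 ≤ ρ w) (f : E 4 → ℝ) :
    Integrable f (dn ν ρ) ↔ Integrable (fun w => ρ w * f w) ν := by
  rw [dn, integrable_withDensity_iff_integrable_smul' (by fun_prop) (Eventually.of_forall fun _ => ENNReal.ofReal_lt_top)]
  simp [ENNReal.toReal_ofReal (h0 _)]

lemma s_deriv {ν : Measure (E 4)} {ρ : E 4 → ℝ} (hρ : Continuous ρ) (h0 : ∀ w, 0 ≤ ρ w) {K p : ℝ}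
    (hi : ∀ s : ℝ, 0 < s → Integrable (fun w => ρ w * Real.exp (-s * ‖w‖ ^ 2)) ν)
    (hv : ∀ s : ℝ, 0 < s → ∫ w, ρ w * Real.exp (-s * ‖w‖ ^ 2) ∂ν = K * s ^ (-p)) {s : ℝ} (hs : 0 < s) :
    ∫ w, ρ w * ‖w‖ ^ 2 * Real.exp (-s * ‖w‖ ^ 2) ∂ν = p * K * s ^ (-(p + 1)) := by
  set D : E 4 → ℝ := fun w => ρ w * Real.exp (-s * ‖w‖ ^ 2) with hD
  have hDc : Continuous D := by fun_prop
  have hD0 : ∀ w, 0 ≤ D w := fun w => mul_nonneg (h0 w) (Real.exp_pos _).le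
  have hcomb : ∀ t w, D w * Real.exp (t * ‖w‖ ^ 2) = ρ w * Real.exp (-(s - t) * ‖w‖ ^ 2) := by
    intro t w; rw [hD, mul_assoc, ← Real.exp_add]; congr 2; ring
  have hset : 0 ∈ interior (ProbabilityTheory.integrableExpSet (fun w => ‖w‖ ^ 2) (dn ν D)) := by
    refine mem_interior.2 ⟨Iio s, fun t ht => ?_, isOpen_Iio, hs⟩
    rw [ProbabilityTheory.integrableExpSet, mem_ofPred_eq, dn_integrable hDc hD0]
    simp only [hcomb]; exact hi _ (sub_pos.2 ht)
  have h1 := ProbabilityTheory.deriv_mgf_zero hset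
  have h2 : ProbabilityTheory.mgf (fun w => ‖w‖ ^ 2) (dn ν D) =ᶠ[𝓝 0] fun t => K * (s - t) ^ (-p) := by
    filter_upwards [gt_mem_nhds hs] with t ht
    rw [ProbabilityTheory.mgf, dn_int hDc hD0]
    simp only [hcomb]; exact hv _ (sub_pos.2 ht)
  rw [h2.deriv_eq, dn_int hDc hD0] at h1
  have h3 : HasDerivAt (fun t => K * (s - t) ^ (-p)) (K * (-1 * (-p) * (s - 0) ^ (-p - 1))) 0 := by
    refine HasDerivAt.const_mul _ ?_
    exact ((hasDerivAt_id (0:ℝ)).const_sub s).rpow_const (Or.inl (by simpa using hs.ne'))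
  rw [h3.deriv] at h1
  have : ∀ w, ρ w * ‖w‖ ^ 2 * Real.exp (-s * ‖w‖ ^ 2) = D w * ‖w‖ ^ 2 := fun w => by rw [hD]; ring
  simp only [this, ← h1, sub_zero, neg_add']
  ring

lemma gder (k : ℝ) (a b c : ℝ → ℝ) (hab : ∀ t, HasDerivAt a (b t) t)
    (hc : ∀ t, c t = b t + 2 * k * t * a t) :
    deriv (fun t => a t * Real.exp (k * t ^ 2)) = fun t => c t * Real.exp (k * t ^ 2) := by
  funext t
  have h1 : HasDerivAt (fun t => Real.exp (k * t ^ 2)) (Real.exp (k * t ^ 2) * (k * (2 * t))) t := by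
    have := ((hasDerivAt_pow 2 t).const_mul k).exp
    simpa using this
  refine ((hab t).fun_mul h1).deriv.trans ?_; rw [hc]; ring

/-- Moments along the support (a cone). -/
lemma moments {ν : Measure (E 4)} (hν : Unif ν) (h0 : 0 ∈ msupp ν)
    (hray : ∀ x ∈ msupp ν, ∀ t : ℝ, 0 < t → t • x ∈ msupp ν) {x : E 4} (hx : x ∈ msupp ν) {s : ℝ} (hs : 0 < s) :
    ∫ w, ⟪x, w⟫ * Real.exp (-s * ‖w‖ ^ 2) ∂ν = 0 ∧
    ∫ w, ⟪x, w⟫ ^ 2 * Real.exp (-s * ‖w‖ ^ 2) ∂ν = cg * ‖x‖ ^ 2 / 2 * s ^ (-(5 / 2) : ℝ) ∧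
    ∫ w, ⟪x, w⟫ ^ 4 * Real.exp (-s * ‖w‖ ^ 2) ∂ν = 3 / 4 * cg * ‖x‖ ^ 4 * s ^ (-(7 / 2) : ℝ) := by
  set D : E 4 → ℝ := fun w => Real.exp (-s * ‖w‖ ^ 2) with hD
  have hDc : Continuous D := by fun_prop
  have hD0 : ∀ w, 0 ≤ D w := fun w => (Real.exp_pos _).le
  set X : E 4 → ℝ := fun w => ⟪x, w⟫ with hX
  have hset : ProbabilityTheory.integrableExpSet X (dn ν D) = univ := by
    refine eq_univ_of_forall fun t => ?_
    rw [ProbabilityTheory.integrableExpSet, mem_ofPred_eq, dn_integrable hDc hD0]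
    have h1 := (gauss hν h0 (half_pos hs)).1
    simp only [dist_zero_right] at h1
    refine (h1.const_mul (Real.exp (t ^ 2 * ‖x‖ ^ 2 / (2 * s)))).mono' (by fun_prop) (Eventually.of_forall fun w => ?_)
    rw [Real.norm_of_nonneg (by positivity), hD, ← Real.exp_add, ← Real.exp_add, Real.exp_le_exp]
    have h2 : t * X w ≤ |t| * ‖x‖ * ‖w‖ := by
      refine (le_abs_self _).trans ?_
      rw [abs_mul, mul_assoc]; exact mul_le_mul_of_nonneg_left (abs_real_inner_le_norm _ _) (abs_nonneg _)
    have h3 : |t| * ‖x‖ * ‖w‖ ≤ t ^ 2 * ‖x‖ ^ 2 / (2 * s) + s / 2 * ‖w‖ ^ 2 := by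
      have : t ^ 2 * ‖x‖ ^ 2 / (2 * s) + s / 2 * ‖w‖ ^ 2 - |t| * ‖x‖ * ‖w‖ = (|t| * ‖x‖ - s * ‖w‖) ^ 2 / (2 * s) := by
        rw [← sq_abs t]; field_simp; ring
      have h4 : 0 ≤ (|t| * ‖x‖ - s * ‖w‖) ^ 2 / (2 * s) := by positivity
      linarith
    linarith
  have h0i : 0 ∈ interior (ProbabilityTheory.integrableExpSet X (dn ν D)) := by rw [hset]; simp
  set k := ‖x‖ ^ 2 / (4 * s) with hk
  set c := cg * s ^ (-(3 / 2) : ℝ) with hc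
  have hpos : ∀ t : ℝ, 0 < t → ProbabilityTheory.mgf X (dn ν D) t = c * Real.exp (k * t ^ 2) := by
    intro t ht
    rw [ProbabilityTheory.mgf, dn_int hDc hD0]
    have h1 := (gauss hν (hray x hx (t / (2 * s)) (by positivity)) hs).2
    have h2 : ∀ w, D w * Real.exp (t * X w) =
        Real.exp (k * t ^ 2) * Real.exp (-s * dist w ((t / (2 * s)) • x) ^ 2) := by
      intro w
      rw [hD, ← Real.exp_add, ← Real.exp_add, dist_eq_norm, norm_sub_sq_real, norm_smul, inner_smul_right,
        real_inner_comm, mul_pow, Real.norm_eq_abs, sq_abs, hk]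
      congr 1; simp only [hX]; field_simp; ring
    simp only [h2]
    rw [integral_const_mul, h1]; ring
  have hana := ProbabilityTheory.analyticOnNhd_mgf (X := X) (μ := dn ν D)
  rw [hset, interior_univ] at hana
  have hfun : ProbabilityTheory.mgf X (dn ν D) = fun t => c * Real.exp (k * t ^ 2) := by
    have ha2 : AnalyticOnNhd ℝ (fun t : ℝ => c * Real.exp (k * t ^ 2)) univ := fun t _ => by fun_prop
    have := hana.eqOn_of_preconnected_of_eventuallyEq ha2 isPreconnected_univ (mem_univ (1:ℝ)) (by
      filter_upwards [lt_mem_nhds (zero_lt_one)] with t ht using hpos t ht)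
    funext t; exact this (mem_univ t)
  have d1 := gder k (fun _ => c) (fun _ => 0) (fun t => 2 * k * t * c) (fun t => hasDerivAt_const t c) (fun t => by ring)
  have d2 := gder k (fun t => 2 * k * t * c) (fun _ => 2 * k * c) (fun t => 2 * k * c + 4 * k ^ 2 * t ^ 2 * c)
    (fun t => by simpa using ((hasDerivAt_id t).const_mul (2 * k)).mul_const c) (fun t => by ring)
  have d3 := gder k (fun t => 2 * k * c + 4 * k ^ 2 * t ^ 2 * c) (fun t => 8 * k ^ 2 * t * c)
    (fun t => 12 * k ^ 2 * t * c + 8 * k ^ 3 * t ^ 3 * c)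
    (fun t => by
      have := (((hasDerivAt_pow 2 t).const_mul (4 * k ^ 2)).mul_const c).const_add (2 * k * c)
      exact this.congr_deriv (by norm_num only [Nat.cast_ofNat]; ring)) (fun t => by ring)
  have d4 := gder k (fun t => 12 * k ^ 2 * t * c + 8 * k ^ 3 * t ^ 3 * c) (fun t => 12 * k ^ 2 * c + 24 * k ^ 3 * t ^ 2 * c)
    (fun t => 12 * k ^ 2 * c + 48 * k ^ 3 * t ^ 2 * c + 16 * k ^ 4 * t ^ 4 * c)
    (fun t => by
      have := (((hasDerivAt_id t).const_mul (12 * k ^ 2)).mul_const c).fun_add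
        (((hasDerivAt_pow 3 t).const_mul (8 * k ^ 3)).mul_const c)
      exact this.congr_deriv (by norm_num only [Nat.cast_ofNat]; ring)) (fun t => by ring)
  have e1 := ProbabilityTheory.deriv_mgf_zero h0i
  have e2 := ProbabilityTheory.iteratedDeriv_mgf_zero h0i 2
  have e4 := ProbabilityTheory.iteratedDeriv_mgf_zero h0i 4
  rw [hfun] at e1 e2 e4
  simp only [iteratedDeriv_succ, iteratedDeriv_zero, d1, d2, d3, d4] at e1 e2 e4
  rw [dn_int hDc hD0] at e1 e2 e4
  have hs52 : s ^ (-(3 / 2) : ℝ) = s * s ^ (-(5/2) : ℝ) := by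
    rw [← Real.rpow_one_add' hs.le (by norm_num)]; norm_num
  have hs72 : s ^ (-(3 / 2) : ℝ) = s ^ 2 * s ^ (-(7/2) : ℝ) := by
    rw [← Real.rpow_natCast, ← Real.rpow_add hs]; norm_num
  simp only [mul_comm (D _)] at e1 e2 e4
  refine ⟨by rw [← e1]; simp, ?_, ?_⟩
  · refine Eq.trans e2.symm ?_
    simp only [hk, hc, hs52]; simp; field_simp; ring
  · refine Eq.trans e4.symm ?_
    simp [hk, hc, hs72]; field_simp; ring

lemma alg4 {a b c d t : ℝ} (ha : 0 < a) (hb : b < 0) (h1 : a + b + c + d = 1)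
    (h2 : a ^ 2 + b ^ 2 + c ^ 2 + d ^ 2 = 1)
    (pa : a = 0 ∨ (8 * t - 2) * a ^ 2 + (4 * t + 4) * a + (11 / 2 + 3 * t) = 0)
    (pb : b = 0 ∨ (8 * t - 2) * b ^ 2 + (4 * t + 4) * b + (11 / 2 + 3 * t) = 0)
    (pc : c = 0 ∨ (8 * t - 2) * c ^ 2 + (4 * t + 4) * c + (11 / 2 + 3 * t) = 0)
    (pd : d = 0 ∨ (8 * t - 2) * d ^ 2 + (4 * t + 4) * d + (11 / 2 + 3 * t) = 0) :
    a = 1 / 2 ∧ b = - 1 / 2 ∧ c = 1 / 2 ∧ d = 1 / 2 := by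
  replace pa := pa.resolve_left ha.ne'
  replace pb := pb.resolve_left hb.ne
  have hv : (8 * t - 2) * (a + b) + (4 * t + 4) = 0 := by
    have : (a - b) * ((8 * t - 2) * (a + b) + (4 * t + 4)) = 0 := by linear_combination pa - pb
    exact (mul_eq_zero.1 this).resolve_left (by linarith)
  have hl : 8 * t - 2 ≠ 0 := by
    intro h; rw [h] at hv; linarith
  have root : ∀ x, (x = 0 ∨ (8 * t - 2) * x ^ 2 + (4 * t + 4) * x + (11 / 2 + 3 * t) = 0) →
      x = 0 ∨ x = a ∨ x = b := by
    rintro x (h | h)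
    · exact Or.inl h
    · right
      have : (x - a) * ((8 * t - 2) * (x - b)) = 0 := by linear_combination h - pa - (x - a) * hv
      rcases mul_eq_zero.1 this with h | h
      · left; linarith
      · right; rcases mul_eq_zero.1 h with h | h
        · exact absurd h hl
        · linarith
  have two : ∀ a b : ℝ, 0 < a → a + a + b = 1 → a ^ 2 + a ^ 2 + b ^ 2 = 1 →
      (8 * t - 2) * a ^ 2 + (4 * t + 4) * a + (11 / 2 + 3 * t) = 0 →
      (8 * t - 2) * b ^ 2 + (4 * t + 4) * b + (11 / 2 + 3 * t) = 0 → False := by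
    intro a b ha h1 h2 pa pb
    have hb : b = 1 - 2 * a := by linarith
    subst hb
    have : a = 2 / 3 := by
      have : a * (a - 2 / 3) = 0 := by nlinarith
      rcases mul_eq_zero.1 this with h | h <;> linarith
    subst this; norm_num at pa pb; linarith
  rcases root c pc with rfl | rfl | rfl <;> rcases root d pd with rfl | rfl | rfl
  · nlinarith
  · exact (two d b ha (by linarith) (by linarith) pa pb).elim
  · nlinarith
  · exact (two c b ha (by linarith) (by linarith) pa pb).elim
  · have hb : b = 1 - 3 * d := by linarith
    have : d = 1 / 2 := by
      have : d * (d - 1 / 2) = 0 := by rw [hb] at h2; nlinarith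
      rcases mul_eq_zero.1 this with h | h <;> linarith
    subst this; norm_num at hb; refine ⟨rfl, ?_, rfl, rfl⟩; linarith
  · exfalso
    have hs : c + d = 1 / 2 := by linarith
    have ht : t = -3 / 8 := by rw [hs] at hv; linarith
    subst ht
    nlinarith
  · nlinarith
  · exfalso
    have hs : d + c = 1 / 2 := by linarith
    have ht : t = -3 / 8 := by rw [hs] at hv; linarith
    subst ht
    nlinarith
  · nlinarith

lemma kp_alg {l : Fin 4 → ℝ} {T : Fin 4 → Fin 4 → ℝ} (h1 : ∑ i, l i = 1) (h2 : ∑ i, l i ^ 2 = 1)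
    (hp : ∃ p, 0 < l p) (hq : ∃ q, l q < 0) (hT : ∀ i j, T i j = T j i)
    (hr : ∀ i, ∑ j, T i j = 5 / 3 * (1 - l i)) (hz : ∀ i, ∑ j, l j * T i j = 0)
    (hQ : ∀ y : Fin 4 → ℝ, ∑ i, l i * y i = 0 →
      ∑ i, ∑ j, (3 * T i j - 1) * (y i * y j) - 2 * ∑ i, T i i * y i ^ 2 = 0) :
    ∃ k, l k = -1 / 2 ∧ ∀ i, i ≠ k → l i = 1 / 2 := by
  have hpol : ∀ y z : Fin 4 → ℝ, ∑ i, l i * y i = 0 → ∑ i, l i * z i = 0 →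
      ∑ i, ∑ j, (3 * T i j - 1) * (y i * z j) - 2 * ∑ i, T i i * (y i * z i) = 0 := by
    intro y z hy hz
    have e1 := hQ (fun i => y i + z i) (by
      simp only [mul_add, Finset.sum_add_distrib, hy, hz, add_zero])
    have e2 := hQ y hy
    have e3 := hQ z hz
    simp only [Fin.sum_univ_four, hT 1 0, hT 2 0, hT 3 0, hT 2 1, hT 3 1, hT 3 2] at *
    linear_combination (e1 - e2 - e3) / 2
  obtain ⟨γ, hγ⟩ : ∃ γ : Fin 4 → ℝ, ∀ i j, 3 * T i j - 1 - (if i = j then 2 * T i i else 0) =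
      l i * γ j + l j * γ i := by
    set M : Fin 4 → Fin 4 → ℝ := fun i j => 3 * T i j - 1 - (if i = j then 2 * T i i else 0) with hM
    refine ⟨fun i => ∑ j, M i j - 1 / 2 * l i * ∑ a, ∑ b, M a b, fun i j => ?_⟩
    have := hpol (fun a => (if a = i then 1 else 0) - l i) (fun a => (if a = j then 1 else 0) - l j)
      (by simp [mul_sub, Finset.sum_sub_distrib, ← Finset.sum_mul, h1])
      (by simp [mul_sub, Finset.sum_sub_distrib, ← Finset.sum_mul, h1])
    simp only [Fin.sum_univ_four, hM] at *
    fin_cases i <;> fin_cases j <;>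
      simp [hT 1 0, hT 2 0, hT 3 0, hT 2 1, hT 3 1, hT 3 2] at this ⊢ <;> linear_combination this
  have hd : ∀ i, T i i = 1 + 2 * l i * γ i := by
    intro i; have := hγ i i; simp at this; linarith
  set s := ∑ i, γ i with hs
  set t := ∑ i, l i * γ i with ht
  have hA : ∀ i, s * l i + γ i * (1 + 4 * l i) = -1 - 5 * l i := by
    intro i
    have e : ∑ j, (3 * T i j - 1 - (if i = j then 2 * T i i else 0)) = ∑ j, (l i * γ j + l j * γ i) :=
      Finset.sum_congr rfl fun j _ => hγ i j
    simp only [Finset.sum_sub_distrib, Finset.sum_add_distrib, ← Finset.mul_sum, ← Finset.sum_mul, hr,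
      h1, Finset.sum_ite_eq, Finset.mem_univ, if_true, hd, ← hs] at e
    simp at e; linear_combination -e
  have hB : ∀ i, t * l i + γ i * (1 + 4 * l i ^ 2) = -1 - 2 * l i := by
    intro i
    have e : ∑ j, l j * (3 * T i j - 1 - (if i = j then 2 * T i i else 0)) = ∑ j, l j * (l i * γ j + l j * γ i) :=
      Finset.sum_congr rfl fun j _ => by rw [hγ i j]
    have e1 : ∑ j, l j * (l i * γ j + l j * γ i) = l i * t + γ i := by
      rw [ht, Finset.mul_sum]
      calc _ = ∑ j, (l i * (l j * γ j)) + ∑ j, l j ^ 2 * γ i := by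
            rw [← Finset.sum_add_distrib]; exact Finset.sum_congr rfl fun j _ => by ring
        _ = _ := by rw [← Finset.sum_mul, h2, one_mul]
    have e2 : ∑ j, l j * (3 * T i j - 1 - (if i = j then 2 * T i i else 0)) = -1 - 2 * l i * T i i := by
      calc _ = 3 * ∑ j, l j * T i j - ∑ j, l j - ∑ j, (if i = j then 2 * l j * T i i else 0) := by
            rw [Finset.mul_sum, ← Finset.sum_sub_distrib, ← Finset.sum_sub_distrib]
            refine Finset.sum_congr rfl fun j _ => ?_
            split_ifs <;> ring
        _ = _ := by rw [hz, h1]; simp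
    rw [e1, e2, hd] at e; linear_combination -e
  have hst : 2 * s + 4 * t = -9 := by
    have : ∑ i, (s * l i + γ i * (1 + 4 * l i)) = ∑ i, (-1 - 5 * l i) := Finset.sum_congr rfl fun i _ => hA i
    simp only [Fin.sum_univ_four] at *
    linear_combination this - (s+5) * h1 + hs + 4 * ht
  have hP : ∀ i, l i = 0 ∨ (8 * t - 2) * l i ^ 2 + (4 * t + 4) * l i + (11 / 2 + 3 * t) = 0 := by
    intro i
    by_cases h0 : l i = 0
    · exact Or.inl h0
    right
    have e : 4 * γ i * (1 - l i) = 3 / 2 + 3 * t := by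
      have : l i * (4 * γ i * (1 - l i) - (3 / 2 + 3 * t)) = 0 := by
        linear_combination hA i - hB i - l i * hst / 2
      have := (mul_eq_zero.1 this).resolve_left h0
      linarith
    linear_combination 4 * (1 - l i) * hB i - (1 + 4 * l i ^ 2) * e
  obtain ⟨p, hp⟩ := hp
  obtain ⟨q, hq⟩ := hq
  have hpq : p ≠ q := by rintro rfl; linarith
  have hex : ∀ p q : Fin 4, p ≠ q → ∃ r s : Fin 4, p ≠ r ∧ p ≠ s ∧ q ≠ r ∧ q ≠ s ∧ r ≠ s := by decide
  obtain ⟨r, s', a1, a2, a3, a4, a5⟩ := hex p q hpq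
  have huniv : (Finset.univ : Finset (Fin 4)) = {p, q, r, s'} := by
    symm; apply Finset.eq_univ_of_card
    simp [*]
  have hsum : ∀ f : Fin 4 → ℝ, ∑ i, f i = f p + f q + f r + f s' := by
    intro f; rw [huniv, Finset.sum_insert (by simp [*]), Finset.sum_insert (by simp [*]),
      Finset.sum_insert (by simp [*]), Finset.sum_singleton]; ring
  rw [hsum] at h1 h2
  obtain ⟨b1, b2, b3, b4⟩ := alg4 hp hq h1 h2 (hP p) (hP q) (hP r) (hP s')
  refine ⟨q, b2, fun i hi => ?_⟩
  have : i ∈ (Finset.univ : Finset (Fin 4)) := Finset.mem_univ i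
  rw [huniv] at this
  simp only [Finset.mem_insert, Finset.mem_singleton] at this
  rcases this with rfl | rfl | rfl | rfl
  · exact b1
  · exact absurd rfl hi
  · exact b3
  · exact b4

abbrev OB4 := OrthonormalBasis (Fin 4) ℝ (E 4)

def diagL (e : OB4) (l : Fin 4 → ℝ) : E 4 →L[ℝ] E 4 := ∑ i, l i • (innerSL ℝ (e i)).smulRight (e i)

lemma diagL_apply (e : OB4) (l : Fin 4 → ℝ) (x : E 4) : diagL e l x = ∑ i, (l i * ⟪e i, x⟫) • e i := by
  simp [diagL, smul_smul]

lemma diagL_inner (e : OB4) (l : Fin 4 → ℝ) (x y : E 4) :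
    ⟪diagL e l x, y⟫ = ∑ i, l i * (⟪e i, x⟫ * ⟪e i, y⟫) := by
  rw [diagL_apply, sum_inner]
  exact Finset.sum_congr rfl fun i _ => by rw [inner_smul_left]; simp; ring

lemma diagL_symm (e : OB4) (l : Fin 4 → ℝ) : SymL (diagL e l) := fun x y => by
  rw [diagL_inner, diagL_inner]; exact Finset.sum_congr rfl fun i _ => by ring

lemma ob_ne (e : OB4) (i : Fin 4) : e i ≠ 0 := by
  intro h; have := e.orthonormal.1 i; rw [h] at this; simp at this

lemma diagL_e (e : OB4) (l : Fin 4 → ℝ) (i : Fin 4) : diagL e l (e i) = l i • e i := by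
  rw [diagL_apply, Finset.sum_eq_single i]
  · simp
  · intro j _ hj; rw [e.inner_eq_zero hj]; simp
  · simp

lemma norm_coord (e : OB4) (x : E 4) : ∑ i, ⟪e i, x⟫ ^ 2 = ‖x‖ ^ 2 := e.sum_sq_inner_right x

lemma anal_pow (e : OB4) (ν : Measure (E 4)) (n : ℕ) (G : E 4 → ℝ)
    (hi : ∀ p : Fin n → Fin 4, Integrable (fun w => (∏ i, ⟪e (p i), w⟫) * G w) ν) :
    AnalyticOnNhd ℝ (fun x => ∫ w, ⟪x, w⟫ ^ n * G w ∂ν) univ := by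
  have h : (fun x => ∫ w, ⟪x, w⟫ ^ n * G w ∂ν) =
      fun x => ∑ p : Fin n → Fin 4, (∏ i, ⟪e (p i), x⟫) * ∫ w, (∏ i, ⟪e (p i), w⟫) * G w ∂ν := by
    funext x
    have : ∀ w, ⟪x, w⟫ ^ n * G w = ∑ p : Fin n → Fin 4, (∏ i, ⟪e (p i), x⟫) * ((∏ i, ⟪e (p i), w⟫) * G w) := by
      intro w
      rw [← e.sum_inner_mul_inner x w, Fintype.sum_pow, Finset.sum_mul]
      refine Finset.sum_congr rfl fun p _ => ?_
      rw [Finset.prod_mul_distrib, mul_assoc]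
      congr 1; exact Finset.prod_congr rfl fun i _ => real_inner_comm _ _
    simp only [this]
    rw [integral_finsetSum _ fun p _ => (hi p).const_mul _]
    exact Finset.sum_congr rfl fun p _ => integral_const_mul _ _
  rw [h]
  intro x _
  refine Finset.analyticAt_fun_sum _ fun p _ => AnalyticAt.mul ?_ analyticAt_const
  exact Finset.analyticAt_fun_prod _ fun i _ => (innerSL ℝ (e (p i))).analyticAt x

lemma norm_anal : AnalyticOnNhd ℝ (fun x : E 4 => ‖x‖ ^ 2) univ := by
  intro x _
  have h1 : AnalyticAt ℝ (fun u : E 4 => ⟪u, u⟫) x :=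
    AnalyticAt.comp (f := fun u : E 4 => (u, u)) ((innerSL ℝ (E := E 4)).analyticAt_bilinear _)
      (analyticAt_id.prod analyticAt_id)
  simpa only [real_inner_self_eq_norm_sq] using h1

lemma ext_pos {l : Fin 4 → ℝ} (h1 : ∑ i, l i = 1) {q : Fin 4} (hq : l q < 0) {N : Fin 4 → Fin 4 → ℝ}
    (h : ∀ y : Fin 4 → ℝ, (∀ i, 0 ≤ y i) → ∑ i, l i * y i = 0 → ∑ i, ∑ j, N i j * (y i * y j) = 0)
    (y : Fin 4 → ℝ) (hy : ∑ i, l i * y i = 0) : ∑ i, ∑ j, N i j * (y i * y j) = 0 := by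
  set z : Fin 4 → ℝ := fun i => 1 + if i = q then -(l q)⁻¹ else 0 with hz
  have hz1 : ∀ i, 1 ≤ z i := by
    intro i; simp only [hz]; split_ifs
    · have : (l q)⁻¹ < 0 := inv_lt_zero.2 hq
      linarith
    · simp
  have hzl : ∑ i, l i * z i = 0 := by
    simp only [hz, mul_add, Finset.sum_add_distrib, mul_one, h1, mul_ite, mul_zero,
      Finset.sum_ite_eq', Finset.mem_univ, if_true]
    rw [mul_neg, mul_inv_cancel₀ hq.ne]; ring
  set τ := (1 + ∑ i, |y i|)⁻¹ with hτ
  have hpos : 0 < 1 + ∑ i, |y i| := by positivity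
  have hτp : 0 < τ := inv_pos.2 hpos
  have hle : ∀ i, |τ * y i| ≤ 1 := by
    intro i
    rw [abs_mul, abs_of_pos hτp, hτ, inv_mul_le_iff₀ hpos]
    have := Finset.single_le_sum (f := fun i => |y i|) (fun i _ => abs_nonneg _) (Finset.mem_univ i)
    linarith
  have e1 := h (fun i => z i + τ * y i) (fun i => by have := hz1 i; have := (abs_le.1 (hle i)).1; linarith) (by
    simp only [mul_add, Finset.sum_add_distrib, hzl, mul_left_comm _ τ, ← Finset.mul_sum, hy]; simp)
  have e2 := h (fun i => z i - τ * y i) (fun i => by have := hz1 i; have := (abs_le.1 (hle i)).2; linarith) (by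
    simp only [mul_sub, Finset.sum_sub_distrib, hzl, mul_left_comm _ τ, ← Finset.mul_sum, hy]; simp)
  have e3 := h z (fun i => by have := hz1 i; linarith) hzl
  have : 2 * τ ^ 2 * ∑ i, ∑ j, N i j * (y i * y j) = 0 := by
    have : ∑ i, ∑ j, N i j * ((z i + τ * y i) * (z j + τ * y j)) + ∑ i, ∑ j, N i j * ((z i - τ * y i) * (z j - τ * y j))
        = 2 * ∑ i, ∑ j, N i j * (z i * z j) + 2 * τ ^ 2 * ∑ i, ∑ j, N i j * (y i * y j) := by
      simp only [Finset.mul_sum, ← Finset.sum_add_distrib]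
      exact Finset.sum_congr rfl fun i _ => Finset.sum_congr rfl fun j _ => by ring
    linarith
  have h2 : 2 * τ ^ 2 ≠ 0 := by positivity
  exact (mul_eq_zero.1 this).resolve_left h2

lemma ext_lin {l : Fin 4 → ℝ} (h1 : ∑ i, l i = 1) {q : Fin 4} (hq : l q < 0) {v : Fin 4 → ℝ}
    (h : ∀ y : Fin 4 → ℝ, (∀ i, 0 ≤ y i) → ∑ i, l i * y i = 0 → ∑ i, v i * y i = 0)
    (i : Fin 4) : v i = l i * ∑ j, v j := by
  have e : ∀ y : Fin 4 → ℝ, ∑ i, ∑ j, (v i * v j) * (y i * y j) = (∑ i, v i * y i) * ∑ i, v i * y i := by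
    intro y; rw [Finset.sum_mul_sum]
    exact Finset.sum_congr rfl fun i _ => Finset.sum_congr rfl fun j _ => by ring
  have := ext_pos h1 hq (N := fun i j => v i * v j) (fun y hy hl => by rw [e, h y hy hl, zero_mul])
    (fun j => (if j = i then 1 else 0) - l i) (by simp [mul_sub, Finset.sum_sub_distrib, ← Finset.sum_mul, h1])
  rw [e] at this
  have := mul_self_eq_zero.1 this
  simp [mul_sub, Finset.sum_sub_distrib, ← Finset.sum_mul] at this
  linarith

def sg (b : Bool) : ℝ := if b then 1 else -1
def sgz (z : Fin 4 → ℝ) (s : Bool × Bool × Bool) : Fin 4 → ℝ := ![z 0, sg s.1 * z 1, sg s.2.1 * z 2, sg s.2.2 * z 3]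

lemma sgz_sq (z : Fin 4 → ℝ) (s) (i) : sgz z s i ^ 2 = z i ^ 2 := by
  fin_cases i <;> simp [sgz, sg]

lemma avg2 (z a : Fin 4 → ℝ) : ∑ s, (∑ i, sgz z s i * a i) ^ 2 = 8 * ∑ i, z i ^ 2 * a i ^ 2 := by
  simp only [Fintype.sum_prod_type, Fintype.sum_bool, Fin.sum_univ_four, sgz, sg]
  simp; ring

lemma avg4 (z a : Fin 4 → ℝ) : ∑ s, (∑ i, sgz z s i * a i) ^ 4 =
    8 * (3 * ∑ i, ∑ j, (z i ^ 2 * z j ^ 2) * (a i ^ 2 * a j ^ 2) - 2 * ∑ i, (z i ^ 2) ^ 2 * (a i ^ 2 * a i ^ 2)) := by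
  simp only [Fintype.sum_prod_type, Fintype.sum_bool, Fin.sum_univ_four, sgz, sg]
  simp; ring

lemma indef {ν : Measure (E 4)} (hsp : Spans ν) {e : OB4} {l : Fin 4 → ℝ} (h1 : ∑ i, l i = 1)
    (hF : ∀ x ∈ msupp ν, ∑ i, l i * ⟪e i, x⟫ ^ 2 = 0) : (∃ p, 0 < l p) ∧ ∃ q, l q < 0 := by
  have hp : ∃ p, 0 < l p := by
    by_contra! h
    have : ∑ i, l i ≤ 0 := Finset.sum_nonpos fun i _ => h i
    linarith
  refine ⟨hp, ?_⟩
  by_contra! h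
  obtain ⟨p, hp⟩ := hp
  obtain ⟨x, hx, hne⟩ := hsp (e p) (ob_ne e p)
  have := (Finset.sum_eq_zero_iff_of_nonneg (fun i _ => mul_nonneg (h i) (sq_nonneg _))).1 (hF x hx) p (Finset.mem_univ p)
  rcases mul_eq_zero.1 this with h | h
  · exact hp.ne' h
  · exact hne (by simpa using h)

lemma ray {ν : Measure (E 4)} (hν : Unif ν) (hsp : Spans ν) {e : OB4} {l : Fin 4 → ℝ} (h1 : ∑ i, l i = 1)
    (hF : ∀ x ∈ msupp ν, ∑ i, l i * ⟪e i, x⟫ ^ 2 = 0) : ∀ x ∈ msupp ν, ∀ t : ℝ, 0 < t → t • x ∈ msupp ν := by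
  obtain ⟨⟨p, hp⟩, q, hq⟩ := indef hsp h1 hF
  intro x hx t ht
  refine K3 hν (diagL_symm e l) (fun x hx => ?_) (e.orthonormal.1 p) (v := e q) ?_ ?_ ?_ hx ht
  · rw [diagL_inner, ← hF x hx]; exact Finset.sum_congr rfl fun i _ => by ring
  · exact e.inner_eq_zero (by rintro rfl; linarith)
  · rw [diagL_e]; exact smul_ne_zero hq.ne (ob_ne e q)
  · intro y hy
    have := diagL_symm e l (e p) y
    rw [hy, diagL_e, inner_smul_left, inner_zero_left] at this
    exact (mul_eq_zero.1 this).resolve_left hp.ne'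

theorem KPeig {ν : Measure (E 4)} (hν : Unif ν) (h0 : 0 ∈ msupp ν) (hsp : Spans ν) {e : OB4} {l : Fin 4 → ℝ}
    (h1 : ∑ i, l i = 1) (hF : ∀ x ∈ msupp ν, ∑ i, l i * ⟪e i, x⟫ ^ 2 = 0) :
    ∃ k, l k = -1 / 2 ∧ ∀ i, i ≠ k → l i = 1 / 2 := by
  have hray := ray hν hsp h1 hF
  obtain ⟨⟨p, hp⟩, q, hq⟩ := indef hsp h1 hF
  have hLF : ∀ x, ⟪diagL e l x, x⟫ = ∑ i, l i * ⟪e i, x⟫ ^ 2 := fun x => by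
    rw [diagL_inner]; exact Finset.sum_congr rfl fun i _ => by ring
  have hL0 : diagL e l ≠ 0 := by
    intro h; have := diagL_e e l p; rw [h] at this
    exact smul_ne_zero hp.ne' (ob_ne e p) (by simpa using this.symm)
  have hco : ∀ i w, |⟪e i, w⟫| ≤ ‖w‖ := fun i w => by
    have := abs_real_inner_le_norm (e i) w; rwa [e.orthonormal.1 i, one_mul] at this
  have hprod : ∀ (n : ℕ) (p : Fin n → Fin 4) w, |∏ i, ⟪e (p i), w⟫| ≤ ‖w‖ ^ n := by
    intro n p w
    rw [Finset.abs_prod]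
    refine (Finset.prod_le_prod (fun _ _ => abs_nonneg _) fun i _ => hco (p i) w).trans ?_
    simp
  have b2 : ∀ w : E 4, ‖w‖ ^ 2 ≤ 1 * (1 + ‖w‖ ^ 4) := fun w => by nlinarith [sq_nonneg (‖w‖ ^ 2 - 1)]
  have b4 : ∀ w : E 4, ‖w‖ ^ 4 ≤ 1 * (1 + ‖w‖ ^ 4) := fun w => by linarith
  set g : E 4 → ℝ := fun w => Real.exp (-1 * ‖w‖ ^ 2) with hg
  -- integrability
  have i2 : ∀ (s : ℝ), 0 < s → ∀ x, Integrable (fun w => ⟪x, w⟫ ^ 2 * Real.exp (-s * ‖w‖ ^ 2)) ν := by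
    intro s hs x
    refine gint hν h0 hs (C := ‖x‖ ^ 2) (by fun_prop) fun w => ?_
    rw [abs_pow, ← one_mul (1 + ‖w‖ ^ 4)]
    refine (pow_le_pow_left₀ (abs_nonneg _) (abs_real_inner_le_norm x w) 2).trans ?_
    rw [mul_pow]; exact mul_le_mul_of_nonneg_left (b2 w) (by positivity)
  have iN : ∀ (s : ℝ), 0 < s → Integrable (fun w : E 4 => ‖w‖ ^ 2 * Real.exp (-s * ‖w‖ ^ 2)) ν := by
    intro s hs
    refine gint hν h0 hs (C := 1) (by fun_prop) fun w => ?_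
    rw [abs_of_nonneg (by positivity)]; exact b2 w
  -- moments
  have m2 : ∀ x ∈ msupp ν, ∫ w, ⟪x, w⟫ ^ 2 * g w ∂ν = cg / 2 * ‖x‖ ^ 2 := fun x hx => by
    have := (moments hν h0 hray hx one_pos).2.1
    rw [this]; simp; ring
  have m4 : ∀ x ∈ msupp ν, ∫ w, ⟪x, w⟫ ^ 4 * g w ∂ν = 3 / 4 * cg * ‖x‖ ^ 4 := fun x hx => by
    have := (moments hν h0 hray hx one_pos).2.2
    rw [this]; simp
  have m22 : ∀ x ∈ msupp ν, ∫ w, ⟪x, w⟫ ^ 2 * (‖w‖ ^ 2 * g w) ∂ν = 5 / 4 * cg * ‖x‖ ^ 2 := fun x hx => by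
    have := s_deriv (ν := ν) (ρ := fun w => ⟪x, w⟫ ^ 2) (by fun_prop) (fun w => sq_nonneg _)
      (fun s hs => i2 s hs x) (fun s hs => (moments hν h0 hray hx hs).2.1) one_pos
    simp only [mul_assoc] at this
    rw [this]; simp; ring
  have n2 : ∀ s : ℝ, 0 < s → ∫ w, ‖w‖ ^ 2 * Real.exp (-s * ‖w‖ ^ 2) ∂ν = 3 / 2 * cg * s ^ (-(5 / 2) : ℝ) := fun s hs => by
    have := s_deriv (ν := ν) (ρ := fun w => 1) (by fun_prop) (fun w => zero_le_one) (K := cg) (p := 3 / 2)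
      (fun s hs => by simpa using (gauss hν h0 hs).1) (fun s hs => by simpa using (gauss hν h0 hs).2) hs
    simp only [one_mul] at this
    rw [this]; norm_num
  have n4 : ∫ w, ‖w‖ ^ 2 * (‖w‖ ^ 2 * g w) ∂ν = 15 / 4 * cg := by
    have := s_deriv (ν := ν) (ρ := fun w => ‖w‖ ^ 2) (by fun_prop) (fun w => by positivity) iN n2 one_pos
    simp only [mul_assoc] at this
    rw [this]; simp; ring
  -- extension to the quadric
  have ext2 : ∀ (G : E 4 → ℝ) (κ : ℝ) (hi : ∀ p : Fin 2 → Fin 4, Integrable (fun w => (∏ i, ⟪e (p i), w⟫) * G w) ν)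
      (hm : ∀ x ∈ msupp ν, ∫ w, ⟪x, w⟫ ^ 2 * G w ∂ν = κ * ‖x‖ ^ 2) (x : E 4)
      (hx : ∑ i, l i * ⟪e i, x⟫ ^ 2 = 0), ∫ w, ⟪x, w⟫ ^ 2 * G w ∂ν = κ * ‖x‖ ^ 2 := by
    intro G κ hi hm x hx
    have := K5 hν (diagL_symm e l) (fun x hx => by rw [hLF, hF x hx]) hsp hL0 (d := 2)
      (P := fun x => ∫ w, ⟪x, w⟫ ^ 2 * G w ∂ν - κ * ‖x‖ ^ 2)
      ((anal_pow e ν 2 G hi).sub (analyticOnNhd_const.mul norm_anal)) (fun a x => by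
        simp only [inner_smul_left, mul_pow, norm_smul, mul_assoc, integral_const_mul]
        simp; ring) (fun x hx => by rw [hm x hx, sub_self]) (z := x) (by rw [hLF, hx])
    linarith
  have ext4 : ∀ (x : E 4) (_ : ∑ i, l i * ⟪e i, x⟫ ^ 2 = 0), ∫ w, ⟪x, w⟫ ^ 4 * g w ∂ν = 3 / 4 * cg * (‖x‖ ^ 2) ^ 2 := by
    intro x hx
    have := K5 hν (diagL_symm e l) (fun x hx => by rw [hLF, hF x hx]) hsp hL0 (d := 4)
      (P := fun x => ∫ w, ⟪x, w⟫ ^ 4 * g w ∂ν - 3 / 4 * cg * (‖x‖ ^ 2) ^ 2)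
      ((anal_pow e ν 4 g fun p => gint hν h0 one_pos (C := 1) (by fun_prop) fun w => (hprod 4 p w).trans (b4 w)).sub
        (analyticOnNhd_const.mul (norm_anal.pow 2))) (fun a x => by
        simp only [inner_smul_left, mul_pow, norm_smul, mul_assoc, integral_const_mul]
        simp; ring) (fun x hx => by rw [m4 x hx]; ring) (z := x) (by rw [hLF, hx])
    linarith
  set X : (Fin 4 → ℝ) → E 4 := fun c => ∑ i, c i • e i with hX
  have hXe : ∀ c i, ⟪e i, X c⟫ = c i := fun c i => e.orthonormal.inner_right_fintype c i
  have hXn : ∀ c, ‖X c‖ ^ 2 = ∑ i, c i ^ 2 := fun c => by rw [← norm_coord e]; simp only [hXe]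
  have hXw : ∀ c w, ⟪X c, w⟫ = ∑ i, c i * ⟪e i, w⟫ := fun c w => by
    rw [hX, sum_inner]; exact Finset.sum_congr rfl fun i _ => by rw [inner_smul_left]; simp
  have lin : ∀ (G : E 4 → ℝ) (κ : ℝ) (hi : ∀ p : Fin 2 → Fin 4, Integrable (fun w => (∏ i, ⟪e (p i), w⟫) * G w) ν)
      (hm : ∀ x ∈ msupp ν, ∫ w, ⟪x, w⟫ ^ 2 * G w ∂ν = κ * ‖x‖ ^ 2) (i : Fin 4),
      ∫ w, ⟪e i, w⟫ ^ 2 * G w ∂ν - κ = l i * (∑ j, ∫ w, ⟪e j, w⟫ ^ 2 * G w ∂ν - 4 * κ) := by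
    intro G κ hi hm i
    have hii : ∀ i, Integrable (fun w => ⟪e i, w⟫ ^ 2 * G w) ν := fun i => by
      simpa [Fin.prod_univ_two, sq] using hi (fun _ => i)
    have := ext_lin h1 hq (v := fun i => ∫ w, ⟪e i, w⟫ ^ 2 * G w ∂ν - κ) (fun y hy hyl => ?_) i
    · rw [this]; simp
    set z : Fin 4 → ℝ := fun i => √(y i) with hz
    have hzz : ∀ i, z i ^ 2 = y i := fun i => Real.sq_sqrt (hy i)
    have hs : ∀ s, ∫ w, ⟪X (sgz z s), w⟫ ^ 2 * G w ∂ν = κ * ∑ i, y i := by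
      intro s
      rw [ext2 G κ hi hm _ (by simp only [hXe, sgz_sq, hzz, hyl]), hXn]
      simp only [sgz_sq, hzz]
    have hint : ∀ s, Integrable (fun w => ⟪X (sgz z s), w⟫ ^ 2 * G w) ν := by
      intro s
      have : ∀ w, ⟪X (sgz z s), w⟫ ^ 2 * G w = ∑ p : Fin 2 → Fin 4, (∏ i, sgz z s (p i)) * ((∏ i, ⟪e (p i), w⟫) * G w) := by
        intro w
        rw [hXw, Fintype.sum_pow, Finset.sum_mul]
        exact Finset.sum_congr rfl fun p _ => by rw [Finset.prod_mul_distrib, mul_assoc]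
      simp only [this]
      exact integrable_finsetSum _ fun p _ => (hi p).const_mul _
    have hsum : ∑ s, ∫ w, ⟪X (sgz z s), w⟫ ^ 2 * G w ∂ν = 8 * ∑ i, y i * ∫ w, ⟪e i, w⟫ ^ 2 * G w ∂ν := by
      rw [← integral_finsetSum _ fun s _ => hint s]
      simp only [← Finset.sum_mul, hXw, avg2, hzz]
      simp only [mul_assoc, Finset.sum_mul, integral_const_mul]
      rw [integral_finsetSum _ fun i _ => (hii i).const_mul _]
      simp only [integral_const_mul]
    simp only [hs] at hsum
    simp at hsum
    simp only [sub_mul, Finset.sum_sub_distrib, ← Finset.mul_sum]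
    simp only [mul_comm (y _)] at hsum
    linarith
  have ig2 : ∀ p : Fin 2 → Fin 4, Integrable (fun w => (∏ i, ⟪e (p i), w⟫) * g w) ν := fun p =>
    gint hν h0 one_pos (C := 1) (by fun_prop) fun w => (hprod 2 p w).trans (b2 w)
  have ig22 : ∀ p : Fin 2 → Fin 4, Integrable (fun w => (∏ i, ⟪e (p i), w⟫) * (‖w‖ ^ 2 * g w)) ν := fun p => by
    have := gint hν h0 one_pos (f := fun w => (∏ i, ⟪e (p i), w⟫) * ‖w‖ ^ 2) (C := 1) (by fun_prop) fun w => by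
      rw [abs_mul, abs_of_nonneg (sq_nonneg ‖w‖)]
      refine (mul_le_mul_of_nonneg_right (hprod 2 p w) (sq_nonneg _)).trans ((b4 w).trans' (by ring_nf; rfl))
    simpa only [mul_assoc] using this
  have it : ∀ i j, Integrable (fun w => (⟪e i, w⟫ ^ 2 * ⟪e j, w⟫ ^ 2) * g w) ν := fun i j =>
    gint hν h0 one_pos (C := 1) (by fun_prop) fun w => by
      rw [abs_mul, abs_pow, abs_pow]
      have h1 := pow_le_pow_left₀ (abs_nonneg _) (hco i w) 2
      have h2 := pow_le_pow_left₀ (abs_nonneg _) (hco j w) 2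
      refine (mul_le_mul h1 h2 (by positivity) (by positivity)).trans ((b4 w).trans' (by ring_nf; rfl))
  have isq : ∀ i, Integrable (fun w => ⟪e i, w⟫ ^ 2 * g w) ν := fun i => i2 1 one_pos (e i)
  set t : Fin 4 → Fin 4 → ℝ := fun i j => ∫ w, (⟪e i, w⟫ ^ 2 * ⟪e j, w⟫ ^ 2) * g w ∂ν with ht
  have hae : ∀ᵐ w ∂ν, ∑ i, l i * ⟪e i, w⟫ ^ 2 = 0 := (msupp_ae ν).mono hF
  have hcg := cg_pos
  -- second moments
  have hA : ∀ i, ∫ w, ⟪e i, w⟫ ^ 2 * g w ∂ν = cg / 2 * (1 - l i) := by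
    intro i
    have h := lin g (cg / 2) ig2 m2 i
    have h2 := n2 1 one_pos
    rw [← integral_finsetSum _ fun i _ => isq i] at h
    simp only [← Finset.sum_mul, norm_coord] at h
    simp only [hg] at h ⊢
    rw [h2] at h
    simp at h ⊢; linear_combination h
  have h22 : ∀ i, ∫ w, ⟪e i, w⟫ ^ 2 * (‖w‖ ^ 2 * g w) ∂ν = 5 / 4 * cg * (1 - l i) := by
    intro i
    have h := lin (fun w => ‖w‖ ^ 2 * g w) (5 / 4 * cg) ig22 m22 i
    rw [← integral_finsetSum _ fun i _ => by simpa [Fin.prod_univ_two, sq] using ig22 (fun _ => i)] at h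
    simp only [← Finset.sum_mul, norm_coord] at h
    rw [n4] at h
    linear_combination h
  have hl2 : ∑ i, l i ^ 2 = 1 := by
    have : ∑ i, l i * ∫ w, ⟪e i, w⟫ ^ 2 * g w ∂ν = 0 := by
      simp only [← integral_const_mul]
      rw [← integral_finsetSum _ fun i _ => (isq i).const_mul _]
      simp only [← mul_assoc, ← Finset.sum_mul]
      rw [← integral_zero (E 4) ℝ (μ := ν)]
      exact integral_congr_ae (hae.mono fun w hw => by simp [hw])
    simp only [hA] at this
    have e : ∑ i, l i * (cg / 2 * (1 - l i)) = cg / 2 * (∑ i, l i - ∑ i, l i ^ 2) := by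
      rw [← Finset.sum_sub_distrib, Finset.mul_sum]; exact Finset.sum_congr rfl fun i _ => by ring
    rw [e, h1] at this
    have := (mul_eq_zero.1 this).resolve_left (by positivity)
    linarith
  have hrow : ∀ i, ∑ j, t i j = 5 / 4 * cg * (1 - l i) := by
    intro i
    rw [← h22 i, ht, ← integral_finsetSum _ fun j _ => it i j]
    congr 1; funext w
    rw [← norm_coord e w, Finset.sum_mul, Finset.mul_sum]
    exact Finset.sum_congr rfl fun j _ => by ring
  have hzero : ∀ i, ∑ j, l j * t i j = 0 := by
    intro i
    simp only [ht, ← integral_const_mul]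
    rw [← integral_finsetSum _ fun j _ => (it i j).const_mul _, ← integral_zero (E 4) ℝ (μ := ν)]
    refine integral_congr_ae (hae.mono fun w hw => ?_)
    have : ∑ j, l j * (⟪e i, w⟫ ^ 2 * ⟪e j, w⟫ ^ 2 * g w) = (⟪e i, w⟫ ^ 2 * g w) * ∑ j, l j * ⟪e j, w⟫ ^ 2 := by
      rw [Finset.mul_sum]; exact Finset.sum_congr rfl fun j _ => by ring
    simp only [this, hw, mul_zero]
  have hquad : ∀ y : Fin 4 → ℝ, (∀ i, 0 ≤ y i) → ∑ i, l i * y i = 0 →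
      3 * ∑ i, ∑ j, y i * y j * t i j - 2 * ∑ i, y i ^ 2 * t i i = 3 / 4 * cg * (∑ i, y i) ^ 2 := by
    intro y hy hyl
    set z : Fin 4 → ℝ := fun i => √(y i) with hz
    have hzz : ∀ i, z i ^ 2 = y i := fun i => Real.sq_sqrt (hy i)
    have hs : ∀ s, ∫ w, ⟪X (sgz z s), w⟫ ^ 4 * g w ∂ν = 3 / 4 * cg * (∑ i, y i) ^ 2 := by
      intro s
      rw [ext4 _ (by simp only [hXe, sgz_sq, hzz, hyl]), hXn]
      simp only [sgz_sq, hzz]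
    have hint : ∀ s, Integrable (fun w => ⟪X (sgz z s), w⟫ ^ 4 * g w) ν := by
      intro s
      refine gint hν h0 one_pos (C := ‖X (sgz z s)‖ ^ 4) (by fun_prop) fun w => ?_
      rw [abs_pow, ← one_mul (1 + ‖w‖ ^ 4)]
      refine (pow_le_pow_left₀ (abs_nonneg _) (abs_real_inner_le_norm _ w) 4).trans ?_
      rw [mul_pow]; exact mul_le_mul_of_nonneg_left (b4 w) (by positivity)
    have hsum : ∑ s, ∫ w, ⟪X (sgz z s), w⟫ ^ 4 * g w ∂ν =
        8 * (3 * ∑ i, ∑ j, y i * y j * t i j - 2 * ∑ i, y i ^ 2 * t i i) := by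
      rw [← integral_finsetSum _ fun s _ => hint s]
      have ee : ∀ w, ∑ s, ⟪X (sgz z s), w⟫ ^ 4 * g w =
          8 * (3 * ∑ i, ∑ j, y i * y j * ((⟪e i, w⟫ ^ 2 * ⟪e j, w⟫ ^ 2) * g w) -
            2 * ∑ i, y i ^ 2 * ((⟪e i, w⟫ ^ 2 * ⟪e i, w⟫ ^ 2) * g w)) := by
        intro w
        rw [← Finset.sum_mul]
        simp only [hXw, avg4, hzz]
        simp only [← mul_assoc (y _ * y _), ← mul_assoc (y _ ^ 2), ← Finset.sum_mul]
        ring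
      have f1 : ∀ i j, Integrable (fun w => y i * y j * ((⟪e i, w⟫ ^ 2 * ⟪e j, w⟫ ^ 2) * g w)) ν := fun i j => (it i j).const_mul _
      have f2 : ∀ i, Integrable (fun w => y i ^ 2 * ((⟪e i, w⟫ ^ 2 * ⟪e i, w⟫ ^ 2) * g w)) ν := fun i => (it i i).const_mul _
      simp only [ee, integral_const_mul]
      rw [integral_sub ((integrable_finsetSum _ fun i _ => integrable_finsetSum _ fun j _ => f1 i j).const_mul 3)
        ((integrable_finsetSum _ fun i _ => f2 i).const_mul 2), integral_const_mul, integral_const_mul,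
        integral_finsetSum _ fun i _ => integrable_finsetSum _ fun j _ => f1 i j, integral_finsetSum _ fun i _ => f2 i]
      simp only [integral_finsetSum _ fun j _ => f1 _ j, integral_const_mul, ht]
    simp only [hs] at hsum
    simp at hsum
    linarith
  have hN : ∀ y : Fin 4 → ℝ, 3 * ∑ i, ∑ j, y i * y j * t i j - 2 * ∑ i, y i ^ 2 * t i i - 3 / 4 * cg * (∑ i, y i) ^ 2 =
      ∑ i, ∑ j, (3 * t i j - 3 / 4 * cg - if i = j then 2 * t i i else 0) * (y i * y j) := by
    intro y
    have : ∑ i, y i ^ 2 * t i i = ∑ i, ∑ j, if i = j then t i i * (y i * y j) else 0 := by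
      refine Finset.sum_congr rfl fun i _ => ?_
      simp; ring
    rw [this, sq, Finset.sum_mul_sum]
    simp only [Finset.mul_sum, ← Finset.sum_sub_distrib]
    refine Finset.sum_congr rfl fun i _ => Finset.sum_congr rfl fun j _ => ?_
    split_ifs <;> ring
  have hall := ext_pos h1 hq (N := fun i j => 3 * t i j - 3 / 4 * cg - if i = j then 2 * t i i else 0)
    (fun y hy hyl => by rw [← hN, hquad y hy hyl, sub_self])
  refine kp_alg (T := fun i j => t i j / (3 / 4 * cg)) h1 hl2 ⟨p, hp⟩ ⟨q, hq⟩ (fun i j => ?_) (fun i => ?_)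
    (fun i => ?_) (fun y hy => ?_)
  · simp only [ht, mul_comm]
  · rw [← Finset.sum_div, hrow]; field_simp
  · simp only [← mul_div_assoc]; rw [← Finset.sum_div, hzero, zero_div]
  · have := hall y hy
    rw [← hN] at this
    have e2 : ∑ i, t i i / (3 / 4 * cg) * y i ^ 2 = (3 / 4 * cg)⁻¹ * ∑ i, y i ^ 2 * t i i := by
      rw [Finset.mul_sum]; exact Finset.sum_congr rfl fun i _ => by ring
    have e1 : ∑ i, ∑ j, (3 * (t i j / (3 / 4 * cg)) - 1) * (y i * y j) =
        3 * ((3 / 4 * cg)⁻¹ * ∑ i, ∑ j, y i * y j * t i j) - (∑ i, y i) ^ 2 := by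
      rw [sq, Finset.sum_mul_sum]
      simp only [Finset.mul_sum, ← Finset.sum_sub_distrib]
      exact Finset.sum_congr rfl fun i _ => Finset.sum_congr rfl fun j _ => by ring
    rw [e1, e2]
    have h3 : (3 / 4 * cg)⁻¹ * (3 / 4 * cg) = 1 := inv_mul_cancel₀ (by positivity)
    linear_combination (3 / 4 * cg)⁻¹ * this + (∑ i, y i) ^ 2 * h3

def kpL (u : E 4) : E 4 →L[ℝ] E 4 := (1 / 2 : ℝ) • ContinuousLinearMap.id ℝ (E 4) - (innerSL ℝ u).smulRight u

lemma kpL_apply (u x : E 4) : kpL u x = (1 / 2 : ℝ) • x - ⟪u, x⟫ • u := by simp [kpL]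

lemma kpL_inner (u x y : E 4) : ⟪kpL u x, y⟫ = 1 / 2 * ⟪x, y⟫ - ⟪u, x⟫ * ⟪u, y⟫ := by
  rw [kpL_apply, inner_sub_left, inner_smul_left, inner_smul_left]; simp

lemma kpL_self (u x : E 4) : ⟪kpL u x, x⟫ = 1 / 2 * ‖x‖ ^ 2 - ⟪u, x⟫ ^ 2 := by
  rw [kpL_inner, real_inner_self_eq_norm_sq]; ring

lemma kpL_symm (u : E 4) : SymL (kpL u) := fun x y => by
  rw [kpL_inner, kpL_inner, real_inner_comm]; ring

lemma kpL_ne {u x : E 4} (hu : ‖u‖ = 1) (hx : x ≠ 0) : kpL u x ≠ 0 := by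
  intro h
  have h1 : ⟪kpL u x, u⟫ = 0 := by rw [h, inner_zero_left]
  have h2 : ⟪kpL u x, x⟫ = 0 := by rw [h, inner_zero_left]
  rw [kpL_inner, real_inner_self_eq_norm_sq, hu, real_inner_comm] at h1
  have h3 : ⟪u, x⟫ = 0 := by linarith
  rw [kpL_self, h3] at h2
  exact hx (norm_eq_zero.1 (by nlinarith [norm_nonneg x]))

lemma both_sides {ν : Measure (E 4)} (hν : Unif ν) (h0 : 0 ∈ msupp ν) (hsp : Spans ν)
    (hray : ∀ x ∈ msupp ν, ∀ t : ℝ, 0 < t → t • x ∈ msupp ν) {e : E 4} (he : e ≠ 0) : ∃ x ∈ msupp ν, 0 < ⟪e, x⟫ := by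
  have := hν.1
  by_contra! hneg
  have hbd : ∀ w : E 4, ‖w‖ ≤ 1 + ‖w‖ ^ 4 := fun w => by
    nlinarith [sq_nonneg (‖w‖ ^ 2 - 1), sq_nonneg (‖w‖ - 1), sq_nonneg (‖w‖)]
  have hi : Integrable (fun w : E 4 => Real.exp (-1 * ‖w‖ ^ 2) • w) ν := by
    have := gint hν h0 one_pos (f := fun w => ‖w‖) continuous_norm (C := 1) (fun w => by
      rw [abs_of_nonneg (norm_nonneg w), one_mul]; exact hbd w)
    refine this.mono' (by fun_prop) (Eventually.of_forall fun w => ?_)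
    rw [norm_smul, Real.norm_eq_abs, abs_of_pos (Real.exp_pos _), mul_comm]
  have hv : ∀ x, ⟪x, ∫ w, Real.exp (-1 * ‖w‖ ^ 2) • w ∂ν⟫ = ∫ w, ⟪x, w⟫ * Real.exp (-1 * ‖w‖ ^ 2) ∂ν := by
    intro x
    rw [← integral_inner hi]
    exact integral_congr_ae (Eventually.of_forall fun w => by simp only [inner_smul_right]; ring)
  have hv0 : ∫ w, Real.exp (-1 * ‖w‖ ^ 2) • w ∂ν = 0 := by
    by_contra hne
    obtain ⟨x, hx, hx0⟩ := hsp _ hne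
    rw [real_inner_comm, hv] at hx0
    exact hx0 (moments hν h0 hray hx one_pos).1
  have hz := hv e
  rw [hv0, inner_zero_right] at hz
  have hie : Integrable (fun w => ⟪e, w⟫ * Real.exp (-1 * ‖w‖ ^ 2)) ν := by
    have := hi.const_inner (𝕜 := ℝ) e
    refine this.congr (Eventually.of_forall fun w => by simp only [inner_smul_right]; ring)
  have hae : ∀ᵐ w ∂ν, 0 ≤ -(⟪e, w⟫ * Real.exp (-1 * ‖w‖ ^ 2)) := by
    filter_upwards [msupp_ae ν] with w hw
    have := hneg w hw
    nlinarith [Real.exp_pos (-1 * ‖w‖ ^ 2)]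
  have hz2 := (integral_eq_zero_iff_of_nonneg_ae hae hie.neg).1 (by rw [integral_neg, ← hz, neg_zero])
  obtain ⟨x, hx, hx0⟩ := hsp e he
  have hop : IsOpen {w : E 4 | ⟪e, w⟫ ≠ 0} := isOpen_ne_fun (by fun_prop) continuous_const
  obtain ⟨s, hs, hsub⟩ := Metric.isOpen_iff.1 hop x hx0
  have hpos := hx (s / 2) (half_pos hs)
  refine hpos.ne' (measure_mono_null (fun w hw => ?_) (ae_iff.1 hz2))
  have hw2 : ⟪e, w⟫ ≠ 0 := hsub (closedBall_subset_ball (half_lt_self hs) hw)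
  simp only [mem_ofPred_eq, Pi.zero_apply, neg_eq_zero, mul_eq_zero, not_or]
  exact ⟨hw2, (Real.exp_pos _).ne'⟩

lemma kp_full {ν : Measure (E 4)} (hν : Unif ν) (h0 : 0 ∈ msupp ν) (hsp : Spans ν)
    (hray : ∀ x ∈ msupp ν, ∀ t : ℝ, 0 < t → t • x ∈ msupp ν) {e : E 4} (he : ‖e‖ = 1)
    (hF : ∀ x ∈ msupp ν, ⟪kpL e x, x⟫ = 0) {p : E 4} (hp : ⟪kpL e p, p⟫ = 0) : p ∈ msupp ν := by
  have main : ∀ e : E 4, ‖e‖ = 1 → (∀ x ∈ msupp ν, ⟪kpL e x, x⟫ = 0) → ∀ p, ⟪kpL e p, p⟫ = 0 → 0 < ⟪e, p⟫ → p ∈ msupp ν := by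
    clear he hF hp p e
    intro e he hF p hp hpos
    have he0 : e ≠ 0 := by rintro rfl; simp at he
    obtain ⟨J, hJ⟩ := exists_hyper_emb e he0
    have hee : ⟪e, e⟫ = 1 := by rw [real_inner_self_eq_norm_sq, he]; norm_num
    have hJe : ∀ v, ⟪e, J v⟫ = 0 := fun v => (hJ _).2 ⟨v, rfl⟩
    have hΦ : Continuous fun v : E 3 => J v + ‖v‖ • e := by
      have := J.continuous; fun_prop
    have hrep : ∀ x, ⟪kpL e x, x⟫ = 0 → 0 < ⟪e, x⟫ → ∃ v, v ≠ 0 ∧ J v + ‖v‖ • e = x := by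
      intro x hx hx0
      obtain ⟨v, hv⟩ := (hJ (x - ⟪e, x⟫ • e)).1 (by rw [inner_sub_right, inner_smul_right, hee]; ring)
      have hn : ‖v‖ = ⟪e, x⟫ := by
        have h1 : ‖v‖ ^ 2 = ⟪e, x⟫ ^ 2 := by
          rw [← J.norm_map, hv, ← real_inner_self_eq_norm_sq, inner_sub_left, inner_sub_right, inner_sub_right,
            inner_smul_right, inner_smul_right, inner_smul_left, inner_smul_left, hee, real_inner_comm e x,
            real_inner_self_eq_norm_sq]
          rw [kpL_self] at hx
          simp; nlinarith
        exact (sq_eq_sq₀ (norm_nonneg _) hx0.le).1 h1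
      refine ⟨v, ?_, by rw [hn, hv]; abel⟩
      rintro rfl; rw [norm_zero] at hn; linarith
    have hΦ0 : ∀ v : E 3, ⟪kpL e (J v + ‖v‖ • e), J v + ‖v‖ • e⟫ = 0 := by
      intro v
      rw [kpL_self, inner_add_right, hJe, inner_smul_right, hee, ← real_inner_self_eq_norm_sq, inner_add_left,
        inner_add_right, inner_add_right, inner_smul_left, inner_smul_right, inner_smul_left, real_inner_comm e (J v),
        hJe, inner_smul_right, real_inner_self_eq_norm_sq, J.norm_map, hee]
      simp; ring
    have hpre : IsPreconnected ({0}ᶜ : Set (E 3)) := by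
      refine (isConnected_compl_singleton_of_one_lt_rank ?_ 0).isPreconnected
      rw [← Module.finrank_eq_rank]; simp
    have hsub := preconn_sub (s := ({0}ᶜ : Set (E 3))) (u := {v | J v + ‖v‖ • e ∈ msupp ν}) hpre ?_ ?_
      ((msupp_closed ν).preimage hΦ)
    · obtain ⟨v, hv0, hv⟩ := hrep p hp hpos
      rw [← hv]; exact hsub hv0
    · obtain ⟨x, hx, hx0⟩ := both_sides hν h0 hsp hray he0
      obtain ⟨v, hv0, hv⟩ := hrep x (hF x hx) hx0
      exact ⟨v, hv0, by rw [mem_ofPred_eq, hv]; exact hx⟩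
    · rintro v ⟨hv0, hv⟩
      have hne : J v + ‖v‖ • e ≠ 0 := by
        intro h
        have : ⟪e, J v + ‖v‖ • e⟫ = 0 := by rw [h, inner_zero_right]
        rw [inner_add_right, hJe, inner_smul_right, hee, zero_add, mul_one] at this
        exact hv0 (norm_eq_zero.1 this)
      obtain ⟨ε, hε, hk⟩ := K1 hν (kpL_symm e) hF hv (kpL_ne he hne)
      have := hΦ.continuousAt.preimage_mem_nhds (ball_mem_nhds (J v + ‖v‖ • e) hε)
      filter_upwards [this] with w hw
      exact hk _ (hΦ0 w) hw
  rcases lt_trichotomy 0 ⟪e, p⟫ with h | h | h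
  · exact main e he hF p hp h
  · rw [kpL_self, ← h] at hp
    have : p = 0 := norm_eq_zero.1 (by nlinarith [norm_nonneg p])
    rw [this]; exact h0
  · have hneg : ∀ x, ⟪kpL (-e) x, x⟫ = ⟪kpL e x, x⟫ := fun x => by
      rw [kpL_self, kpL_self, inner_neg_left]; ring
    refine main (-e) (by rw [norm_neg, he]) (fun x hx => by rw [hneg, hF x hx]) p (by rw [hneg, hp]) (by rw [inner_neg_left]; linarith)

lemma eigen4 {L : E 4 →L[ℝ] E 4} (hs : SymL L) : ∃ (e : OB4) (l : Fin 4 → ℝ), ∀ i, L (e i) = l i • e i := by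
  have hT : (L : E 4 →ₗ[ℝ] E 4).IsSymmetric := fun x y => by
    simpa [real_inner_comm] using hs x y
  exact ⟨hT.eigenvectorBasis (by simp), hT.eigenvalues (by simp), fun i => hT.apply_eigenvectorBasis (by simp) i⟩

lemma eigen4_eq {L : E 4 →L[ℝ] E 4} {e : OB4} {l : Fin 4 → ℝ} (h : ∀ i, L (e i) = l i • e i) : L = diagL e l := by
  have : (L : E 4 →ₗ[ℝ] E 4) = (diagL e l : E 4 →ₗ[ℝ] E 4) := by
    refine e.toBasis.ext fun i => ?_
    simp [h, diagL_e]
  exact ContinuousLinearMap.coe_injective this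

/-- Lemma K: Kowalski--Preiss. -/
theorem LK {ν : Measure (E 4)} (hν : Unif ν) (h0 : 0 ∈ msupp ν) (hsp : Spans ν) {L : E 4 →L[ℝ] E 4} (hs : SymL L)
    (htr : ∀ e : OB4, ∑ i, ⟪L (e i), e i⟫ = 1) (hF : ∀ x ∈ msupp ν, ⟪L x, x⟫ = 0) :
    ∃ u : E 4, ‖u‖ = 1 ∧ L = kpL u ∧ ∀ x, x ∈ msupp ν ↔ ⟪kpL u x, x⟫ = 0 := by
  obtain ⟨e, l, hel⟩ := eigen4 hs
  have hL := eigen4_eq hel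
  have h1 : ∑ i, l i = 1 := by
    rw [← htr e]; exact Finset.sum_congr rfl fun i _ => by
      rw [hel, inner_smul_left, real_inner_self_eq_norm_sq, e.orthonormal.1]; simp
  have hF' : ∀ x ∈ msupp ν, ∑ i, l i * ⟪e i, x⟫ ^ 2 = 0 := fun x hx => by
    rw [← hF x hx, hL, diagL_inner]; exact Finset.sum_congr rfl fun i _ => by ring
  obtain ⟨k, hk, hi⟩ := KPeig hν h0 hsp h1 hF'
  have hLk : L = kpL (e k) := by
    have : diagL e (fun i => if i = k then -1/2 else 1/2) = kpL (e k) := by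
      refine (eigen4_eq fun i => ?_).symm
      rw [kpL_apply]
      split_ifs with h
      · rw [h, real_inner_self_eq_norm_sq, e.orthonormal.1]; module
      · rw [e.inner_eq_zero (Ne.symm h)]; module
    rw [hL, ← this]; congr 1; funext i
    split_ifs with h
    · rw [h, hk]
    · exact hi i h
  refine ⟨e k, e.orthonormal.1 k, hLk, fun x => ⟨fun hx => hLk ▸ hF x hx, fun hx => ?_⟩⟩
  exact kp_full hν h0 hsp (ray hν hsp h1 hF') (e.orthonormal.1 k) (fun x hx => hLk ▸ hF x hx) hx

lemma nsi {n : E 4} (hn : n ≠ 0) : ‖‖n‖⁻¹ • n‖ = 1 := by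
  rw [norm_smul, norm_inv, norm_norm]; exact inv_mul_cancel₀ (norm_ne_zero_iff.2 hn)

abbrev E4L := E 4 →L[ℝ] E 4

lemma lim_pt {ι : Type*} {U : Filter ι} {μs : ι → Measure (E 4)} {y : E 4}
    (h : ∀ s : ℝ, 0 < s → ∀ᶠ i in U, ∃ z ∈ msupp (μs i), dist z y < s) :
    ∃ z : ι → E 4, Tendsto z U (𝓝 y) ∧ ∀ᶠ i in U, z i ∈ msupp (μs i) := by
  classical
  have hc : ∀ i, ∃ z, (msupp (μs i)).Nonempty → z ∈ msupp (μs i) ∧ infDist y (msupp (μs i)) = dist y z := by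
    intro i
    by_cases hne : (msupp (μs i)).Nonempty
    · obtain ⟨z, hz, hd⟩ := (msupp_closed (μs i)).exists_infDist_eq_dist hne y
      exact ⟨z, fun _ => ⟨hz, hd⟩⟩
    · exact ⟨0, fun h => absurd h hne⟩
  choose z hz using hc
  refine ⟨z, Metric.tendsto_nhds.2 fun s hs => ?_, ?_⟩
  · filter_upwards [h s hs] with i ⟨w, hw, hd⟩
    rw [dist_comm, ← (hz i ⟨w, hw⟩).2]
    exact (infDist_le_dist_of_mem hw).trans_lt (by rwa [dist_comm])
  · filter_upwards [h 1 one_pos] with i ⟨w, hw, hd⟩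
    exact (hz i ⟨w, hw⟩).1

lemma op_expand (e : OB4) (A : E4L) :
    A = ∑ j, ∑ k, ⟪A (e j), e k⟫ • (innerSL ℝ (e j)).smulRight (e k) := by
  ext1 x
  have h1 : A x = ∑ j, ⟪e j, x⟫ • A (e j) := by
    conv_lhs => rw [← e.sum_repr' x]
    simp [map_sum]
  have h2 : ∀ v : E 4, v = ∑ k, ⟪v, e k⟫ • e k := fun v => by
    conv_lhs => rw [← e.sum_repr' v]
    exact Finset.sum_congr rfl fun k _ => by rw [real_inner_comm]
  rw [h1]
  simp only [sum_apply, smul_apply, ContinuousLinearMap.smulRight_apply, innerSL_apply_apply]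
  refine Finset.sum_congr rfl fun j _ => ?_
  conv_lhs => rw [h2 (A (e j)), Finset.smul_sum]
  exact Finset.sum_congr rfl fun k _ => by rw [smul_smul, smul_smul, mul_comm]

def ob4 : OB4 := EuclideanSpace.basisFun (Fin 4) ℝ

lemma op_tendsto {ι : Type*} {U : Filter ι} {A : ι → E4L} {A0 : E4L}
    (h : ∀ x y, Tendsto (fun i => ⟪A i x, y⟫) U (𝓝 ⟪A0 x, y⟫)) : Tendsto A U (𝓝 A0) := by
  rw [op_expand ob4 A0]
  exact (tendsto_finsetSum _ fun j _ => tendsto_finsetSum _ fun k _ => (h (ob4 j) (ob4 k)).smul_const _).congr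
    fun i => (op_expand ob4 (A i)).symm

lemma vec_tendsto {ι : Type*} {U : Filter ι} {b : ι → E 4} {b0 : E 4}
    (h : ∀ x, Tendsto (fun i => ⟪x, b i⟫) U (𝓝 ⟪x, b0⟫)) : Tendsto b U (𝓝 b0) := by
  rw [← ob4.sum_repr' b0]
  exact (tendsto_finsetSum _ fun j _ => (h (ob4 j)).smul_const _).congr fun i => ob4.sum_repr' (b i)

lemma clm_tendsto {ι : Type*} {U : Filter ι} {A : ι → E4L} {A0 : E4L} {z : ι → E 4} {z0 : E 4}
    (hA : Tendsto A U (𝓝 A0)) (hz : Tendsto z U (𝓝 z0)) : Tendsto (fun i => A i (z i)) U (𝓝 (A0 z0)) :=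
  ((isBoundedBilinearMap_apply (𝕜 := ℝ) (E := E 4) (F := E 4)).continuous.tendsto (A0, z0)).comp (hA.prodMk_nhds hz)

lemma opq_tendsto {ι : Type*} {U : Filter ι} {A : ι → E4L} {A0 : E4L} {z : ι → E 4} {z0 : E 4}
    (hA : Tendsto A U (𝓝 A0)) (hz : Tendsto z U (𝓝 z0)) :
    Tendsto (fun i => ⟪A i (z i), z i⟫) U (𝓝 ⟪A0 z0, z0⟫) := (clm_tendsto hA hz).inner hz

lemma VT.Aop {ι : Type*} {U : Filter ι} {μs : ι → Measure (E 4)} {ν : Measure (E 4)}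
    (hl : ∀ i, IsLocallyFiniteMeasure (μs i)) (hl' : IsLocallyFiniteMeasure ν) (h : VT U μs ν)
    {r : ℝ} (hr : 0 < r) : Tendsto (fun i => _root_.Aop (μs i) r) U (𝓝 (_root_.Aop ν r)) :=
  op_tendsto fun x y => h.A hr x y

lemma VT.bt {ι : Type*} {U : Filter ι} {μs : ι → Measure (E 4)} {ν : Measure (E 4)}
    (hl : ∀ i, IsLocallyFiniteMeasure (μs i)) (hl' : IsLocallyFiniteMeasure ν) (h : VT U μs ν)
    {r : ℝ} (hr : 0 < r) : Tendsto (fun i => _root_.bt (μs i) r) U (𝓝 (_root_.bt ν r)) :=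
  vec_tendsto fun x => h.b hr x

/-- `F = I - A` -/
def Fop (μ : Measure (E 4)) (r : ℝ) : E4L := ContinuousLinearMap.id ℝ (E 4) - Aop μ r

lemma Fop_inner (μ : Measure (E 4)) (r : ℝ) (x y : E 4) : ⟪Fop μ r x, y⟫ = ⟪x, y⟫ - ⟪Aop μ r x, y⟫ := by
  simp [Fop, inner_sub_left]

lemma Fop_symm {μ : Measure (E 4)} (h : IsLocallyFiniteMeasure μ) {r : ℝ} (hr : 0 < r) : SymL (Fop μ r) := fun x y => by
  rw [Fop_inner, Fop_inner, A_symm hr, real_inner_comm x y, real_inner_comm x (Aop μ r y)]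

lemma Unif.BE {ν : Measure (E 4)} (h : Unif ν) {x : E 4} (hx : x ∈ msupp ν) (R : ℝ) : BE ν x 0 R := fun s hs _ => by
  rw [h.2 x hx s hs, sub_self, abs_zero, zero_mul]

lemma sum_id (e : OB4) : ∑ i, ⟪e i, e i⟫ = (4 : ℝ) := by
  simp

lemma Unif.trace {ν : Measure (E 4)} (h : Unif ν) (h0 : 0 ∈ msupp ν) {r : ℝ} (hr : 0 < r) (e : OB4) :
    ∑ i, ⟪Fop ν r (e i), e i⟫ = 1 := by
  have := h.1
  have h1 := A_trace le_rfl hr (h.BE h0 r) e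
  rw [mul_zero, abs_nonpos_iff] at h1
  simp only [Fop_inner, Finset.sum_sub_distrib, sum_id]
  linarith

lemma Unif.ME {ν : Measure (E 4)} (h : Unif ν) (h0 : 0 ∈ msupp ν) {r : ℝ} (hr : 0 < r) {x : E 4} (hx : x ∈ msupp ν)
    (hxr : ‖x‖ ≤ r) : |2 * ⟪x, _root_.bt ν r⟫ - ⟪Fop ν r x, x⟫| ≤ KE * (‖x‖ ^ 3 / r) := by
  have := h.1
  have h1 := _root_.ME le_rfl zero_le_one hr (h.BE h0 _) (h.BE hx _) hxr
  rw [Fop_inner, real_inner_self_eq_norm_sq]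
  simpa [sub_sub_eq_add_sub] using h1

lemma spans_span {ν : Measure (E 4)} (h : Spans ν) : Submodule.span ℝ (msupp ν) = ⊤ := by
  rw [← Submodule.orthogonal_eq_bot_iff, Submodule.eq_bot_iff]
  intro n hn
  by_contra hne
  obtain ⟨x, hx, hx0⟩ := h n hne
  exact hx0 ((Submodule.mem_orthogonal' _ _).1 hn x (Submodule.subset_span hx))

/-- blow-downs -/
lemma BD {ι : Type*} {ν : Measure (E 4)} (hν : Unif ν) (h0 : 0 ∈ msupp ν) (hsp : Spans ν) (U : Ultrafilter ι)
    {R : ι → ℝ} (hR0 : ∀ i, 0 < R i) (hR : Tendsto R U atTop) :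
    ∃ (ν' : Measure (E 4)) (b : E 4), Unif ν' ∧ 0 ∈ msupp ν' ∧
      Tendsto (fun i => Aop ν (R i)) U (𝓝 (Aop ν' 1)) ∧ 
      (∀ y, y ∈ msupp ν' ↔ ∀ s : ℝ, 0 < s → ∀ᶠ i in (U : Filter ι), ∃ z ∈ msupp (blow ν 0 (R i)), dist z y < s) ∧
      (∀ x ∈ msupp ν, 2 * ⟪x, b⟫ = ⟪Fop ν' 1 x, x⟫) ∧ (∀ x ∈ msupp ν', ⟪Fop ν' 1 x, x⟫ = 0) := by
  have hlf := hν.1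
  obtain ⟨ν', hV, hν', hS⟩ := BU U (fun i => blow ν 0 (R i)) (AU.of_unif fun i => hν.blow 0 (hR0 i))
  have hA : Tendsto (fun i => Aop ν (R i)) U (𝓝 (Aop ν' 1)) := by
    have := VT.Aop (fun i => blow_lf ν 0 (hR0 i)) hν'.1 hV one_pos
    refine this.congr fun i => ?_
    rw [A_scale one_pos (hR0 i), mul_one]
  have h00 : 0 ∈ msupp ν' := (hS 0).2 fun s hs => .of_forall fun i =>
    ⟨0, (blow_msupp ν 0 (hR0 i) 0).2 (by simpa using h0), by simpa using hs⟩
  have hlim : ∀ x ∈ msupp ν, Tendsto (fun i => ⟪x, bt ν (R i)⟫) U (𝓝 (⟪Fop ν' 1 x, x⟫ / 2)) := by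
    intro x hx
    have hF : Tendsto (fun i => ⟪Fop ν (R i) x, x⟫) U (𝓝 ⟪Fop ν' 1 x, x⟫) := by
      simp_rw [Fop_inner]
      exact tendsto_const_nhds.sub ((clm_tendsto hA tendsto_const_nhds).inner tendsto_const_nhds)
    have hE : Tendsto (fun i => 2 * ⟪x, bt ν (R i)⟫ - ⟪Fop ν (R i) x, x⟫) U (𝓝 0) := by
      refine squeeze_zero_norm' (a := fun i => KE * (‖x‖ ^ 3 / R i)) ?_ ?_
      · filter_upwards [hR.eventually_ge_atTop ‖x‖] with i hi
        exact hν.ME h0 (hR0 i) hx hi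
      · have := (tendsto_const_nhds (x := ‖x‖ ^ 3)).div_atTop hR |>.const_mul KE
        simpa using this
    have := (hE.add hF).div_const 2
    rw [zero_add] at this
    exact this.congr fun i => by ring
  have hall : ∀ x, ∃ c, Tendsto (fun i => ⟪x, bt ν (R i)⟫) U (𝓝 c) := by
    intro x
    have hx : x ∈ Submodule.span ℝ (msupp ν) := by rw [spans_span hsp]; trivial
    induction hx using Submodule.span_induction with
    | mem x hx => exact ⟨_, hlim x hx⟩
    | zero => exact ⟨0, by simp⟩
    | add x y _ _ hx hy =>
      obtain ⟨c, hc⟩ := hx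
      obtain ⟨d, hd⟩ := hy
      exact ⟨c + d, by simpa [inner_add_left] using hc.add hd⟩
    | smul a x _ hx =>
      obtain ⟨c, hc⟩ := hx
      exact ⟨a * c, by simpa [inner_smul_left] using hc.const_mul a⟩
  choose c hc using hall
  set b : E 4 := ∑ j, c (ob4 j) • ob4 j with hb
  have hb0 : Tendsto (fun i => bt ν (R i)) U (𝓝 b) := by
    exact (tendsto_finsetSum _ fun j _ => (hc (ob4 j)).smul_const _).congr fun i => ob4.sum_repr' (bt ν (R i))
  have hbx : ∀ x ∈ msupp ν, 2 * ⟪x, b⟫ = ⟪Fop ν' 1 x, x⟫ := by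
    intro x hx
    have := tendsto_nhds_unique ((tendsto_const_nhds (x := x)).inner hb0) (hlim x hx)
    linarith
  refine ⟨ν', b, hν', h00, hA, hS, hbx, fun y hy => ?_⟩
  obtain ⟨z, hz, hzS⟩ := lim_pt ((hS y).1 hy)
  have h1 : Tendsto (fun i => ⟪Fop ν' 1 (z i), z i⟫) U (𝓝 ⟪Fop ν' 1 y, y⟫) := opq_tendsto tendsto_const_nhds hz
  have h2 : Tendsto (fun i => 2 * ⟪z i, b⟫ / R i) U (𝓝 0) :=
    ((hz.inner tendsto_const_nhds).const_mul 2).div_atTop hR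
  refine tendsto_nhds_unique h1 (h2.congr' ?_)
  filter_upwards [hzS] with i hi
  have h3 := hbx _ ((blow_msupp ν 0 (hR0 i) _).1 hi)
  rw [zero_add, map_smul, inner_smul_left, inner_smul_left, inner_smul_right] at h3
  have := hR0 i
  simp at h3
  field_simp
  have h4 : R i * (2 * ⟪z i, b⟫) = R i * (R i * ⟪Fop ν' 1 (z i), z i⟫) := by linarith
  linarith [mul_left_cancel₀ this.ne' h4]

/-- dichotomy -/
lemma DI {ν : Measure (E 4)} (hν : Unif ν) (h0 : 0 ∈ msupp ν) (hF : ∀ x ∈ msupp ν, ⟪Fop ν 1 x, x⟫ = 0) :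
    (∃ u : E 4, ‖u‖ = 1 ∧ Fop ν 1 = kpL u ∧ ∀ x, x ∈ msupp ν ↔ ⟪kpL u x, x⟫ = 0) ∨
    ∃ n : E 4, ‖n‖ = 1 ∧ (∀ x, x ∈ msupp ν ↔ ⟪n, x⟫ = 0) ∧ ∀ x, ⟪Fop ν 1 x, x⟫ = ⟪n, x⟫ ^ 2 := by
  have := hν.1
  by_cases hsp : Spans ν
  · exact Or.inl (LK hν h0 hsp (Fop_symm hν.1 one_pos) (hν.trace h0 one_pos) hF)
  · right
    simp only [Spans, not_forall, not_exists, not_and, not_not] at hsp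
    obtain ⟨n', hn', hp⟩ := hsp
    obtain ⟨n, hn, hp⟩ : ∃ n : E 4, ‖n‖ = 1 ∧ ∀ x ∈ msupp ν, ⟪n, x⟫ = 0 :=
      ⟨‖n'‖⁻¹ • n', nsi hn', fun x hx => by rw [inner_smul_left, hp x hx, mul_zero]⟩
    have hn0 : n ≠ 0 := by rintro rfl; simp at hn
    have hiff : ∀ x, x ∈ msupp ν ↔ ⟪n, x⟫ = 0 := fun x => ⟨hp x, FL hν hn0 ⟨0, h0⟩ hp x⟩
    have hAn : ∀ y, ⟪Aop ν 1 n, y⟫ = 0 := by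
      intro y
      rw [inner_A one_pos, integral_eq_zero_of_ae, mul_zero]
      filter_upwards [msupp_ae ν] with w hw
      simp [hp w hw]
    refine ⟨n, hn, hiff, fun x => ?_⟩
    have hnn : ⟪n, n⟫ = 1 := by rw [real_inner_self_eq_norm_sq, hn]; norm_num
    have h1 := hF (x - ⟪n, x⟫ • n) ((hiff _).2 (by rw [inner_sub_right, inner_smul_right, hnn]; ring))
    have h2 : ∀ y, ⟪Fop ν 1 n, y⟫ = ⟪n, y⟫ := fun y => by rw [Fop_inner, hAn, sub_zero]
    rw [map_sub, map_smul, inner_sub_left, inner_sub_right, inner_sub_right, inner_smul_right, inner_smul_left,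
      inner_smul_left, inner_smul_right, Fop_symm hν.1 one_pos x n, h2, h2, hnn] at h1
    simp at h1
    linarith [h1, sq ⟪n, x⟫]

lemma ultra_unit {ι : Type*} (U : Ultrafilter ι) {z : ι → E 4} (h : ∀ᶠ i in (U : Filter ι), ‖z i‖ = 1) :
    ∃ z0, ‖z0‖ = 1 ∧ Tendsto z U (𝓝 z0) := by
  obtain ⟨z0, hz0⟩ := ultra_lim U z (R := 1) (h.mono fun i hi => hi.le)
  exact ⟨z0, tendsto_nhds_unique hz0.norm (tendsto_const_nhds.congr' (h.mono fun i hi => hi.symm)), hz0⟩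

lemma spans_of_A {ν : Measure (E 4)} [IsLocallyFiniteMeasure ν] {δ r : ℝ} (hr : 0 < r) (hδ : 0 < δ)
    (h1 : ∀ z, ‖z‖ = 1 → δ ≤ ⟪Aop ν r z, z⟫) : Spans ν := by
  intro n hn
  by_contra! h
  have h2 := h1 (‖n‖⁻¹ • n) (nsi hn)
  rw [inner_A hr, integral_eq_zero_of_ae, mul_zero] at h2
  · linarith
  · filter_upwards [msupp_ae ν] with w hw
    simp [inner_smul_left, h w hw]

/-- flat blow-down is impossible -/
lemma no_flat {ι : Type*} {ν : Measure (E 4)} (hν : Unif ν) (h0 : 0 ∈ msupp ν) (hsp : Spans ν) (U : Ultrafilter ι)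
    {R : ι → ℝ} (hR0 : ∀ i, 0 < R i) {n b : E 4} (hn : ‖n‖ = 1)
    (hS : ∀ y, ⟪n, y⟫ = 0 → ∀ s : ℝ, 0 < s → ∀ᶠ i in (U : Filter ι), ∃ z ∈ msupp (blow ν 0 (R i)), dist z y < s)
    (hb : ∀ x ∈ msupp ν, 2 * ⟪x, b⟫ = ⟪n, x⟫ ^ 2) : False := by
  have := hν.1
  have hw := omega3_pos
  have hn0 : n ≠ 0 := by rintro rfl; simp at hn
  have hge : ∀ y, ⟪n, y⟫ = 0 → 0 ≤ ⟪y, b⟫ := by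
    intro y hy
    obtain ⟨z, hz, hzS⟩ := lim_pt (hS y hy)
    refine ge_of_tendsto (hz.inner tendsto_const_nhds) ?_
    filter_upwards [hzS] with i hi
    have h3 := hb _ ((blow_msupp ν 0 (hR0 i) _).1 hi)
    rw [zero_add, inner_smul_left] at h3
    simp at h3
    have h4 : 0 ≤ R i * ⟪z i, b⟫ := by nlinarith [sq_nonneg ⟪n, R i • z i⟫]
    exact nonneg_of_mul_nonneg_right h4 (hR0 i)
  have hnn : ⟪n, n⟫ = 1 := by rw [real_inner_self_eq_norm_sq, hn]; norm_num
  set γ := ⟪n, b⟫ with hγ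
  have hbx : ∀ x, ⟪x, b⟫ = γ * ⟪n, x⟫ := by
    intro x
    have hz : ⟪n, x - ⟪n, x⟫ • n⟫ = 0 := by rw [inner_sub_right, inner_smul_right, hnn]; ring
    have h1 := hge _ hz
    have h2 := hge (-(x - ⟪n, x⟫ • n)) (by rw [inner_neg_right, hz, neg_zero])
    rw [inner_neg_left] at h2
    have h3 : ⟪x - ⟪n, x⟫ • n, b⟫ = 0 := by linarith
    rw [inner_sub_left, inner_smul_left] at h3
    simp at h3; linarith
  have hx2 : ∀ x ∈ msupp ν, ⟪n, x⟫ = 0 ∨ ⟪n, x⟫ = 2 * γ := by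
    intro x hx
    have := hb x hx
    rw [hbx] at this
    by_cases h : ⟪n, x⟫ = 0
    · exact Or.inl h
    · right; refine mul_left_cancel₀ h ?_; linarith
  obtain ⟨x, hx, hxn⟩ := hsp n hn0
  have hγ0 : 0 < |γ| := by
    rw [abs_pos]; intro h
    rcases hx2 x hx with h' | h'
    · exact hxn h'
    · rw [h, mul_zero] at h'; exact hxn h'
  have hsm : ∀ x w : E 4, ⟪n, w - x⟫ = 2 * γ ∨ ⟪n, w - x⟫ = -(2 * γ) → 2 * |γ| ≤ dist w x := by
    intro x w h
    have h1 := abs_real_inner_le_norm n (w - x)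
    rw [hn, one_mul, ← dist_eq_norm] at h1
    refine le_trans (le_of_eq ?_) h1
    rcases h with h | h <;> rw [h] <;> simp [abs_mul]
  have h1 := (FLloc (ν := ν) hn0 hγ0 ⟨0, h0, inner_zero_right _⟩ (fun x hx hxn s hs hsγ => by
    rw [measure_inter_msupp (B := {w | ⟪n, w⟫ = 0}) (fun w hw hws => ?_), hν.ball hx hs]
    rcases hx2 w hws with h | h
    · exact h
    · have := hsm x w (Or.inl (by rw [inner_sub_right, h, hxn, sub_zero]))
      rw [mem_closedBall] at hw
      linarith)).2 0 (inner_zero_right _) (‖x‖ + |γ|) (by positivity)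
  have h2 := hν.ball h0 (s := ‖x‖ + |γ|) (by positivity)
  have hxg : ⟪n, x⟫ = 2 * γ := (hx2 x hx).resolve_left hxn
  have hdisj : Disjoint (closedBall (0 : E 4) (‖x‖ + |γ|) ∩ {w | ⟪n, w⟫ = 0}) (closedBall x |γ|) := by
    rw [Set.disjoint_left]
    rintro w ⟨_, hw⟩ hwx
    have := hsm x w (Or.inr (by rw [inner_sub_right, hxg, show ⟪n, w⟫ = 0 from hw]; ring))
    rw [mem_closedBall] at hwx; linarith
  have h3 : ν (closedBall (0 : E 4) (‖x‖ + |γ|) ∩ {w | ⟪n, w⟫ = 0}) + ν (closedBall x |γ|) ≤ ν (closedBall 0 (‖x‖ + |γ|)) := by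
    rw [← measure_union hdisj measurableSet_closedBall]
    refine measure_mono (union_subset inter_subset_left (closedBall_subset_closedBall' ?_))
    rw [dist_zero_right, add_comm]
  rw [h1, h2] at h3
  have h4 := hx |γ| hγ0
  exact absurd h3 (not_le.2 (ENNReal.lt_add_right ENNReal.ofReal_ne_top h4.ne'))

lemma kp_A_ge {ν : Measure (E 4)} {r : ℝ} {u : E 4} (h : Fop ν r = kpL u) (z : E 4) :
    ⟪Aop ν r z, z⟫ = 1 / 2 * ‖z‖ ^ 2 + ⟪u, z⟫ ^ 2 := by
  have h1 := Fop_inner ν r z z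
  rw [h, kpL_self, real_inner_self_eq_norm_sq] at h1
  linarith

lemma GapNu {ν : Measure (E 4)} (hν : Unif ν) (h0 : 0 ∈ msupp ν) {δ : ℝ} (hδ : 0 < δ) (hδ2 : δ < 1 / 2)
    (h1 : ∀ z, ‖z‖ = 1 → δ ≤ ⟪Aop ν 1 z, z⟫)
    (h2 : ∀ j : ℕ, ∃ z, ‖z‖ = 1 ∧ ⟪Aop ν (2 ^ (j + 1)) z, z⟫ ≤ δ) : False := by
  have := hν.1
  have hsp := spans_of_A one_pos hδ h1
  have hat : Tendsto (fun j : ℕ => (2:ℝ) ^ (j + 1)) (hyperfilter ℕ : Filter ℕ) atTop :=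
    ((tendsto_pow_atTop_atTop_of_one_lt one_lt_two).comp (tendsto_add_atTop_nat 1)).mono_left Nat.hyperfilter_le_atTop
  obtain ⟨ν', b, hν', h00, hA, hS, hb, hF⟩ := BD hν h0 hsp (hyperfilter ℕ) (R := fun j => 2 ^ (j + 1))
    (fun j => by positivity) hat
  choose z hz1 hz2 using h2
  obtain ⟨z0, hz0, hzl⟩ := ultra_unit (hyperfilter ℕ) (.of_forall hz1)
  have hle : ⟪Aop ν' 1 z0, z0⟫ ≤ δ := le_of_tendsto (opq_tendsto hA hzl) (.of_forall hz2)
  rcases DI hν' h00 hF with ⟨u, hu, hFu, -⟩ | ⟨n, hn, hiff, hFn⟩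
  · rw [kp_A_ge hFu, hz0] at hle
    nlinarith [sq_nonneg ⟪u, z0⟫]
  · exact no_flat hν h0 hsp (hyperfilter ℕ) (R := fun j => 2 ^ (j + 1)) (fun j => by positivity) hn (fun y hy => (hS y).1 ((hiff y).2 hy))
      (fun x hx => by rw [hb x hx, hFn])

lemma BUP {ι : Type*} {μ : Measure (E 4)} {C α : ℝ} (H : HReg μ C α) (U : Ultrafilter ι) {t : ι → ℝ}
    (ht : ∀ i, 0 < t i) (ht0 : Tendsto t U (𝓝 0)) : ∃ ν, Unif ν ∧ 0 ∈ msupp ν ∧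
      (∀ r, 0 < r → Tendsto (fun i => Aop μ (t i * r)) U (𝓝 (Aop ν r))) ∧
      (∀ r, 0 < r → Tendsto (fun i => (t i)⁻¹ • bt μ (t i * r)) U (𝓝 (bt ν r))) ∧
      ∀ y, y ∈ msupp ν ↔ ∀ s : ℝ, 0 < s → ∀ᶠ i in (U : Filter ι), ∃ z ∈ msupp (blow μ 0 (t i)), dist z y < s := by
  have := H.1
  obtain ⟨ν, hV, hν, hS⟩ := BU U _ (AU.of_reg H (p := fun _ => 0) ht tendsto_const_nhds ht0)
  refine ⟨ν, hν, ?_, fun r hr => ?_, fun r hr => ?_, hS⟩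
  · exact (hS 0).2 fun s hs => .of_forall fun i =>
      ⟨0, (blow_msupp μ 0 (ht i) 0).2 (by simpa using H.2.1), by simpa using hs⟩
  · exact (VT.Aop (fun i => blow_lf μ 0 (ht i)) hν.1 hV hr).congr fun i => A_scale hr (ht i)
  · exact (VT.bt (fun i => blow_lf μ 0 (ht i)) hν.1 hV hr).congr fun i => bt_scale hr (ht i)

lemma ev_choose {ι : Type*} {U : Filter ι} {P : ι → E 4 → Prop} (h : ∀ᶠ i in U, ∃ z, P i z) :
    ∃ z : ι → E 4, ∀ᶠ i in U, P i (z i) := by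
  classical
  refine ⟨fun i => if h : ∃ z, P i z then h.choose else 0, ?_⟩
  filter_upwards [h] with i hi
  rw [dif_pos hi]; exact hi.choose_spec

lemma Pclosed {ι : Type*} {U : Ultrafilter ι} {A : ι → E4L} {A0 : E4L} {δ : ℝ} (hA : Tendsto A U (𝓝 A0))
    (h : ∀ᶠ i in (U : Filter ι), ∃ z, ‖z‖ = 1 ∧ ⟪A i z, z⟫ ≤ δ) : ∃ z, ‖z‖ = 1 ∧ ⟪A0 z, z⟫ ≤ δ := by
  obtain ⟨z, hz⟩ := ev_choose h
  obtain ⟨z0, hz0, hl⟩ := ultra_unit U (hz.mono fun i hi => hi.1)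
  exact ⟨z0, hz0, le_of_tendsto (opq_tendsto hA hl) (hz.mono fun i hi => hi.2)⟩

def PA (μ : Measure (E 4)) (δ r : ℝ) : Prop := ∃ z, ‖z‖ = 1 ∧ ⟪Aop μ r z, z⟫ < δ

lemma PA.mono {μ : Measure (E 4)} [IsLocallyFiniteMeasure μ] {δ δ' r s : ℝ} (h : PA μ δ s) (hr : 0 < r) (hs : r ≤ s) {J : ℕ}
    (hJ : s ≤ 2 ^ J * r) (hδ : 2 ^ (7 * J) * δ ≤ δ') : PA μ δ' r := by
  obtain ⟨z, hz, hz2⟩ := h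
  have hs0 : 0 < s := hr.trans_le hs
  refine ⟨z, hz, lt_of_lt_of_le ?_ hδ⟩
  have h1 := A_mono (μ := μ) hs0 (τ := r / s) (by positivity) ((div_le_one hs0).2 hs) z
  rw [div_mul_cancel₀ _ hs0.ne'] at h1
  have h2 : ((r / s) ^ 7)⁻¹ ≤ 2 ^ (7 * J) := by
    rw [← inv_pow, inv_div, mul_comm 7 J, pow_mul]
    exact pow_le_pow_left₀ (by positivity) ((div_le_iff₀ hr).2 hJ) 7
  have h3 := A_nonneg (μ := μ) hs0 z
  calc ⟪Aop μ r z, z⟫ ≤ _ := h1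
    _ ≤ 2 ^ (7 * J) * ⟪Aop μ s z, z⟫ := by gcongr
    _ < 2 ^ (7 * J) * δ := by gcongr

lemma Gap_step {μ : Measure (E 4)} [IsLocallyFiniteMeasure μ] {δ : ℝ}
    (ha : ∀ s, 0 < s → ∃ r, 0 < r ∧ r < s ∧ ¬ PA μ δ r) (hδ : 0 < δ)
    (hb : ∀ c, 0 < c → ∀ s, 0 < s → ∃ r, 0 < r ∧ r ≤ s ∧ PA μ c r) (J : ℕ) :
    ∃ t, 0 < t ∧ t ≤ 1 / ((J : ℝ) + 1) ∧ ¬ PA μ δ t ∧ ∀ j : ℕ, j < J → PA μ δ (t * 2 ^ (j + 1)) := by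
  classical
  obtain ⟨s, hs0, hs1, hs⟩ := hb (δ / 2 ^ (7 * (J + 1))) (by positivity) (1 / ((J : ℝ) + 1)) (by positivity)
  obtain ⟨r, hr0, hrs, hr⟩ := ha s hs0
  obtain ⟨K, hK1, hK2⟩ := exists_nat_pow_near (x := s / r) ((one_le_div hr0).2 hrs.le) one_lt_two
  rw [le_div_iff₀ hr0] at hK1
  rw [div_lt_iff₀ hr0] at hK2
  set k := Nat.findGreatest (fun k => ¬ PA μ δ (2 ^ k * r)) K with hk
  have hkP : ¬ PA μ δ (2 ^ k * r) :=
    Nat.findGreatest_spec (P := fun k => ¬ PA μ δ (2 ^ k * r)) (Nat.zero_le K) (by simpa using hr)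
  have hkK : k ≤ K := Nat.findGreatest_le K
  have hgt : ∀ j, k < j → j ≤ K → PA μ δ (2 ^ j * r) := fun j hj hjK => by
    have := Nat.findGreatest_is_greatest (P := fun k => ¬ PA μ δ (2 ^ k * r)) hj hjK
    simpa using this
  have hts : 2 ^ k * r ≤ s := le_trans (by gcongr; norm_num) hK1
  have hJK : J + k ≤ K := by
    by_contra hlt
    push Not at hlt
    refine hkP (hs.mono (J := J + 1) (by positivity) hts ?_ (by field_simp; exact le_rfl))
    calc s ≤ 2 ^ (K + 1) * r := hK2.le
      _ ≤ 2 ^ (J + 1 + k) * r := mul_le_mul_of_nonneg_right (pow_le_pow_right₀ one_le_two (by omega)) hr0.le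
      _ = 2 ^ (J + 1) * (2 ^ k * r) := by ring
  refine ⟨2 ^ k * r, by positivity, hts.trans hs1, hkP, fun j hj => ?_⟩
  have := hgt (k + (j + 1)) (by omega) (by omega)
  rwa [pow_add, mul_right_comm] at this

theorem Gap {μ : Measure (E 4)} {C α : ℝ} (H : HReg μ C α) :
    (∀ δ, 0 < δ → ∃ s, 0 < s ∧ ∀ r, 0 < r → r < s → PA μ δ r) ∨
    ∃ c, 0 < c ∧ ∃ s, 0 < s ∧ ∀ r, 0 < r → r ≤ s → ¬ PA μ c r := by
  have := H.1
  by_contra hcon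
  push Not at hcon
  obtain ⟨⟨δ, hδ, ha⟩, hb⟩ := hcon
  set δ' := min δ (1 / 4) with hδ'
  have hδ0 : 0 < δ' := lt_min hδ (by norm_num)
  have ha' : ∀ s, 0 < s → ∃ r, 0 < r ∧ r < s ∧ ¬ PA μ δ' r := by
    intro s hs
    obtain ⟨r, hr, hrs, hP⟩ := ha s hs
    refine ⟨r, hr, hrs, fun ⟨z, hz, hz2⟩ => hP ⟨z, hz, hz2.trans_le (min_le_left _ _)⟩⟩
  choose t ht0 ht1 htP htj using Gap_step ha' hδ0 hb
  have htl : Tendsto t (hyperfilter ℕ : Filter ℕ) (𝓝 0) :=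
    (squeeze_zero (fun J => (ht0 J).le) ht1 tendsto_one_div_add_atTop_nhds_zero_nat).mono_left Nat.hyperfilter_le_atTop
  obtain ⟨ν, hν, h0, hA, -, -⟩ := BUP H (hyperfilter ℕ) ht0 htl
  refine GapNu hν h0 hδ0 ((min_le_right _ _).trans_lt (by norm_num)) (fun z hz => ?_) (fun j => ?_)
  · refine ge_of_tendsto (opq_tendsto (hA 1 one_pos) (tendsto_const_nhds (x := z))) (.of_forall fun J => ?_)
    have := htP J
    rw [mul_one]
    by_contra hlt
    exact this ⟨z, hz, not_le.1 hlt⟩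
  · refine Pclosed (hA (2 ^ (j + 1)) (by positivity)) ?_
    have : ∀ᶠ J in (hyperfilter ℕ : Filter ℕ), j < J := Nat.hyperfilter_le_atTop (eventually_gt_atTop j)
    filter_upwards [this] with J hJ
    obtain ⟨z, hz, hz2⟩ := htj J j hJ
    exact ⟨z, hz, hz2.le⟩

/-- convergence of supports, one side -/
lemma H1 {ι : Type*} {U : Ultrafilter ι} {μs : ι → Measure (E 4)} {W : Set (E 4)}
    (hS : ∀ y, y ∈ W ↔ ∀ s : ℝ, 0 < s → ∀ᶠ i in (U : Filter ι), ∃ z ∈ msupp (μs i), dist z y < s) {η : ℝ} (hη : 0 < η) :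
    ∀ᶠ i in (U : Filter ι), ∀ y ∈ msupp (μs i), ‖y‖ ≤ 1 → ∃ w ∈ W, ‖w‖ ≤ 1 ∧ dist y w ≤ η := by
  by_contra hcon
  rw [← Ultrafilter.eventually_not] at hcon
  obtain ⟨y, hy⟩ := ev_choose (P := fun i y => y ∈ msupp (μs i) ∧ ‖y‖ ≤ 1 ∧ ∀ w ∈ W, ‖w‖ ≤ 1 → η < dist y w)
    (hcon.mono fun i hi => by push Not at hi; exact hi)
  obtain ⟨y0, hy0⟩ := ultra_lim U y (R := 1) (hy.mono fun i hi => hi.2.1)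
  have hW : y0 ∈ W := (hS y0).2 fun s hs => by
    filter_upwards [hy, Metric.tendsto_nhds.1 hy0 s hs] with i hi hd
    exact ⟨_, hi.1, hd⟩
  have hn : ‖y0‖ ≤ 1 := le_of_tendsto hy0.norm (hy.mono fun i hi => hi.2.1)
  obtain ⟨i, hi, hd⟩ := (hy.and (Metric.tendsto_nhds.1 hy0 η hη)).exists
  exact absurd (hi.2.2 y0 hW hn) (not_lt.2 hd.le)

lemma H2 {ι : Type*} {U : Ultrafilter ι} {μs : ι → Measure (E 4)} {W : Set (E 4)} (hWc : IsClosed W)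
    (hray : ∀ x ∈ W, ∀ t : ℝ, 0 < t → t • x ∈ W)
    (hS : ∀ y, y ∈ W ↔ ∀ s : ℝ, 0 < s → ∀ᶠ i in (U : Filter ι), ∃ z ∈ msupp (μs i), dist z y < s) {η : ℝ} (hη : 0 < η) :
    ∀ᶠ i in (U : Filter ι), ∀ w ∈ W, ‖w‖ ≤ 1 → ∃ y ∈ msupp (μs i), ‖y‖ ≤ 1 ∧ dist w y ≤ η := by
  wlog hη1 : η ≤ 1 generalizing η
  · filter_upwards [this one_pos le_rfl] with i hi w hw hw1
    obtain ⟨y, hy, hy1, hd⟩ := hi w hw hw1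
    exact ⟨y, hy, hy1, hd.trans (not_le.1 hη1).le⟩
  by_contra hcon
  rw [← Ultrafilter.eventually_not] at hcon
  obtain ⟨w, hw⟩ := ev_choose (P := fun i w => w ∈ W ∧ ‖w‖ ≤ 1 ∧ ∀ y ∈ msupp (μs i), ‖y‖ ≤ 1 → η < dist w y)
    (hcon.mono fun i hi => by push Not at hi; exact hi)
  obtain ⟨w0, hw0⟩ := ultra_lim U w (R := 1) (hw.mono fun i hi => hi.2.1)
  have hW : w0 ∈ W := hWc.mem_of_tendsto hw0 (hw.mono fun i hi => hi.1)
  have hn : ‖w0‖ ≤ 1 := le_of_tendsto hw0.norm (hw.mono fun i hi => hi.2.1)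
  have hW2 := hray w0 hW (1 - η / 4) (by linarith)
  obtain ⟨i, ⟨hi, hd⟩, z, hz, hzd⟩ := ((hw.and (Metric.tendsto_nhds.1 hw0 (η / 4) (by linarith))).and
    ((hS _).1 hW2 (η / 4) (by linarith))).exists
  have h1 : ‖(1 - η / 4) • w0‖ ≤ 1 - η / 4 := by
    rw [norm_smul, Real.norm_of_nonneg (by linarith)]; nlinarith
  have h2 : dist w0 ((1 - η / 4) • w0) ≤ η / 4 := by
    rw [dist_eq_norm, show w0 - (1 - η / 4) • w0 = (η / 4) • w0 by module, norm_smul, Real.norm_of_nonneg (by linarith)]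
    nlinarith
  have h3 : ‖z‖ ≤ 1 := by
    have := norm_le_norm_add_norm_sub' z ((1 - η / 4) • w0)
    rw [← dist_eq_norm] at this
    linarith
  have h4 := hi.2.2 z hz h3
  have h5 := dist_triangle4 (w i) w0 ((1 - η / 4) • w0) z
  rw [dist_comm ((1 - η / 4) • w0) z] at h5
  linarith

lemma dxr_le {r η : ℝ} (hr : 0 < r) (hη : 0 ≤ η) {A B : Set (E 4)}
    (h : ∀ a ∈ A, ‖a‖ ≤ r → ∃ b ∈ B, ‖b‖ ≤ r ∧ dist a b ≤ η * r) : dxr 0 r A B ≤ η := by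
  rw [dxr, one_div, inv_mul_le_iff₀ hr, mul_comm]
  refine Real.iSup_le (fun a => Real.iSup_le (fun ha => ?_) (by positivity)) (by positivity)
  obtain ⟨b, hb, hb1, hd⟩ := h a ha.1 (by simpa using ha.2)
  have hb2 : b ∈ B ∩ closedBall (0 : E 4) r := ⟨hb, by simpa using hb1⟩
  exact (infDist_le_dist_of_mem hb2).trans hd

lemma Dxr_nonneg {n : ℕ} (x : E n) {r : ℝ} (hr : 0 < r) (A B : Set (E n)) : 0 ≤ Dxr x r A B := by
  refine le_trans ?_ (le_max_left _ _)
  exact mul_nonneg (by positivity) (Real.iSup_nonneg fun a => Real.iSup_nonneg fun _ => infDist_nonneg)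

lemma seq_of {P : ℝ → Prop} (h : ¬ ∃ s, 0 < s ∧ ∀ r, 0 < r → r < s → P r) :
    ∃ t : ℕ → ℝ, (∀ n, 0 < t n) ∧ Tendsto t (hyperfilter ℕ : Filter ℕ) (𝓝 0) ∧ ∀ n, ¬ P (t n) := by
  push Not at h
  choose t ht0 ht1 htP using fun n : ℕ => h (1 / ((n : ℝ) + 1)) (by positivity)
  exact ⟨t, ht0, (squeeze_zero (fun J => (ht0 J).le) (fun n => (ht1 n).le)
    tendsto_one_div_add_atTop_nhds_zero_nat).mono_left Nat.hyperfilter_le_atTop, htP⟩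

lemma A_zero_supp {ν : Measure (E 4)} [IsLocallyFiniteMeasure ν] {r : ℝ} (hr : 0 < r) {z : E 4} (hz : ⟪Aop ν r z, z⟫ ≤ 0)
    {w : E 4} (hw : w ∈ msupp ν) (hwr : ‖w‖ < r) : ⟪z, w⟫ = 0 := by
  have hc := c2_pos
  rw [inner_A hr] at hz
  have hint : Integrable (fun w => ap r ‖w‖ * (⟪z, w⟫ * ⟪z, w⟫)) ν :=
    ap_int4 hr (by have := ap_cont r; fun_prop) (by simp +contextual)
  have h0 : ∀ w, 0 ≤ ap r ‖w‖ * (⟪z, w⟫ * ⟪z, w⟫) := fun w => mul_nonneg (ap_nonneg _ _) (mul_self_nonneg _)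
  have hi0 : ∫ w, ap r ‖w‖ * (⟪z, w⟫ * ⟪z, w⟫) ∂ν = 0 := by
    refine le_antisymm ?_ (integral_nonneg h0)
    by_contra hpos
    push Not at hpos
    have : 0 < 4 * (c2 * r ^ 7)⁻¹ := by positivity
    nlinarith [mul_pos this hpos]
  have hae := (integral_eq_zero_iff_of_nonneg h0 hint).1 hi0
  by_contra hne
  have hop : IsOpen {w : E 4 | ⟪z, w⟫ ≠ 0 ∧ ‖w‖ < r} :=
    (isOpen_ne_fun (by fun_prop) continuous_const).inter (isOpen_lt continuous_norm continuous_const)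
  obtain ⟨s, hs, hsub⟩ := Metric.isOpen_iff.1 hop w ⟨hne, hwr⟩
  refine (hw (s / 2) (half_pos hs)).ne' (measure_mono_null (fun v hv => ?_) (ae_iff.1 hae))
  have hv2 := hsub (closedBall_subset_ball (half_lt_self hs) hv)
  have : 0 < ap r ‖v‖ := lt_of_lt_of_le (by nlinarith [hv2.2, norm_nonneg v]) (le_max_left (r ^ 2 - ‖v‖ ^ 2) 0)
  simp only [mem_ofPred_eq, Pi.zero_apply, mul_eq_zero, or_self, not_or]
  exact ⟨this.ne', hv2.1⟩

lemma thetaP_le {z : E 4} (hz : ‖z‖ = 1) {S : Set (E 4)} {r : ℝ} (hr : 0 < r) :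
    thetaP 3 S 0 r ≤ Dxr 0 r S {x | ⟪z, x⟫ = 0} := by
  have hz0 : z ≠ 0 := by rintro rfl; simp at hz
  set W : Submodule ℝ (E 4) := (ℝ ∙ z)ᗮ with hW
  have hWs : ({x | ⟪z, x⟫ = 0} : Set (E 4)) = (W.toAffineSubspace : Set (E 4)) := by
    ext x; simp [hW, Submodule.mem_orthogonal_singleton_iff_inner_right]
  have hf : Module.finrank ℝ W.toAffineSubspace.direction = 3 := by
    have : Fact (Module.finrank ℝ (E 4) = 3 + 1) := ⟨by simp⟩
    rw [Submodule.toAffineSubspace_direction]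
    exact Submodule.finrank_orthogonal_span_singleton hz0
  rw [hWs]
  exact ciInf_le (f := fun L : {L : AffineSubspace ℝ (E 4) // (0 : E 4) ∈ L ∧ Module.finrank ℝ L.direction = 3} =>
    Dxr 0 r S (L.1 : Set (E 4))) ⟨0, by rintro _ ⟨L, rfl⟩; exact Dxr_nonneg _ hr _ _⟩ ⟨W.toAffineSubspace, by simp, hf⟩

lemma caseA {μ : Measure (E 4)} {C α : ℝ} (H : HReg μ C α)
    (ha : ∀ δ, 0 < δ → ∃ s, 0 < s ∧ ∀ r, 0 < r → r < s → PA μ δ r) :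
    Tendsto (fun r : ℝ => thetaP 3 (msupp μ) 0 r) (nhdsWithin 0 (Set.Ioi 0)) (nhds 0) := by
  suffices h : ∀ η, 0 < η → ∃ s, 0 < s ∧ ∀ r, 0 < r → r < s → thetaP 3 (msupp μ) 0 r ≤ η by
    rw [Metric.tendsto_nhds]
    intro ε hε
    obtain ⟨s, hs, hs2⟩ := h (ε / 2) (half_pos hε)
    filter_upwards [Ioo_mem_nhdsGT hs] with r hr
    have hnn : 0 ≤ thetaP 3 (msupp μ) 0 r := Real.iInf_nonneg fun L => Dxr_nonneg _ hr.1 _ _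
    rw [Real.dist_0_eq_abs, abs_of_nonneg hnn]
    linarith [hs2 r hr.1 hr.2]
  intro η hη
  by_contra hcon
  obtain ⟨t, ht0, htl, hbad⟩ := seq_of hcon
  obtain ⟨ν, hν, h0, hA, -, hS⟩ := BUP H (hyperfilter ℕ) ht0 htl
  have hlf := hν.1
  have hδ : ∀ R, 0 < R → ∀ δ, 0 < δ → ∃ z, ‖z‖ = 1 ∧ ⟪Aop ν R z, z⟫ ≤ δ := by
    intro R hR δ hδ
    refine Pclosed (hA R hR) ?_
    obtain ⟨s, hs, hP⟩ := ha δ hδ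
    have : Tendsto (fun i => t i * R) (hyperfilter ℕ : Filter ℕ) (𝓝 0) := by simpa using htl.mul_const R
    filter_upwards [this.eventually_lt_const hs] with i hi
    obtain ⟨z, hz, hz2⟩ := hP _ (mul_pos (ht0 i) hR) hi
    exact ⟨z, hz, hz2.le⟩
  have hz : ∀ k : ℕ, ∃ z, ‖z‖ = 1 ∧ ⟪Aop ν ((k : ℝ) + 1) z, z⟫ ≤ 0 := by
    intro k
    choose z hz1 hz2 using fun n : ℕ => hδ ((k : ℝ) + 1) (by positivity) (1 / ((n : ℝ) + 1)) (by positivity)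
    obtain ⟨z0, hz0, hl⟩ := ultra_unit (hyperfilter ℕ) (.of_forall hz1)
    refine ⟨z0, hz0, le_of_tendsto_of_tendsto (opq_tendsto tendsto_const_nhds hl)
      (tendsto_one_div_add_atTop_nhds_zero_nat.mono_left Nat.hyperfilter_le_atTop) (.of_forall hz2)⟩
  choose z hz1 hz2 using hz
  obtain ⟨z0, hz0, hl⟩ := ultra_unit (hyperfilter ℕ) (.of_forall hz1)
  have hn0 : z0 ≠ 0 := by rintro rfl; simp at hz0
  have hperp : ∀ x ∈ msupp ν, ⟪z0, x⟫ = 0 := by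
    intro x hx
    refine tendsto_nhds_unique (hl.inner tendsto_const_nhds) (tendsto_const_nhds.congr' ?_)
    have h1 : ∀ᶠ k : ℕ in (hyperfilter ℕ : Filter ℕ), ‖x‖ < (k : ℝ) :=
      Nat.hyperfilter_le_atTop (tendsto_natCast_atTop_atTop.eventually_gt_atTop ‖x‖)
    filter_upwards [h1] with k hk
    exact (A_zero_supp (by positivity) (hz2 k) hx (by linarith)).symm
  have hiff : ∀ x, x ∈ msupp ν ↔ ⟪z0, x⟫ = 0 := fun x => ⟨hperp x, FL hν hn0 ⟨0, h0⟩ hperp x⟩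
  have e1 := H1 hS hη
  have e2 := H2 (msupp_closed ν) (fun x hx t _ => by
    rw [hiff] at hx ⊢; rw [inner_smul_right, hx, mul_zero]) hS hη
  obtain ⟨i, hi1, hi2⟩ := (e1.and e2).exists
  refine hbad i ((thetaP_le hz0 (ht0 i)).trans (max_le ?_ ?_))
  · refine dxr_le (ht0 i) hη.le fun a ha har => ?_
    have ht := ht0 i
    obtain ⟨w, hw, hw1, hd⟩ := hi1 ((t i)⁻¹ • a) ((blow_msupp μ 0 ht _).2 (by rwa [zero_add, smul_inv_smul₀ ht.ne'])) (by
      rw [norm_smul, norm_inv, Real.norm_of_nonneg ht.le, inv_mul_le_iff₀ ht]; linarith)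
    refine ⟨t i • w, ?_, ?_, ?_⟩
    · rw [mem_ofPred_eq, inner_smul_right, (hiff w).1 hw, mul_zero]
    · rw [norm_smul, Real.norm_of_nonneg ht.le]; nlinarith
    · have : a = t i • (t i)⁻¹ • a := by rw [smul_inv_smul₀ ht.ne']
      rw [this, dist_smul₀, Real.norm_of_nonneg ht.le]; nlinarith
  · refine dxr_le (ht0 i) hη.le fun a ha har => ?_
    have ht := ht0 i
    obtain ⟨w, hw, hw1, hd⟩ := hi2 ((t i)⁻¹ • a) ((hiff _).2 (by rw [inner_smul_right, show ⟪z0, a⟫ = 0 from ha, mul_zero])) (by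
      rw [norm_smul, norm_inv, Real.norm_of_nonneg ht.le, inv_mul_le_iff₀ ht]; linarith)
    refine ⟨t i • w, ?_, ?_, ?_⟩
    · simpa using (blow_msupp μ 0 ht _).1 hw
    · rw [norm_smul, Real.norm_of_nonneg ht.le]; nlinarith
    · have : a = t i • (t i)⁻¹ • a := by rw [smul_inv_smul₀ ht.ne']
      rw [this, dist_smul₀, Real.norm_of_nonneg ht.le]; nlinarith

lemma b_zero {ν : Measure (E 4)} (hν : Unif ν) (h0 : 0 ∈ msupp ν) {c : ℝ} (hc : 0 < c)
    (h1 : ∀ r, 0 < r → ∀ z, ‖z‖ = 1 → c ≤ ⟪Aop ν r z, z⟫) {b : E 4} {K : ℝ} (hK : 0 < K)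
    (hb : ∀ x ∈ msupp ν, |⟪b, x⟫| ≤ K * ‖x‖ ^ 2) : b = 0 := by
  have := hν.1
  by_contra hne
  have hn : 0 < ‖b‖ := norm_pos_iff.2 hne
  have hmain : ∀ r, 0 < r → c * ‖b‖ ^ 2 ≤ 3 * K ^ 2 * r ^ 2 := by
    intro r hr
    have hc2 := c2_pos
    have e1 : c * ‖b‖ ^ 2 ≤ ⟪Aop ν r b, b⟫ := by
      have := h1 r hr _ (nsi hne)
      rw [map_smul, inner_smul_left, inner_smul_right] at this
      simp only [conj_trivial] at this
      calc c * ‖b‖ ^ 2 ≤ (‖b‖⁻¹ * (‖b‖⁻¹ * ⟪Aop ν r b, b⟫)) * ‖b‖ ^ 2 := by gcongr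
        _ = _ := by field_simp
    have hint : ∀ z, Integrable (fun w => ap r ‖w‖ * (⟪z, w⟫ * ⟪z, w⟫)) ν := fun z =>
      ap_int4 hr (by have := ap_cont r; fun_prop) (by simp +contextual)
    have e2 : ∫ w, ap r ‖w‖ * (⟪b, w⟫ * ⟪b, w⟫) ∂ν ≤ K ^ 2 * r ^ 2 * ∑ i, ∫ w, ap r ‖w‖ * (⟪ob4 i, w⟫ * ⟪ob4 i, w⟫) ∂ν := by
      rw [← integral_finsetSum _ fun i _ => hint _, ← integral_const_mul]
      refine integral_mono_ae (hint b) ((integrable_finsetSum _ fun i _ => hint _).const_mul _) ?_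
      filter_upwards [msupp_ae ν] with w hw
      have h3 : ∑ i, ap r ‖w‖ * (⟪ob4 i, w⟫ * ⟪ob4 i, w⟫) = ap r ‖w‖ * ‖w‖ ^ 2 := by
        rw [← norm_coord ob4 w, Finset.mul_sum]; exact Finset.sum_congr rfl fun i _ => by ring
      simp only [h3]
      rcases le_total r ‖w‖ with h | h
      · rw [ap_zero hr.le h]; simp
      · have h4 := hb w hw
        have h5 : ⟪b, w⟫ * ⟪b, w⟫ ≤ K ^ 2 * r ^ 2 * ‖w‖ ^ 2 := by
          rw [← abs_mul_abs_self ⟪b, w⟫]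
          calc |⟪b, w⟫| * |⟪b, w⟫| ≤ (K * ‖w‖ ^ 2) * (K * ‖w‖ ^ 2) := by gcongr
            _ = K ^ 2 * ‖w‖ ^ 2 * ‖w‖ ^ 2 := by ring
            _ ≤ K ^ 2 * r ^ 2 * ‖w‖ ^ 2 := by gcongr
        calc ap r ‖w‖ * (⟪b, w⟫ * ⟪b, w⟫) ≤ ap r ‖w‖ * (K ^ 2 * r ^ 2 * ‖w‖ ^ 2) := by
              gcongr; exact ap_nonneg _ _
          _ = _ := by ring
    have e3 := A_trace le_rfl hr (hν.BE h0 r) ob4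
    rw [mul_zero, abs_nonpos_iff] at e3
    simp only [inner_A hr] at e3
    rw [← Finset.mul_sum] at e3
    rw [inner_A hr] at e1
    have hp : 0 < 4 * (c2 * r ^ 7)⁻¹ := by positivity
    calc c * ‖b‖ ^ 2 ≤ _ := e1
      _ ≤ 4 * (c2 * r ^ 7)⁻¹ * (K ^ 2 * r ^ 2 * ∑ i, ∫ w, ap r ‖w‖ * (⟪ob4 i, w⟫ * ⟪ob4 i, w⟫) ∂ν) := by gcongr
      _ = K ^ 2 * r ^ 2 * (4 * (c2 * r ^ 7)⁻¹ * ∑ i, ∫ w, ap r ‖w‖ * (⟪ob4 i, w⟫ * ⟪ob4 i, w⟫) ∂ν) := by ring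
      _ = 3 * K ^ 2 * r ^ 2 := by rw [show 4 * (c2 * r ^ 7)⁻¹ * ∑ i, ∫ w, ap r ‖w‖ * (⟪ob4 i, w⟫ * ⟪ob4 i, w⟫) ∂ν = 3 by linarith]; ring
  have hl : Tendsto (fun r : ℝ => 3 * K ^ 2 * r ^ 2) (𝓝[>] 0) (𝓝 0) := by
    have : Tendsto (fun r : ℝ => 3 * K ^ 2 * r ^ 2) (𝓝 0) (𝓝 (3 * K ^ 2 * 0 ^ 2)) :=
      (by fun_prop : Continuous fun r : ℝ => 3 * K ^ 2 * r ^ 2).tendsto 0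
    simpa using this.mono_left nhdsWithin_le_nhds
  have := ge_of_tendsto hl (by filter_upwards [self_mem_nhdsWithin] with r hr using hmain r hr)
  have : 0 < c * ‖b‖ ^ 2 := by positivity
  linarith

/-- (II) -/
theorem LII {ν : Measure (E 4)} (hν : Unif ν) (h0 : 0 ∈ msupp ν) {c : ℝ} (hc : 0 < c)
    (h1 : ∀ r, 0 < r → ∀ z, ‖z‖ = 1 → c ≤ ⟪Aop ν r z, z⟫) :
    ∃ u : E 4, ‖u‖ = 1 ∧ ∀ x, x ∈ msupp ν ↔ ⟪kpL u x, x⟫ = 0 := by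
  have := hν.1
  have hsp := spans_of_A one_pos hc (h1 1 one_pos)
  have hat : Tendsto (fun j : ℕ => ((j : ℝ) + 1)) (hyperfilter ℕ : Filter ℕ) atTop :=
    (tendsto_natCast_atTop_atTop.atTop_add tendsto_const_nhds).mono_left Nat.hyperfilter_le_atTop
  obtain ⟨ν', b, hν', h00, hA, hS, hb, hF⟩ := BD hν h0 hsp (hyperfilter ℕ) (R := fun j => (j : ℝ) + 1)
    (fun j => by positivity) hat
  rcases DI hν' h00 hF with ⟨u, hu, hFu, -⟩ | ⟨n, hn, hiff, hFn⟩
  · have hbz : b = 0 := by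
      refine b_zero hν h0 hc h1 (K := 1) one_pos fun x hx => ?_
      have h2 := hb x hx
      rw [hFu, kpL_self, real_inner_comm] at h2
      have h3 := abs_real_inner_le_norm u x
      rw [hu, one_mul] at h3
      have h4 : ⟪u, x⟫ ^ 2 ≤ ‖x‖ ^ 2 := sq_le_sq' (by linarith [neg_abs_le ⟪u, x⟫]) ((le_abs_self _).trans h3)
      rw [abs_le]; constructor <;> nlinarith [sq_nonneg ⟪u, x⟫, sq_nonneg ‖x‖]
    subst hbz
    obtain ⟨u', hu', -, hiff⟩ := LK hν h0 hsp (kpL_symm u) (fun e => by rw [← hFu]; exact hν'.trace h00 one_pos e)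
      (fun x hx => by rw [← hFu, ← hb x hx, inner_zero_right, mul_zero])
    exact ⟨u', hu', hiff⟩
  · exact (no_flat hν h0 hsp (hyperfilter ℕ) (R := fun j => (j : ℝ) + 1) (fun j => by positivity) hn (fun y hy => (hS y).1 ((hiff y).2 hy))
      (fun x hx => by rw [hb x hx, hFn])).elim

/-- linear lemma -/
lemma LinL {u : E 4} (hu : ‖u‖ = 1) {A : E4L} (hA : SymL A) {β : E 4}
    (h : ∀ x, ‖x‖ < 1 → ⟪kpL u x, x⟫ = 0 → 2 * ⟪x, β⟫ = ⟪A x, x⟫) (e : OB4) (htr : ∑ i, ⟪A (e i), e i⟫ = 0) :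
    β = 0 ∧ A = 0 := by
  have huu : ⟪u, u⟫ = 1 := by rw [real_inner_self_eq_norm_sq, hu]; norm_num
  have hhom : ∀ x, ⟪kpL u x, x⟫ = 0 → ⟪x, β⟫ = 0 ∧ ⟪A x, x⟫ = 0 := by
    intro x hx
    set t : ℝ := (‖x‖ + 1)⁻¹ with ht
    have ht0 : 0 < t := by positivity
    have hs : ∀ s : ℝ, |s| = t → 2 * s * ⟪x, β⟫ = s ^ 2 * ⟪A x, x⟫ := by
      intro s hs
      have h1 := h (s • x) (by
        rw [norm_smul, Real.norm_eq_abs, hs, ht, inv_mul_lt_iff₀ (by positivity)]; linarith)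
        (by rw [map_smul, inner_smul_left, inner_smul_right, hx]; simp)
      rw [map_smul, inner_smul_left, inner_smul_left, inner_smul_right] at h1
      simp at h1; linarith
    have h1 := hs t (abs_of_pos ht0)
    have h2 := hs (-t) (by rw [abs_neg, abs_of_pos ht0])
    have h3 : t * ⟪x, β⟫ = 0 := by linarith
    have h4 : t ^ 2 * ⟪A x, x⟫ = 0 := by linarith
    exact ⟨(mul_eq_zero.1 h3).resolve_left ht0.ne', (mul_eq_zero.1 h4).resolve_left (by positivity)⟩
  have hcone : ∀ v : E 4, ⟪u, v⟫ = 0 → ∀ s : ℝ, s ^ 2 = ‖v‖ ^ 2 → ⟪kpL u (s • u + v), s • u + v⟫ = 0 := by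
    intro v hv s hs
    rw [kpL_self, ← real_inner_self_eq_norm_sq]
    have hvu : ⟪v, u⟫ = 0 := by rw [real_inner_comm, hv]
    simp only [inner_add_left, inner_add_right, inner_smul_left, inner_smul_right, conj_trivial, hvu, hv, huu]
    rw [real_inner_self_eq_norm_sq, ← hs]
    ring
  set a := ⟪A u, u⟫ with ha
  have key : ∀ v : E 4, ⟪u, v⟫ = 0 → ‖v‖ * ⟪u, β⟫ = 0 ∧ ⟪v, β⟫ = 0 ∧ ‖v‖ ^ 2 * a + ⟪A v, v⟫ = 0 ∧ ‖v‖ * ⟪A u, v⟫ = 0 := by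
    intro v hv
    obtain ⟨h1, h2⟩ := hhom _ (hcone v hv ‖v‖ rfl)
    obtain ⟨h3, h4⟩ := hhom _ (hcone v hv (-‖v‖) (by ring))
    simp only [inner_add_left, inner_add_right, map_add, map_smul, inner_smul_left, inner_smul_right, hA v u, conj_trivial, ← ha] at h1 h2 h3 h4
    refine ⟨by linarith, by linarith, by nlinarith, by nlinarith⟩
  obtain ⟨v, hv0, hv⟩ : ∃ v : E 4, v ≠ 0 ∧ ⟪u, v⟫ = 0 := by
    obtain ⟨J, hJ⟩ := exists_hyper_emb u (by rintro rfl; simp at hu)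
    refine ⟨J (EuclideanSpace.single 0 1), ?_, (hJ _).2 ⟨_, rfl⟩⟩
    intro h0
    have := J.norm_map (EuclideanSpace.single 0 1)
    rw [h0] at this; simp at this
  have hub : ⟪u, β⟫ = 0 := (mul_eq_zero.1 (key v hv).1).resolve_left (norm_ne_zero_iff.2 hv0)
  have hdec : ∀ x : E 4, ⟪u, x - ⟪u, x⟫ • u⟫ = 0 := fun x => by rw [inner_sub_right, inner_smul_right, huu]; ring
  have hβ : β = 0 := by
    refine ext_inner_left ℝ fun x => ?_
    have := (key _ (hdec x)).2.1
    rw [inner_sub_left, inner_smul_left, hub] at this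
    rw [inner_zero_right]; simpa using this
  have hq : ∀ x, ⟪A x, x⟫ = a * (2 * ⟪u, x⟫ ^ 2 - ‖x‖ ^ 2) := by
    intro x
    obtain ⟨-, -, h3, h4⟩ := key _ (hdec x)
    set y := x - ⟪u, x⟫ • u with hy
    have hAy : ⟪A u, y⟫ = 0 := by
      rcases mul_eq_zero.1 h4 with h | h
      · rw [norm_eq_zero.1 h, inner_zero_right]
      · exact h
    have hxy : x = ⟪u, x⟫ • u + y := by rw [hy]; abel
    have hny : ‖y‖ ^ 2 = ‖x‖ ^ 2 - ⟪u, x⟫ ^ 2 := by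
      rw [hy, ← real_inner_self_eq_norm_sq, ← real_inner_self_eq_norm_sq]
      simp only [inner_sub_left, inner_sub_right, inner_smul_left, inner_smul_right, huu, real_inner_comm u x, conj_trivial]
      ring
    have : ⟪A x, x⟫ = ⟪u, x⟫ ^ 2 * a + ⟪A y, y⟫ := by
      conv_lhs => rw [hxy]
      simp only [inner_add_left, inner_add_right, map_add, map_smul, inner_smul_left, inner_smul_right, hA y u, conj_trivial, ← ha, hAy]
      ring
    rw [this]; rw [hny] at h3; linarith
  have ha0 : a = 0 := by
    simp only [hq] at htr
    rw [← Finset.mul_sum, Finset.sum_sub_distrib, ← Finset.mul_sum] at htr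
    have h1 : ∑ i, ⟪u, e i⟫ ^ 2 = 1 := by
      have := norm_coord e u
      rw [hu] at this
      rw [show (∑ i, ⟪u, e i⟫ ^ 2) = ∑ i, ⟪e i, u⟫ ^ 2 from Finset.sum_congr rfl fun i _ => by rw [real_inner_comm]]
      linarith
    rw [h1] at htr
    simp at htr
    rcases htr with h | h
    · exact h
    · norm_num at h
  refine ⟨hβ, ?_⟩
  ext1 x
  refine ext_inner_right ℝ fun y => ?_
  have h1 := hq (x + y)
  have h2 := hq x
  have h3 := hq y
  rw [ha0] at h1 h2 h3
  simp only [inner_add_left, inner_add_right, map_add, hA y x] at h1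
  simp; linarith

def NF (μ : Measure (E 4)) (c s : ℝ) : Prop := 0 < c ∧ 0 < s ∧ ∀ r, 0 < r → r ≤ s → ¬ PA μ c r

lemma ConeBU {ι : Type*} {μ : Measure (E 4)} {C α c s : ℝ} (H : HReg μ C α) (hN : NF μ c s) (U : Ultrafilter ι) {t : ι → ℝ}
    (ht : ∀ i, 0 < t i) (ht0 : Tendsto t U (𝓝 0)) : ∃ u : E 4, ‖u‖ = 1 ∧
      ∀ y, ⟪kpL u y, y⟫ = 0 ↔ ∀ s : ℝ, 0 < s → ∀ᶠ i in (U : Filter ι), ∃ z ∈ msupp (blow μ 0 (t i)), dist z y < s := by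
  obtain ⟨ν, hν, h0, hA, -, hS⟩ := BUP H U ht ht0
  obtain ⟨hc, hs, hP⟩ := hN
  obtain ⟨u, hu, hux⟩ := LII hν h0 hc (fun r hr z hz => by
    have h1 : ∀ᶠ i in (U : Filter ι), t i * r < s := by
      have := ht0.mul_const r
      rw [zero_mul] at this
      exact this.eventually_lt_const hs
    refine ge_of_tendsto (opq_tendsto (hA r hr) (tendsto_const_nhds (x := z))) ?_
    filter_upwards [h1] with i hi
    by_contra hcon
    exact hP _ (mul_pos (ht i) hr) hi.le ⟨z, hz, not_le.1 hcon⟩)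
  exact ⟨u, hu, fun y => (hux y).symm.trans (hS y)⟩

lemma ultra_limP {ι F : Type*} [NormedAddCommGroup F] [ProperSpace F] (U : Ultrafilter ι) (y : ι → F) {R : ℝ}
    (h : ∀ i, ‖y i‖ ≤ R) : ∃ y0, Tendsto y U (𝓝 y0) := by
  obtain ⟨y0, -, hy0⟩ := (isCompact_closedBall (0 : F) R).ultrafilter_le_nhds (U.map y)
    (by
      rw [le_principal_iff]
      exact Filter.mem_map.2 (Filter.Eventually.of_forall (p := fun i => y i ∈ closedBall (0 : F) R) fun i => by simpa using h i))
  exact ⟨y0, hy0⟩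

lemma St {μ : Measure (E 4)} {C α c s : ℝ} (H : HReg μ C α) (hN : NF μ c s) :
    ∃ K, 0 < K ∧ ∃ ρ0, 0 < ρ0 ∧ ∀ ρ, 0 < ρ → ρ < ρ0 → ∀ (A : E4L) (β : E 4) (M : ℝ), SymL A →
      (∀ x ∈ msupp μ, ‖x‖ ≤ ρ → |2 * ⟪x, β⟫ - ⟪A x, x⟫| ≤ M * ρ ^ 2) →
      |∑ i, ⟪A (ob4 i), ob4 i⟫| ≤ M → ‖A‖ + ‖β‖ / ρ ≤ K * M := by
  by_contra hcon
  push Not at hcon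
  choose ρ hρ0 hρ1 A β M hA hq htr hbig using fun n : ℕ => hcon ((n : ℝ) + 1) (by positivity) (1 / ((n : ℝ) + 1)) (by positivity)
  have hρl : Tendsto ρ (hyperfilter ℕ : Filter ℕ) (𝓝 0) := (squeeze_zero (fun J => (hρ0 J).le) (fun n => (hρ1 n).le)
    tendsto_one_div_add_atTop_nhds_zero_nat).mono_left Nat.hyperfilter_le_atTop
  obtain ⟨u, hu, hS⟩ := ConeBU H hN (hyperfilter ℕ) hρ0 hρl
  set N : ℕ → ℝ := fun n => ‖A n‖ + ‖β n‖ / ρ n with hNdef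
  have hM : ∀ n, 0 ≤ M n := fun n => (abs_nonneg _).trans (htr n)
  have hN0 : ∀ n, 0 < N n := fun n => lt_of_le_of_lt (mul_nonneg (by positivity) (hM n)) (hbig n)
  have hMN : ∀ n, M n / N n ≤ 1 / ((n : ℝ) + 1) := fun n => by
    rw [div_le_div_iff₀ (hN0 n) (by positivity)]
    have := (hbig n).le
    rw [one_mul, mul_comm]; exact this
  have hMNl : Tendsto (fun n => M n / N n) (hyperfilter ℕ : Filter ℕ) (𝓝 0) :=
    (squeeze_zero (fun n => div_nonneg (hM n) (hN0 n).le) hMN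
    tendsto_one_div_add_atTop_nhds_zero_nat).mono_left Nat.hyperfilter_le_atTop
  set A' : ℕ → E4L := fun n => (N n)⁻¹ • A n with hA'
  set β' : ℕ → E 4 := fun n => (ρ n * N n)⁻¹ • β n with hβ'
  have hsum : ∀ n, ‖A' n‖ + ‖β' n‖ = 1 := by
    intro n
    have h1 := hN0 n
    have h2 := hρ0 n
    rw [hA', hβ']
    simp only [norm_smul, norm_inv, Real.norm_eq_abs, abs_of_pos h1, abs_of_pos (mul_pos h2 h1)]
    have : (N n)⁻¹ * N n = 1 := inv_mul_cancel₀ h1.ne'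
    rw [mul_inv, ← this]
    simp only [hNdef]
    ring
  have : ProperSpace E4L := FiniteDimensional.proper ℝ E4L
  obtain ⟨A0, hA0⟩ := ultra_limP (hyperfilter ℕ) A' (R := 1) fun n => by linarith [hsum n, norm_nonneg (β' n)]
  obtain ⟨β0, hβ0⟩ := ultra_limP (hyperfilter ℕ) β' (R := 1) fun n => by linarith [hsum n, norm_nonneg (A' n)]
  have h1 : ‖A0‖ + ‖β0‖ = 1 := tendsto_nhds_unique (hA0.norm.add hβ0.norm) (by simp only [hsum]; exact tendsto_const_nhds)
  have hsym : SymL A0 := fun x y => by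
    refine tendsto_nhds_unique ((clm_tendsto hA0 (tendsto_const_nhds (x := x))).inner (tendsto_const_nhds (x := y))) ?_
    refine ((clm_tendsto hA0 (tendsto_const_nhds (x := y))).inner (tendsto_const_nhds (x := x))).congr fun n => ?_
    simp only [hA', smul_apply, inner_smul_left, hA n y x]
  have hz : ∀ x, ‖x‖ < 1 → ⟪kpL u x, x⟫ = 0 → 2 * ⟪x, β0⟫ = ⟪A0 x, x⟫ := by
    intro x hx hk
    obtain ⟨z, hz, hzS⟩ := lim_pt ((hS x).1 hk)
    have hl := ((hz.inner hβ0).const_mul 2).sub (opq_tendsto hA0 hz)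
    have hb : Tendsto (fun n => 2 * ⟪z n, β' n⟫ - ⟪A' n (z n), z n⟫) (hyperfilter ℕ : Filter ℕ) (𝓝 0) := by
      refine squeeze_zero_norm' ?_ hMNl
      filter_upwards [hzS, hz.norm.eventually_lt_const hx] with n hn hn1
      have h1 := hN0 n
      have h2 := hρ0 n
      have h3 := (blow_msupp μ 0 h2 _).1 hn
      rw [zero_add] at h3
      have h4 := hq n _ h3 (by rw [norm_smul, Real.norm_eq_abs, abs_of_pos h2]; nlinarith)
      simp only [hA', hβ', smul_apply, inner_smul_left, inner_smul_right, map_smul, conj_trivial] at h4 ⊢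
      have h5 : 2 * ((ρ n * N n)⁻¹ * ⟪z n, β n⟫) - (N n)⁻¹ * ⟪A n (z n), z n⟫ =
          (N n)⁻¹ * (ρ n ^ 2)⁻¹ * (2 * (ρ n * ⟪z n, β n⟫) - ρ n * (ρ n * ⟪A n (z n), z n⟫)) := by
        field_simp
      rw [h5, Real.norm_eq_abs, abs_mul, abs_of_pos (by positivity)]
      calc _ ≤ (N n)⁻¹ * (ρ n ^ 2)⁻¹ * (M n * ρ n ^ 2) := by gcongr
        _ = _ := by field_simp
    linarith [tendsto_nhds_unique hl hb]
  have htr0 : ∑ i, ⟪A0 (ob4 i), ob4 i⟫ = 0 := by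
    have hl : Tendsto (fun n => ∑ i, ⟪A' n (ob4 i), ob4 i⟫) (hyperfilter ℕ : Filter ℕ) (𝓝 (∑ i, ⟪A0 (ob4 i), ob4 i⟫)) :=
      tendsto_finsetSum _ fun i _ => opq_tendsto hA0 tendsto_const_nhds
    refine tendsto_nhds_unique hl (squeeze_zero_norm (fun n => ?_) hMNl)
    have h1 := hN0 n
    simp only [hA', smul_apply, inner_smul_left, conj_trivial]
    rw [← Finset.mul_sum, Real.norm_eq_abs, abs_mul, abs_of_pos (by positivity), div_eq_inv_mul]
    gcongr
    exact htr n
  obtain ⟨hb, hA⟩ := LinL hu hsym hz ob4 htr0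
  rw [hb, hA] at h1
  simp at h1

lemma R1 {μ : Measure (E 4)} {C α : ℝ} (H : HReg μ C α) : ∃ γ κ K ρ0 : ℝ, 0 < γ ∧ 0 < κ ∧ κ ≤ 1 ∧ 0 < K ∧ 0 < ρ0 ∧ ρ0 ≤ 1 ∧
    ∀ ρ, 0 < ρ → ρ < ρ0 →
      (∀ x ∈ msupp μ, ‖x‖ ≤ ρ → |2 * ⟪x, bt μ (ρ ^ γ)⟫ - ⟪Fop μ (ρ ^ γ) x, x⟫| ≤ K * ρ ^ κ * ρ ^ 2) ∧
      |∑ i, ⟪Fop μ (ρ ^ γ) (ob4 i), ob4 i⟫ - 1| ≤ K * ρ ^ κ := by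
  obtain ⟨hlf, h0, hα, hC, H⟩ := H
  have hω := omega3_pos
  have hKE := KE_pos
  set κ := α / (4 + 2 * α) with hκ
  set γ := 1 - κ with hγ
  have hκ0 : 0 < κ := by positivity
  have hκ1 : κ ≤ 1 / 2 := by rw [hκ, div_le_div_iff₀ (by positivity) (by positivity)]; linarith
  have hκα : κ * (4 + 2 * α) = α := by rw [hκ]; field_simp
  have hγ0 : 0 < γ := by linarith
  have e1 : κ ≤ γ * α := by nlinarith
  have e2 : κ + 2 ≤ γ * (α + 2) := by nlinarith
  have ht : Tendsto (fun ρ : ℝ => C * (2 * ρ ^ γ) ^ α) (𝓝 0) (𝓝 0) := by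
    have h1 : Tendsto (fun ρ : ℝ => ρ ^ γ) (𝓝 0) (𝓝 ((0 : ℝ) ^ γ)) := tendsto_id.rpow_const (Or.inr hγ0.le)
    rw [Real.zero_rpow hγ0.ne'] at h1
    have := ((h1.const_mul 2).rpow_const (p := α) (Or.inr hα.le)).const_mul C
    rwa [mul_zero, Real.zero_rpow hα.ne', mul_zero] at this
  have ht2 : Tendsto (fun ρ : ℝ => 2 * ρ ^ γ) (𝓝 0) (𝓝 0) := by
    have h1 : Tendsto (fun ρ : ℝ => ρ ^ γ) (𝓝 0) (𝓝 ((0 : ℝ) ^ γ)) := tendsto_id.rpow_const (Or.inr hγ0.le)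
    rw [Real.zero_rpow hγ0.ne'] at h1
    simpa using h1.const_mul 2
  obtain ⟨δ, hδ, hδ2⟩ := Metric.eventually_nhds_iff.1 ((ht.eventually_lt_const one_pos).and (ht2.eventually_lt_const one_pos))
  set K := KE * (1 + 2 * (C * 2 ^ α)) + 11 / omega3 * (C * 2 ^ α) with hK
  have h2α : (0 : ℝ) < 2 ^ α := by positivity
  refine ⟨γ, κ, K, min δ 1, hγ0, hκ0, by linarith, by positivity, lt_min hδ one_pos, min_le_right _ _, fun ρ hρ hρ1 => ?_⟩
  have hρ2 : ρ < 1 := hρ1.trans_le (min_le_right _ _)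
  obtain ⟨hε1, hr1⟩ := hδ2 (y := ρ) (by rw [Real.dist_0_eq_abs, abs_of_pos hρ]; exact hρ1.trans_le (min_le_left _ _))
  set r := ρ ^ γ with hr
  have hr0 : 0 < r := Real.rpow_pos_of_pos hρ _
  have hρr : ρ ≤ r := by
    conv_lhs => rw [← Real.rpow_one ρ]
    exact Real.rpow_le_rpow_of_exponent_ge hρ hρ2.le (by linarith)
  have hρκ : ρ ^ κ * r = ρ := by rw [hr, ← Real.rpow_add hρ, hγ, add_sub_cancel, Real.rpow_one]
  have hρκ0 : 0 < ρ ^ κ := Real.rpow_pos_of_pos hρ _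
  have f1 : r ^ α ≤ ρ ^ κ := by
    rw [hr, ← Real.rpow_mul hρ.le]
    exact Real.rpow_le_rpow_of_exponent_ge hρ hρ2.le e1
  have f2 : r ^ α * r ^ 2 ≤ ρ ^ κ * ρ ^ 2 := by
    rw [hr, ← Real.rpow_natCast, ← Real.rpow_natCast, ← Real.rpow_add hr0, ← Real.rpow_add hρ, ← Real.rpow_mul hρ.le]
    exact Real.rpow_le_rpow_of_exponent_ge hρ hρ2.le (by push_cast; exact e2)
  have hmul : (2 * r) ^ α = 2 ^ α * r ^ α := Real.mul_rpow (by norm_num) hr0.le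
  set ε := C * (2 * r) ^ α with hε
  have hε0 : 0 ≤ ε := by positivity
  have hBE : ∀ x ∈ msupp μ, ‖x‖ ≤ 1 → BE μ x ε (2 * r) := by
    intro x hx hx1 s hs hs2
    refine (H x hx hx1 s hs (by linarith)).trans ?_
    have : s ^ α ≤ (2 * r) ^ α := Real.rpow_le_rpow hs.le hs2 hα.le
    rw [hε]
    gcongr
  have hB0 := hBE 0 h0 (by simp)
  constructor
  · intro x hx hxρ
    have h1 := ME hε0 hε1.le hr0 hB0 (hBE x hx (by linarith)) (hxρ.trans hρr)
    rw [Fop_inner, real_inner_self_eq_norm_sq]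
    have h2 : 2 * ⟪x, bt μ r⟫ - (‖x‖ ^ 2 - ⟪Aop μ r x, x⟫) = 2 * ⟪x, bt μ r⟫ + ⟪Aop μ r x, x⟫ - ‖x‖ ^ 2 := by ring
    rw [h2]
    refine h1.trans ?_
    have h3 : ‖x‖ ^ 3 / r ≤ ρ ^ κ * ρ ^ 2 := by
      rw [div_le_iff₀ hr0]
      calc ‖x‖ ^ 3 ≤ ρ ^ 3 := by gcongr
        _ = ρ * ρ ^ 2 := by ring
        _ = ρ ^ κ * r * ρ ^ 2 := by rw [hρκ]
        _ = _ := by ring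
    have h4 : 2 * ε * r ^ 2 ≤ 2 * (C * 2 ^ α) * (ρ ^ κ * ρ ^ 2) := by
      rw [hε, hmul]
      calc _ = 2 * (C * 2 ^ α) * (r ^ α * r ^ 2) := by ring
        _ ≤ _ := by gcongr
    calc KE * (‖x‖ ^ 3 / r + 2 * ε * r ^ 2) ≤ KE * (ρ ^ κ * ρ ^ 2 + 2 * (C * 2 ^ α) * (ρ ^ κ * ρ ^ 2)) := by gcongr
      _ = KE * (1 + 2 * (C * 2 ^ α)) * ρ ^ κ * ρ ^ 2 := by ring
      _ ≤ K * ρ ^ κ * ρ ^ 2 := by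
        have : KE * (1 + 2 * (C * 2 ^ α)) ≤ K := by rw [hK]; exact le_add_of_nonneg_right (by positivity)
        gcongr
  · have h1 := A_trace hε0 hr0 (fun s hs hs2 => hB0 s hs (by linarith)) ob4
    have h2 : ∑ i, ⟪Fop μ r (ob4 i), ob4 i⟫ - 1 = -(∑ i, ⟪Aop μ r (ob4 i), ob4 i⟫ - 3) := by
      simp only [Fop_inner]
      rw [Finset.sum_sub_distrib, sum_id]; ring
    rw [h2, abs_neg]
    refine h1.trans ?_
    rw [hε, hmul]
    calc 11 / omega3 * (C * (2 ^ α * r ^ α)) = 11 / omega3 * (C * 2 ^ α) * r ^ α := by ring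
      _ ≤ 11 / omega3 * (C * 2 ^ α) * ρ ^ κ := by gcongr
      _ ≤ K * ρ ^ κ := by
        have : 11 / omega3 * (C * 2 ^ α) ≤ K := by rw [hK]; exact le_add_of_nonneg_left (by positivity)
        gcongr

lemma bt_lim {μ : Measure (E 4)} {C α : ℝ} (H : HReg μ C α) {t : ℕ → ℝ} (ht : ∀ i, 0 < t i)
    (ht0 : Tendsto t (hyperfilter ℕ : Filter ℕ) (𝓝 0)) : Tendsto (fun n => bt μ (t n)) (hyperfilter ℕ : Filter ℕ) (𝓝 0) := by
  obtain ⟨ν, -, -, -, hb, -⟩ := BUP H (hyperfilter ℕ) ht ht0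
  have := ht0.smul (hb 1 one_pos)
  rw [zero_smul] at this
  refine this.congr fun n => ?_
  rw [smul_inv_smul₀ (ht n).ne', mul_one]

lemma R2 {μ : Measure (E 4)} {C α c s : ℝ} (H : HReg μ C α) (hN : NF μ c s) : ∃ (G : E4L) (κ K ρ : ℝ), SymL G ∧
    ∑ i, ⟪G (ob4 i), ob4 i⟫ = 1 ∧ 0 < κ ∧ κ ≤ 1 ∧ 0 < K ∧ 0 < ρ ∧
    ∀ x ∈ msupp μ, ‖x‖ < ρ → |⟪G x, x⟫| ≤ K * ‖x‖ ^ κ * ‖x‖ ^ 2 := by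
  obtain ⟨γ, κ, K, ρ0, hγ, hκ, hκ1, hK, hρ0, hρ01, hR⟩ := R1 H
  obtain ⟨K', hK', ρ0', hρ0', hSt⟩ := St H hN
  set ρ1 := min ρ0 ρ0' / 2 with hρ1
  have hρ1p : 0 < ρ1 := by have := lt_min hρ0 hρ0'; positivity
  have hρ1a : ρ1 < ρ0 := by have := min_le_left ρ0 ρ0'; linarith
  have hρ1b : ρ1 < ρ0' := by have := min_le_right ρ0 ρ0'; linarith
  set ρ : ℕ → ℝ := fun n => ρ1 * (1 / 2) ^ n with hρ
  have hρp : ∀ n, 0 < ρ n := fun n => by positivity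
  have hρle : ∀ n, ρ n ≤ ρ1 := fun n => mul_le_of_le_one_right hρ1p.le (pow_le_one₀ (by norm_num) (by norm_num))
  have hρs : ∀ n, ρ (n + 1) = ρ n / 2 := fun n => by simp only [hρ, pow_succ]; ring
  have hρl : Tendsto ρ atTop (𝓝 0) := by
    have := (tendsto_pow_atTop_nhds_zero_of_lt_one (r := (1 / 2 : ℝ)) (by norm_num) (by norm_num)).const_mul ρ1
    rwa [mul_zero] at this
  set q : ℝ := (1 / 2) ^ κ with hq
  have hq0 : 0 < q := by positivity
  have hq1 : q < 1 := Real.rpow_lt_one (by norm_num) (by norm_num) hκ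
  have hρκ : ∀ n, ρ n ^ κ = ρ1 ^ κ * q ^ n := fun n => by
    simp only [hρ]
    rw [Real.mul_rpow hρ1p.le (by positivity), hq, ← Real.rpow_natCast, ← Real.rpow_mul (by norm_num), mul_comm (n : ℝ),
      Real.rpow_mul (by norm_num), Real.rpow_natCast]
  set G : ℕ → E4L := fun n => Fop μ (ρ n ^ γ) with hG
  set b : ℕ → E 4 := fun n => bt μ (ρ n ^ γ) with hb
  have hsym : ∀ n, SymL (G n) := fun n => Fop_symm H.1 (Real.rpow_pos_of_pos (hρp n) _)
  have hRn : ∀ n, _ := fun n => hR (ρ n) (hρp n) ((hρle n).trans_lt hρ1a)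
  have hstep : ∀ n, ‖G n - G (n + 1)‖ + ‖b n - b (n + 1)‖ / ρ (n + 1) ≤ K' * (5 * K * ρ n ^ κ) := by
    intro n
    obtain ⟨h1, h2⟩ := hRn n
    obtain ⟨h3, h4⟩ := hRn (n + 1)
    have hp := hρp n
    have hle : ρ (n + 1) ^ κ ≤ ρ n ^ κ := Real.rpow_le_rpow (hρp _).le (by rw [hρs]; linarith) hκ.le
    have hpk : 0 < ρ n ^ κ := Real.rpow_pos_of_pos hp _
    refine hSt (ρ (n + 1)) (hρp _) ((hρle _).trans_lt hρ1b) _ _ _ ?_ ?_ ?_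
    · intro x y
      simp only [sub_apply, inner_sub_left, hsym n x y, hsym (n + 1) x y]
    · intro x hx hxr
      have a1 := h1 x hx (hxr.trans (by rw [hρs]; linarith))
      have a2 := h3 x hx hxr
      simp only [sub_apply, inner_sub_left, inner_sub_right]
      have e : 2 * (⟪x, b n⟫ - ⟪x, b (n + 1)⟫) - (⟪G n x, x⟫ - ⟪G (n + 1) x, x⟫) =
        (2 * ⟪x, b n⟫ - ⟪G n x, x⟫) - (2 * ⟪x, b (n + 1)⟫ - ⟪G (n + 1) x, x⟫) := by ring
      rw [e]
      refine (abs_sub _ _).trans ((add_le_add a1 a2).trans ?_)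
      calc K * ρ n ^ κ * ρ n ^ 2 + K * ρ (n + 1) ^ κ * ρ (n + 1) ^ 2
          ≤ K * ρ n ^ κ * ρ n ^ 2 + K * ρ n ^ κ * ρ (n + 1) ^ 2 := by gcongr
        _ = 5 * K * ρ n ^ κ * ρ (n + 1) ^ 2 := by rw [hρs]; ring
    · simp only [sub_apply, inner_sub_left]
      rw [Finset.sum_sub_distrib]
      have e : ∑ i, ⟪G n (ob4 i), ob4 i⟫ - ∑ i, ⟪G (n + 1) (ob4 i), ob4 i⟫ =
        (∑ i, ⟪G n (ob4 i), ob4 i⟫ - 1) - (∑ i, ⟪G (n + 1) (ob4 i), ob4 i⟫ - 1) := by ring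
      rw [e]
      refine (abs_sub _ _).trans ((add_le_add h2 h4).trans ?_)
      have : K * ρ (n + 1) ^ κ ≤ K * ρ n ^ κ := by gcongr
      have : 0 < K * ρ n ^ κ := by positivity
      linarith
  set D := K' * (5 * K * ρ1 ^ κ) with hD
  have hDp : 0 < D := by have : 0 < ρ1 ^ κ := Real.rpow_pos_of_pos hρ1p _; positivity
  have hstep2 : ∀ n, ‖G n - G (n + 1)‖ + ‖b n - b (n + 1)‖ / ρ (n + 1) ≤ D * q ^ n := fun n => (hstep n).trans (by
    rw [hρκ n, hD]; exact le_of_eq (by ring))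
  have hG1 : ∀ n, dist (G n) (G (n + 1)) ≤ D * q ^ n := fun n => by
    rw [dist_eq_norm]
    have := hstep2 n
    have : 0 ≤ ‖b n - b (n + 1)‖ / ρ (n + 1) := div_nonneg (norm_nonneg _) (hρp _).le
    linarith
  have hb1 : ∀ n, dist (b n) (b (n + 1)) ≤ D * ρ1 * (q / 2) ^ n := fun n => by
    rw [dist_eq_norm]
    have h1 := hstep2 n
    have h2 : ‖b n - b (n + 1)‖ / ρ (n + 1) ≤ D * q ^ n := by linarith [norm_nonneg (G n - G (n + 1))]
    rw [div_le_iff₀ (hρp _)] at h2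
    refine h2.trans ?_
    have : D * q ^ n * ρ (n + 1) ≤ D * q ^ n * ρ n := by
      have : ρ (n + 1) ≤ ρ n := by rw [hρs]; linarith [hρp n]
      gcongr
    refine this.trans (le_of_eq ?_)
    simp only [hρ, div_pow, one_pow]; ring
  have : ProperSpace E4L := FiniteDimensional.proper ℝ E4L
  obtain ⟨G0, hG0⟩ := cauchySeq_tendsto_of_complete (cauchySeq_of_le_geometric q D hq1 hG1)
  obtain ⟨b0, hb0⟩ := cauchySeq_tendsto_of_complete (cauchySeq_of_le_geometric (q / 2) (D * ρ1) (by linarith) hb1)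
  have hb00 : b0 = 0 := by
    refine tendsto_nhds_unique (hb0.mono_left Nat.hyperfilter_le_atTop) (bt_lim H (fun n => Real.rpow_pos_of_pos (hρp n) _) ?_)
    have := hρl.rpow_const (p := γ) (Or.inr hγ.le)
    rw [Real.zero_rpow hγ.ne'] at this
    exact this.mono_left Nat.hyperfilter_le_atTop
  rw [hb00] at hb0
  have hGr : ∀ n, ‖G n - G0‖ ≤ D * q ^ n / (1 - q) := fun n => by
    rw [← dist_eq_norm]; exact dist_le_of_le_geometric_of_tendsto q D hq1 hG1 hG0 n
  have hbr : ∀ n, ‖b n‖ ≤ D * ρ1 * (q / 2) ^ n / (1 - q / 2) := fun n => by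
    rw [← dist_zero_right]; exact dist_le_of_le_geometric_of_tendsto (q / 2) (D * ρ1) (by linarith) hb1 hb0 n
  refine ⟨G0, κ, 8 * (K + 2 * (D / ρ1 ^ κ / (1 - q))  + D / ρ1 ^ κ / (1 - q)), ρ1, ?_, ?_, hκ, hκ1, ?_, hρ1p, ?_⟩
  · intro x y
    refine tendsto_nhds_unique ((clm_tendsto hG0 (tendsto_const_nhds (x := x))).inner (tendsto_const_nhds (x := y))) ?_
    exact ((clm_tendsto hG0 (tendsto_const_nhds (x := y))).inner (tendsto_const_nhds (x := x))).congr fun n => hsym n y x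
  · have hl : Tendsto (fun n => ∑ i, ⟪G n (ob4 i), ob4 i⟫) atTop (𝓝 (∑ i, ⟪G0 (ob4 i), ob4 i⟫)) :=
      tendsto_finsetSum _ fun i _ => opq_tendsto hG0 tendsto_const_nhds
    have hz : Tendsto (fun n => ∑ i, ⟪G n (ob4 i), ob4 i⟫ - 1) atTop (𝓝 0) := by
      refine squeeze_zero_norm (fun n => (hRn n).2) ?_
      have := (hρl.rpow_const (p := κ) (Or.inr hκ.le)).const_mul K
      rwa [Real.zero_rpow hκ.ne', mul_zero] at this
    linarith [tendsto_nhds_unique (hl.sub_const 1) hz]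
  · have : 0 < 1 - q := by linarith
    have : 0 < ρ1 ^ κ := Real.rpow_pos_of_pos hρ1p _
    positivity
  · intro x hx hxρ
    rcases eq_or_ne x 0 with rfl | hx0
    · simp
    have hxp : 0 < ‖x‖ := norm_pos_iff.2 hx0
    obtain ⟨n, hn1, hn2⟩ := exists_nat_pow_near_of_lt_one (x := ‖x‖ / ρ1) (y := (1 / 2 : ℝ)) (by positivity)
      ((div_le_one hρ1p).2 hxρ.le) (by norm_num) (by norm_num)
    have hn1' : ρ (n + 1) < ‖x‖ := by rw [lt_div_iff₀ hρ1p] at hn1; simp only [hρ]; linarith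
    have hn2' : ‖x‖ ≤ ρ n := by rw [div_le_iff₀ hρ1p] at hn2; simp only [hρ]; linarith
    rw [hρs] at hn1'
    have hp := hρp n
    have hq2 : 0 < 1 - q := by linarith
    have hρ1k : 0 < ρ1 ^ κ := Real.rpow_pos_of_pos hρ1p _
    have hpk : 0 < ρ n ^ κ := Real.rpow_pos_of_pos hp _
    have hDq : D * q ^ n / (1 - q) = D / ρ1 ^ κ / (1 - q) * ρ n ^ κ := by rw [hρκ]; field_simp
    set M := D / ρ1 ^ κ / (1 - q) with hM
    have hM0 : 0 < M := by positivity
    have a1 : |2 * ⟪x, b n⟫ - ⟪G n x, x⟫| ≤ K * ρ n ^ κ * ρ n ^ 2 := (hRn n).1 x hx hn2'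
    have a2 : |⟪x, b n⟫| ≤ M * ρ n ^ κ * ρ n ^ 2 := by
      have h1 : ‖b n‖ ≤ M * ρ n ^ κ * ρ n := by
        refine (hbr n).trans ?_
        rw [← hDq]
        have : D * ρ1 * (q / 2) ^ n / (1 - q / 2) ≤ D * ρ1 * (q / 2) ^ n / (1 - q) := by gcongr; linarith
        refine this.trans (le_of_eq ?_)
        simp only [hρ, div_pow, one_pow]; ring
      calc |⟪x, b n⟫| ≤ ‖x‖ * ‖b n‖ := abs_real_inner_le_norm _ _
        _ ≤ ρ n * (M * ρ n ^ κ * ρ n) := by gcongr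
        _ = _ := by ring
    have a3 : |⟪(G n - G0) x, x⟫| ≤ M * ρ n ^ κ * ρ n ^ 2 := by
      have := hGr n
      rw [hDq] at this
      calc |⟪(G n - G0) x, x⟫| ≤ ‖(G n - G0) x‖ * ‖x‖ := abs_real_inner_le_norm _ _
        _ ≤ ‖G n - G0‖ * ‖x‖ * ‖x‖ := by gcongr; exact (G n - G0).le_opNorm x
        _ ≤ (M * ρ n ^ κ) * ρ n * ρ n := by gcongr
        _ = _ := by ring
    have e : ⟪G0 x, x⟫ = -(2 * ⟪x, b n⟫ - ⟪G n x, x⟫) + 2 * ⟪x, b n⟫ - ⟪(G n - G0) x, x⟫ := by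
      simp only [sub_apply, inner_sub_left]; ring
    have a4 : |⟪G0 x, x⟫| ≤ (K + 2 * M + M) * ρ n ^ κ * ρ n ^ 2 := by
      rw [abs_le] at a1 a2 a3 ⊢
      constructor <;> rw [e] <;> linarith
    refine a4.trans ?_
    have h5 : ρ n ^ κ ≤ 2 * ‖x‖ ^ κ := by
      calc ρ n ^ κ ≤ (2 * ‖x‖) ^ κ := Real.rpow_le_rpow hp.le (by linarith) hκ.le
        _ = 2 ^ κ * ‖x‖ ^ κ := Real.mul_rpow (by norm_num) hxp.le
        _ ≤ 2 ^ (1 : ℝ) * ‖x‖ ^ κ := by gcongr; norm_num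
        _ = _ := by rw [Real.rpow_one]
    calc (K + 2 * M + M) * ρ n ^ κ * ρ n ^ 2 ≤ (K + 2 * M + M) * (2 * ‖x‖ ^ κ) * (2 * ‖x‖) ^ 2 := by
          gcongr; linarith
      _ = _ := by ring

lemma kpL_trace {u : E 4} (hu : ‖u‖ = 1) : ∑ i, ⟪kpL u (ob4 i), ob4 i⟫ = 1 := by
  simp only [kpL_self]
  rw [Finset.sum_sub_distrib]
  have h1 : ∑ i, ⟪u, ob4 i⟫ ^ 2 = 1 := by
    have := norm_coord ob4 u
    rw [hu] at this
    rw [show (∑ i, ⟪u, ob4 i⟫ ^ 2) = ∑ i, ⟪ob4 i, u⟫ ^ 2 from Finset.sum_congr rfl fun i _ => by rw [real_inner_comm]]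
    linarith
  rw [h1]; simp; norm_num

lemma kpL_norm {u : E 4} (hu : ‖u‖ = 1) (x : E 4) : ‖kpL u x‖ = ‖x‖ / 2 := by
  have h : ‖kpL u x‖ ^ 2 = (‖x‖ / 2) ^ 2 := by
    rw [← real_inner_self_eq_norm_sq, kpL_apply]
    simp only [inner_sub_left, inner_sub_right, inner_smul_left, inner_smul_right, conj_trivial,
      real_inner_self_eq_norm_sq, hu, real_inner_comm u x]
    ring
  exact (pow_left_inj₀ (norm_nonneg _) (by positivity) two_ne_zero).1 h

/-- `G` determines all blow-up cones. -/
lemma coneG {μ : Measure (E 4)} {G : E4L} {κ K ρ : ℝ} (hG : SymL G)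
    (htr : ∑ i, ⟪G (ob4 i), ob4 i⟫ = 1) (hκ : 0 < κ) (hρ : 0 < ρ)
    (h : ∀ x ∈ msupp μ, ‖x‖ < ρ → |⟪G x, x⟫| ≤ K * ‖x‖ ^ κ * ‖x‖ ^ 2) {ι : Type*} (U : Ultrafilter ι) {t : ι → ℝ}
    (ht : ∀ i, 0 < t i) (ht0 : Tendsto t U (𝓝 0)) {u : E 4} (hu : ‖u‖ = 1)
    (hS : ∀ y, ⟪kpL u y, y⟫ = 0 ↔ ∀ s : ℝ, 0 < s → ∀ᶠ i in (U : Filter ι), ∃ z ∈ msupp (blow μ 0 (t i)), dist z y < s) :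
    G = kpL u := by
  have hz : ∀ x, ⟪kpL u x, x⟫ = 0 → ⟪G x, x⟫ = 0 := by
    intro x hx
    obtain ⟨z, hz, hzS⟩ := lim_pt ((hS x).1 hx)
    have htz : Tendsto (fun i => ‖t i • z i‖) U (𝓝 0) := by
      have := (ht0.smul hz).norm
      rwa [zero_smul, norm_zero] at this
    have hl := opq_tendsto (tendsto_const_nhds (x := G)) hz
    refine tendsto_nhds_unique hl (squeeze_zero_norm' (a := fun i => K * ‖t i • z i‖ ^ κ * ‖z i‖ ^ 2) ?_ ?_)
    · filter_upwards [hzS, htz.eventually_lt_const hρ] with i hi hi2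
      have hti := ht i
      have h3 := (blow_msupp μ 0 hti _).1 hi
      rw [zero_add] at h3
      have h4 := h _ h3 hi2
      rw [map_smul, inner_smul_left, inner_smul_right, conj_trivial] at h4
      rw [Real.norm_eq_abs]
      have h5 : |t i * (t i * ⟪G (z i), z i⟫)| = t i ^ 2 * |⟪G (z i), z i⟫| := by
        rw [abs_mul, abs_mul, abs_of_pos hti]; ring
      have h6 : K * ‖t i • z i‖ ^ κ * ‖t i • z i‖ ^ 2 = t i ^ 2 * (K * ‖t i • z i‖ ^ κ * ‖z i‖ ^ 2) := by
        rw [norm_smul (t i) (z i), Real.norm_eq_abs, abs_of_pos hti]; ring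
      rw [h5, h6] at h4
      exact le_of_mul_le_mul_left h4 (by positivity)
    · have := ((htz.rpow_const (p := κ) (Or.inr hκ.le)).const_mul K).mul (hz.norm.pow 2)
      rwa [Real.zero_rpow hκ.ne', mul_zero, zero_mul] at this
  have hA : SymL (G - kpL u) := fun x y => by
    rw [sub_apply, sub_apply, inner_sub_left, inner_sub_left, hG x y, kpL_symm u x y]
  have := (LinL hu (A := G - kpL u) (β := 0) hA (fun x _ hx => by
    rw [sub_apply, inner_sub_left, hx, hz x hx]; simp) ob4 (by
      simp only [sub_apply, inner_sub_left]
      rw [Finset.sum_sub_distrib, htr, kpL_trace hu, sub_self])).2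
  exact sub_eq_zero.1 this

lemma R3 {μ : Measure (E 4)} {C α c s : ℝ} (H : HReg μ C α) (hN : NF μ c s) : ∃ (e : E 4) (κ K ρ : ℝ), ‖e‖ = 1 ∧
    0 < κ ∧ κ ≤ 1 ∧ 0 < K ∧ 0 < ρ ∧
    (∀ x ∈ msupp μ, ‖x‖ < ρ → |⟪kpL e x, x⟫| ≤ K * ‖x‖ ^ κ * ‖x‖ ^ 2) ∧
    ∀ (U : Ultrafilter ℕ) (t : ℕ → ℝ), (∀ i, 0 < t i) → Tendsto t U (𝓝 0) → ∀ y, ⟪kpL e y, y⟫ = 0 →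
      ∀ s : ℝ, 0 < s → ∀ᶠ i in (U : Filter ℕ), ∃ z ∈ msupp (blow μ 0 (t i)), dist z y < s := by
  obtain ⟨G, κ, K, ρ, hG, htr, hκ, hκ1, hK, hρ, h⟩ := R2 H hN
  have hl : Tendsto (fun n : ℕ => 1 / ((n : ℝ) + 1)) (hyperfilter ℕ : Filter ℕ) (𝓝 0) :=
    tendsto_one_div_add_atTop_nhds_zero_nat.mono_left Nat.hyperfilter_le_atTop
  obtain ⟨e, he, heS⟩ := ConeBU H hN (hyperfilter ℕ) (t := fun n => 1 / ((n : ℝ) + 1)) (fun n => by positivity) hl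
  have hGe := coneG hG htr hκ hρ h _ (fun n => by positivity) hl he heS
  refine ⟨e, κ, K, ρ, he, hκ, hκ1, hK, hρ, by rw [← hGe]; exact h, fun U t ht ht0 y hy => ?_⟩
  obtain ⟨u, hu, huS⟩ := ConeBU H hN U ht ht0
  have hGu := coneG hG htr hκ hρ h _ ht ht0 hu huS
  refine (huS y).1 ?_
  rw [← hGu, hGe, hy]

/-- projection to the cone -/
lemma cone_proj {e x : E 4} (he : ‖e‖ = 1) {δ : ℝ} (h : |⟪kpL e x, x⟫| ≤ δ * ‖x‖ ^ 2) :
    ∃ y, ‖y‖ = ‖x‖ ∧ ⟪kpL e y, y⟫ = 0 ∧ dist x y ≤ 4 * δ * ‖x‖ := by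
  rcases eq_or_ne x 0 with rfl | hx0
  · exact ⟨0, rfl, by simp, by simp⟩
  have hx : 0 < ‖x‖ := norm_pos_iff.2 hx0
  have hee : ⟪e, e⟫ = 1 := by rw [real_inner_self_eq_norm_sq, he]; norm_num
  obtain ⟨v, hv0, hv⟩ : ∃ v : E 4, v ≠ 0 ∧ ⟪e, v⟫ = 0 := by
    obtain ⟨J, hJ⟩ := exists_hyper_emb e (by rintro rfl; simp at he)
    refine ⟨J (EuclideanSpace.single 0 1), ?_, (hJ _).2 ⟨_, rfl⟩⟩
    intro h0
    have := J.norm_map (EuclideanSpace.single 0 1)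
    rw [h0] at this; simp at this
  set s := ⟪e, x⟫ with hs
  obtain ⟨w, a, hw1, hew, ha, hxw⟩ : ∃ (w : E 4) (a : ℝ), ‖w‖ = 1 ∧ ⟪e, w⟫ = 0 ∧ 0 ≤ a ∧ x = s • e + a • w := by
    rcases eq_or_ne (x - s • e) 0 with h0 | h0
    · exact ⟨‖v‖⁻¹ • v, 0, nsi hv0, by rw [inner_smul_right, hv, mul_zero], le_rfl, by rw [zero_smul, add_zero]; exact sub_eq_zero.1 h0⟩
    · refine ⟨‖x - s • e‖⁻¹ • (x - s • e), ‖x - s • e‖, nsi h0, ?_, norm_nonneg _, ?_⟩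
      · rw [inner_smul_right, inner_sub_right, inner_smul_right, hee, ← hs]; ring
      · rw [smul_inv_smul₀ (norm_ne_zero_iff.2 h0)]; abel
  have hwe : ⟪w, e⟫ = 0 := by rw [real_inner_comm, hew]
  have hww : ⟪w, w⟫ = 1 := by rw [real_inner_self_eq_norm_sq, hw1]; norm_num
  have hnorm : ∀ p q : ℝ, ‖p • e + q • w‖ ^ 2 = p ^ 2 + q ^ 2 := by
    intro p q
    rw [← real_inner_self_eq_norm_sq]
    simp only [inner_add_left, inner_add_right, inner_smul_left, inner_smul_right, conj_trivial, hwe, hew, hee, hww]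
    ring
  have hquad : ∀ p q : ℝ, ⟪kpL e (p • e + q • w), p • e + q • w⟫ = (q ^ 2 - p ^ 2) / 2 := by
    intro p q
    rw [kpL_self, hnorm, inner_add_right, inner_smul_right, inner_smul_right, hee, hew]; ring
  have hxn : ‖x‖ ^ 2 = s ^ 2 + a ^ 2 := by conv_lhs => rw [hxw]; rw [hnorm]
  have hxq : ⟪kpL e x, x⟫ = (a ^ 2 - s ^ 2) / 2 := by conv_lhs => rw [hxw]; rw [hquad]
  rw [hxq] at h
  set t := √(‖x‖ ^ 2 / 2) with ht
  have ht0 : 0 < t := Real.sqrt_pos.2 (by positivity)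
  have ht2 : t ^ 2 = ‖x‖ ^ 2 / 2 := Real.sq_sqrt (by positivity)
  have htx : t ≤ ‖x‖ := by nlinarith
  have hδ : 0 ≤ δ := by
    by_contra hd
    have := (abs_nonneg _).trans h
    nlinarith [mul_pos (neg_pos.2 (not_le.1 hd)) (pow_pos hx 2)]
  have key : ∀ b, 0 ≤ b → |b ^ 2 - t ^ 2| ≤ δ * ‖x‖ ^ 2 → |b - t| ≤ 2 * δ * ‖x‖ := by
    intro b hb h1
    have e1 : |b ^ 2 - t ^ 2| = |b - t| * (b + t) := by
      rw [show b ^ 2 - t ^ 2 = (b - t) * (b + t) by ring, abs_mul, abs_of_pos (show 0 < b + t by linarith)]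
    have e2 : |b - t| * t ≤ 2 * δ * t * t := by
      calc |b - t| * t ≤ |b - t| * (b + t) := by gcongr; linarith
        _ ≤ δ * ‖x‖ ^ 2 := by rw [← e1]; exact h1
        _ = 2 * δ * t * t := by rw [show ‖x‖ ^ 2 = 2 * t ^ 2 by linarith]; ring
    refine (le_of_mul_le_mul_right e2 ht0).trans ?_
    gcongr
  have k1 := key a ha (by rwa [ht2, hxn, show a ^ 2 - (s ^ 2 + a ^ 2) / 2 = (a ^ 2 - s ^ 2) / 2 by ring, ← hxn])
  have k2 := key |s| (abs_nonneg s) (by rwa [ht2, hxn, sq_abs, show s ^ 2 - (s ^ 2 + a ^ 2) / 2 = -((a ^ 2 - s ^ 2) / 2) by ring, abs_neg, ← hxn])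
  obtain ⟨σ, hσ, hσs⟩ : ∃ σ : ℝ, |σ| = 1 ∧ s = σ * |s| := by
    rcases le_total 0 s with h | h
    · exact ⟨1, by simp, by rw [abs_of_nonneg h]; ring⟩
    · exact ⟨-1, by simp, by rw [abs_of_nonpos h]; ring⟩
  have hσ2 : σ ^ 2 = 1 := by rw [← sq_abs, hσ]; norm_num
  refine ⟨(σ * t) • e + t • w, ?_, ?_, ?_⟩
  · have : ‖(σ * t) • e + t • w‖ ^ 2 = ‖x‖ ^ 2 := by rw [hnorm, mul_pow, hσ2]; linarith
    exact (pow_left_inj₀ (norm_nonneg _) (by positivity) two_ne_zero).1 this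
  · rw [hquad, mul_pow, hσ2]; ring
  · have : x - ((σ * t) • e + t • w) = (σ * (|s| - t)) • e + (a - t) • w := by
      conv_lhs => rw [hxw]
      rw [mul_sub, ← hσs, sub_smul, sub_smul]; abel
    rw [dist_eq_norm, this]
    refine (norm_add_le _ _).trans ?_
    rw [norm_smul, norm_smul, he, hw1, Real.norm_eq_abs, Real.norm_eq_abs, abs_mul, hσ]
    linarith

lemma R4 {μ : Measure (E 4)} {C α : ℝ} (H : HReg μ C α) {e : E 4} {κ K ρ : ℝ} (he : ‖e‖ = 1)
    (hκ : 0 < κ) (hκ1 : κ ≤ 1) (hK : 0 < K) (hρ : 0 < ρ)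
    (h : ∀ x ∈ msupp μ, ‖x‖ < ρ → |⟪kpL e x, x⟫| ≤ K * ‖x‖ ^ κ * ‖x‖ ^ 2)
    (hS : ∀ (U : Ultrafilter ℕ) (t : ℕ → ℝ), (∀ i, 0 < t i) → Tendsto t U (𝓝 0) → ∀ y, ⟪kpL e y, y⟫ = 0 →
      ∀ s : ℝ, 0 < s → ∀ᶠ i in (U : Filter ℕ), ∃ z ∈ msupp (blow μ 0 (t i)), dist z y < s) :
    ∃ r0, 0 < r0 ∧ ∀ p, ‖p‖ < r0 → ⟪kpL e p, p⟫ = 0 → infDist p (msupp μ) ≤ ‖p‖ ^ (κ / 2) * ‖p‖ := by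
  by_contra hcon
  push Not at hcon
  choose p hp1 hp2 hp3 using fun n : ℕ => hcon (1 / ((n : ℝ) + 1)) (by positivity)
  set U : Ultrafilter ℕ := hyperfilter ℕ with hU
  have h0 := H.2.1
  set d : ℕ → ℝ := fun n => infDist (p n) (msupp μ) with hd
  have hp0 : ∀ n, 0 < ‖p n‖ := by
    intro n
    by_contra hc
    have h1 : p n = 0 := norm_le_zero_iff.1 (not_lt.1 hc)
    have h2 := hp3 n
    rw [h1, infDist_zero_of_mem h0] at h2
    simp at h2
  have hpk : ∀ n, 0 < ‖p n‖ ^ (κ / 2) := fun n => Real.rpow_pos_of_pos (hp0 n) _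
  have hd0 : ∀ n, 0 < d n := fun n => lt_trans (mul_pos (hpk n) (hp0 n)) (hp3 n)
  have hdle : ∀ n, d n ≤ ‖p n‖ := fun n => by
    have := infDist_le_dist_of_mem (x := p n) h0
    rwa [dist_zero_right] at this
  have hpl : Tendsto (fun n => ‖p n‖) U (𝓝 0) := (squeeze_zero (fun J => norm_nonneg _) (fun n => (hp1 n).le)
    tendsto_one_div_add_atTop_nhds_zero_nat).mono_left Nat.hyperfilter_le_atTop
  have hdl : Tendsto d U (𝓝 0) := squeeze_zero (fun n => (hd0 n).le) hdle hpl
  have hLp : ∀ n, kpL e (p n) ≠ 0 := fun n => kpL_ne he (norm_pos_iff.1 (hp0 n))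
  -- the ratio tends to zero
  have hratio : ∀ η, 0 < η → ∀ᶠ n in (U : Filter ℕ), d n ≤ η * ‖p n‖ := by
    intro η hη
    obtain ⟨w0, hw0, hwl⟩ := ultra_unit U (z := fun n => ‖p n‖⁻¹ • p n) (.of_forall fun n => nsi (norm_pos_iff.1 (hp0 n)))
    have hk : ⟪kpL e w0, w0⟫ = 0 := by
      refine tendsto_nhds_unique (opq_tendsto (tendsto_const_nhds (x := kpL e)) hwl) (tendsto_const_nhds.congr fun n => ?_)
      rw [map_smul, inner_smul_left, inner_smul_right, hp2 n]; simp
    filter_upwards [hS U _ hp0 hpl w0 hk (η / 2) (half_pos hη), (tendsto_iff_dist_tendsto_zero.1 hwl).eventually_lt_const (half_pos hη)] with n hn1 hn2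
    obtain ⟨z, hz, hz2⟩ := hn1
    have h3 := (blow_msupp μ 0 (hp0 n) _).1 hz
    rw [zero_add] at h3
    refine (infDist_le_dist_of_mem h3).trans ?_
    have h4 : p n - ‖p n‖ • z = ‖p n‖ • (‖p n‖⁻¹ • p n - z) := by rw [smul_sub, smul_inv_smul₀ (hp0 n).ne']
    rw [dist_eq_norm, h4, norm_smul, norm_norm, mul_comm, ← dist_eq_norm]
    have h5 : dist (‖p n‖⁻¹ • p n) z ≤ η := by
      have := dist_triangle_right (‖p n‖⁻¹ • p n) z w0
      linarith
    gcongr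
  have hpz : Tendsto p U (𝓝 0) := tendsto_zero_iff_norm_tendsto_zero.2 hpl
  refine NH U (fun n => blow μ (p n) (d n)) (AU.of_reg H hd0 hpz hdl)
    (.of_forall fun n => (blow_gap ⟨0, h0⟩ (hd0 n) rfl).1) (.of_forall fun n => (blow_gap ⟨0, h0⟩ (hd0 n) rfl).2)
    (fun n => ‖kpL e (p n)‖⁻¹ • kpL e (p n)) (.of_forall fun n => nsi (hLp n)) ?_
  intro R hR η hη
  have hpkl : Tendsto (fun n => K * (1 + R) ^ 3 * ‖p n‖ ^ (κ / 2)) U (𝓝 0) := by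
    have := (hpl.rpow_const (p := κ / 2) (Or.inr (by positivity))).const_mul (K * (1 + R) ^ 3)
    rwa [Real.zero_rpow (by positivity), mul_zero] at this
  have hpR : Tendsto (fun n => (1 + R) * ‖p n‖) U (𝓝 0) := by simpa using hpl.const_mul (1 + R)
  filter_upwards [hpkl.eventually_lt_const (half_pos hη), hpR.eventually_lt_const hρ,
    hratio (η / (2 * (R ^ 2))) (by positivity)] with n hn1 hn2 hn3 y hy hyR
  have hx := (blow_msupp μ (p n) (hd0 n) y).1 hy
  have hdn := hd0 n
  have hpn := hp0 n
  set P := ‖p n‖ with hP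
  have hxn : ‖p n + d n • y‖ ≤ (1 + R) * P := by
    refine (norm_add_le _ _).trans ?_
    rw [norm_smul, Real.norm_eq_abs, abs_of_pos hdn, ← hP]
    have : d n * ‖y‖ ≤ P * R := mul_le_mul (hdle n) hyR (norm_nonneg _) hpn.le
    linarith
  have h1 := h _ hx (hxn.trans_lt hn2)
  have h2 : ⟪kpL e (p n + d n • y), p n + d n • y⟫ = 2 * d n * ⟪kpL e (p n), y⟫ + d n ^ 2 * ⟪kpL e y, y⟫ := by
    rw [map_add, map_smul]
    simp only [inner_add_left, inner_add_right, inner_smul_left, inner_smul_right, conj_trivial, hp2 n, kpL_symm e y (p n)]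
    ring
  rw [h2] at h1
  have h3 : |⟪kpL e y, y⟫| ≤ R ^ 2 / 2 := by
    calc |⟪kpL e y, y⟫| ≤ ‖kpL e y‖ * ‖y‖ := abs_real_inner_le_norm _ _
      _ = ‖y‖ ^ 2 / 2 := by rw [kpL_norm he]; ring
      _ ≤ _ := by gcongr
  have h4 : K * ‖p n + d n • y‖ ^ κ * ‖p n + d n • y‖ ^ 2 ≤ η / 2 * (d n * P) := by
    have e1 : ‖p n + d n • y‖ ^ κ ≤ (1 + R) * (P ^ (κ / 2) * P ^ (κ / 2)) := by
      calc ‖p n + d n • y‖ ^ κ ≤ ((1 + R) * P) ^ κ := Real.rpow_le_rpow (norm_nonneg _) hxn hκ.le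
        _ = (1 + R) ^ κ * P ^ κ := Real.mul_rpow (by positivity) hpn.le
        _ ≤ (1 + R) ^ (1 : ℝ) * P ^ κ := by gcongr; linarith
        _ = _ := by rw [Real.rpow_one, ← Real.rpow_add hpn, add_halves]
    have e2 : P ^ (κ / 2) * P ≤ d n := (hp3 n).le
    have e3 := (hpk n).le
    calc K * ‖p n + d n • y‖ ^ κ * ‖p n + d n • y‖ ^ 2 ≤ K * ((1 + R) * (P ^ (κ / 2) * P ^ (κ / 2))) * ((1 + R) * P) ^ 2 := by gcongr
      _ = (K * (1 + R) ^ 3 * P ^ (κ / 2)) * ((P ^ (κ / 2) * P) * P) := by ring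
      _ ≤ η / 2 * (d n * P) := by gcongr
  have h5 : |d n ^ 2 * ⟪kpL e y, y⟫| ≤ η / 4 * (d n * P) := by
    rw [abs_mul, abs_of_pos (by positivity)]
    calc d n ^ 2 * |⟪kpL e y, y⟫| ≤ d n * (η / (2 * R ^ 2) * P) * (R ^ 2 / 2) := by
          rw [sq]; gcongr
      _ = _ := by field_simp; ring
  have h6 : |2 * d n * ⟪kpL e (p n), y⟫| ≤ η * (d n * P) := by
    have h7 := h1.trans h4
    have h8 : 0 < η * (d n * P) := by positivity
    rw [abs_le] at h5 h7 ⊢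
    constructor <;> linarith
  rw [inner_smul_left, conj_trivial, kpL_norm he, abs_mul, abs_of_pos (by positivity), inv_mul_le_iff₀ (by positivity), ← hP]
  rw [abs_mul, abs_of_pos (by positivity)] at h6
  have h9 : 2 * d n * |⟪kpL e (p n), y⟫| ≤ 2 * d n * (P / 2 * η) := h6.trans (le_of_eq (by ring))
  exact le_of_mul_le_mul_left h9 (by positivity)

lemma mem_stdKP (x : E 4) : x ∈ stdKP 4 (le_refl 4) ↔ ‖x‖ ^ 2 = 2 * (x 3) ^ 2 := by
  rw [EuclideanSpace.real_norm_sq_eq, Fin.sum_univ_four]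
  show (x 3) ^ 2 = (x 0) ^ 2 + (x 1) ^ 2 + (x 2) ^ 2 ↔ _
  constructor <;> intro h <;> linarith

lemma kp_isKP {e : E 4} (he : ‖e‖ = 1) : IsKPCone (le_refl 4) 0 {x : E 4 | ⟪kpL e x, x⟫ = 0} := by
  obtain ⟨b, hb⟩ := Orthonormal.exists_orthonormalBasis_extension_of_card_eq (𝕜 := ℝ) (E := E 4) (ι := Fin 4) (by simp)
    (v := fun _ => e) (s := {3}) (by
      constructor
      · intro i; simpa using he
      · intro i j hij
        exact absurd (Subsingleton.elim i j) hij)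
  have hb3 : b 3 = e := hb 3 rfl
  refine ⟨b.repr, ?_⟩
  ext x
  rw [mem_preimage, mem_stdKP, b.repr.norm_map, b.repr_apply_apply, hb3]
  simp only [mem_ofPred_eq, zero_add]
  rw [kpL_self]
  constructor <;> intro h <;> linarith

lemma KP_props {D : Set (E 4)} (h : IsKPCone (le_refl 4) 0 D) : IsClosed D ∧ 0 ∈ D ∧ ∀ x ∈ D, ∀ t : ℝ, t • x ∈ D := by
  obtain ⟨f, hf⟩ := h
  simp only [zero_add] at hf
  have hD : D = f ⁻¹' stdKP 4 (le_refl 4) := hf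
  have hmem : ∀ x, x ∈ D ↔ ‖f x‖ ^ 2 = 2 * (f x 3) ^ 2 := fun x => by rw [hD, mem_preimage, mem_stdKP]
  refine ⟨?_, ?_, ?_⟩
  · have : D = {x | ‖f x‖ ^ 2 = 2 * (f x 3) ^ 2} := by ext x; exact hmem x
    rw [this]
    have hf := f.continuous
    exact isClosed_eq (by fun_prop) (by fun_prop)
  · rw [hmem]; simp
  · intro x hx t
    rw [hmem] at hx ⊢
    rw [map_smul, norm_smul, mul_pow, hx, PiLp.smul_apply, smul_eq_mul, Real.norm_eq_abs, sq_abs]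
    ring

lemma dxr_ge {r η η' : ℝ} (hr : 0 < r) {A B : Set (E 4)} (h0 : (0 : E 4) ∈ B) (h : dxr 0 r A B ≤ η) (hη : η < η') {a : E 4}
    (ha : a ∈ A) (har : ‖a‖ ≤ r) : ∃ b ∈ B, ‖b‖ ≤ r ∧ dist a b < η' * r := by
  have hb0 : (0 : E 4) ∈ B ∩ closedBall 0 r := ⟨h0, by simpa using hr.le⟩
  have hle : ∀ x, infDist x (B ∩ closedBall 0 r) ≤ ‖x‖ := fun x => by
    rw [← dist_zero_right]; exact infDist_le_dist_of_mem hb0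
  have h1 : infDist a (B ∩ closedBall 0 r) ≤ setD (A ∩ closedBall 0 r) (B ∩ closedBall 0 r) := by
    have ha' : a ∈ A ∩ closedBall 0 r := ⟨ha, by simpa using har⟩
    unfold setD
    refine le_trans ?_ (le_ciSup (f := fun a => ⨆ _ : a ∈ A ∩ closedBall 0 r, infDist a (B ∩ closedBall 0 r)) ?_ a)
    · simp only [ha', ciSup_unique, le_refl]
    · refine ⟨r, ?_⟩
      rintro _ ⟨x, rfl⟩
      refine Real.iSup_le (fun hx => (hle x).trans ?_) hr.le
      simpa using hx.2
  unfold dxr at h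
  rw [one_div, inv_mul_le_iff₀ hr] at h
  have h2 : infDist a (B ∩ closedBall 0 r) < η' * r := by nlinarith
  obtain ⟨b, hb, hd⟩ := (infDist_lt_iff ⟨0, hb0⟩).1 h2
  exact ⟨b, hb.1, by simpa using hb.2, hd⟩

lemma dxr_le2 {x : E 4} {r : ℝ} (hr : 0 < r) {A B : Set (E 4)} (h0 : x ∈ B) : dxr x r A B ≤ 2 := by
  unfold dxr setD
  rw [one_div, inv_mul_le_iff₀ hr]
  refine Real.iSup_le (fun a => Real.iSup_le (fun ha => ?_) (by positivity)) (by positivity)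
  have h1 : x ∈ B ∩ closedBall x r := ⟨h0, by simpa using hr.le⟩
  have h2 := infDist_le_dist_of_mem (x := a) h1
  have h3 := mem_closedBall.1 ha.2
  linarith

lemma vartheta_lt {S : Set (E 4)} {x : E 4} (hx : x ∈ S) {r : ℝ} (hr : 0 < r) : varthetaC (le_refl 4) S x r < 3 := by
  set D : Set (E 4) := {z | z - x ∈ stdKP 4 (le_refl 4)} with hD
  have hxD : x ∈ D := by
    show x - x ∈ stdKP 4 (le_refl 4)
    rw [mem_stdKP]; simp
  have hKP : IsKPCone (le_refl 4) x D := ⟨LinearIsometryEquiv.refl ℝ _, by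
    ext z
    simp [hD]⟩
  have h1 : varthetaC (le_refl 4) S x r ≤ Dxr x r S D := by
    unfold varthetaC
    refine ciInf_le (f := fun C : {C : Set (E 4) // (∃ y, IsKPCone (le_refl 4) y C) ∧ x ∈ C} => Dxr x r S C.1) ⟨0, ?_⟩ ⟨D, ⟨x, hKP⟩, hxD⟩
    rintro _ ⟨C, rfl⟩
    exact Dxr_nonneg _ hr _ _
  have h2 : Dxr x r S D ≤ 2 := max_le (dxr_le2 hr hxD) (dxr_le2 hr hx)
  linarith

lemma KP_sub {S D D' : Set (E 4)} {C β r0 : ℝ} (h0 : (0 : E 4) ∈ S) (hC : 0 < C) (hβ : 0 < β) (hr0 : 0 < r0)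
    (hD : IsKPCone (le_refl 4) 0 D) (hD' : IsKPCone (le_refl 4) 0 D')
    (h : ∀ r, 0 < r → r ≤ r0 → Dxr (0 : E 4) r S D ≤ C * r ^ β)
    (h' : ∀ r, 0 < r → r ≤ r0 → Dxr (0 : E 4) r S D' ≤ C * r ^ β) : D ⊆ D' := by
  obtain ⟨-, hz, hs⟩ := KP_props hD
  obtain ⟨hcl', hz', hs'⟩ := KP_props hD'
  intro x hx
  rw [← hcl'.closure_eq, Metric.mem_closure_iff]
  intro ε hε
  have hl : Tendsto (fun r : ℝ => (‖x‖ + 1) * (2 * (C * r ^ β + r))) (𝓝 0) (𝓝 0) := by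
    have h1 : Tendsto (fun r : ℝ => r ^ β) (𝓝 0) (𝓝 ((0 : ℝ) ^ β)) := tendsto_id.rpow_const (Or.inr hβ.le)
    rw [Real.zero_rpow hβ.ne'] at h1
    have := (((h1.const_mul C).add tendsto_id).const_mul 2).const_mul (‖x‖ + 1)
    simpa using this
  obtain ⟨δ, hδ, hδ2⟩ := Metric.eventually_nhds_iff.1 (hl.eventually_lt_const hε)
  set r := min r0 (δ / 2) with hr
  have hrp : 0 < r := lt_min hr0 (half_pos hδ)
  have h1 := hδ2 (y := r) (by rw [Real.dist_0_eq_abs, abs_of_pos hrp]; exact (min_le_right _ _).trans_lt (half_lt_self hδ))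
  have hx1 : 0 < ‖x‖ + 1 := by positivity
  set t := r / (‖x‖ + 1) with ht
  have ht0 : 0 < t := by positivity
  have hxr : ‖t • x‖ ≤ r := by
    rw [norm_smul, Real.norm_eq_abs, abs_of_pos ht0, ht, div_mul_eq_mul_div, div_le_iff₀ hx1]
    nlinarith
  obtain ⟨a, ha, har, hda⟩ := dxr_ge hrp h0 ((le_max_right _ _).trans (h r hrp (min_le_left _ _)))
    (show C * r ^ β < C * r ^ β + r by linarith) (hs x hx t) hxr
  obtain ⟨b, hb, -, hdb⟩ := dxr_ge hrp hz' ((le_max_left _ _).trans (h' r hrp (min_le_left _ _)))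
    (show C * r ^ β < C * r ^ β + r by linarith) ha har
  refine ⟨t⁻¹ • b, hs' b hb _, ?_⟩
  have h2 : dist (t • x) b < 2 * (C * r ^ β + r) * r := by
    have := dist_triangle (t • x) a b
    linarith
  have h3 : x - t⁻¹ • b = t⁻¹ • (t • x - b) := by rw [smul_sub, inv_smul_smul₀ ht0.ne']
  rw [dist_eq_norm, h3, norm_smul, norm_inv, Real.norm_eq_abs, abs_of_pos ht0, ← dist_eq_norm, inv_mul_lt_iff₀ ht0]
  calc dist (t • x) b < 2 * (C * r ^ β + r) * r := h2
    _ = t * ((‖x‖ + 1) * (2 * (C * r ^ β + r))) := by rw [ht]; field_simp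
    _ ≤ t * ε := by gcongr

lemma R5 {μ : Measure (E 4)} {C α c s : ℝ} (H : HReg μ C α) (hN : NF μ c s) : ∃ (e : E 4) (β C' r0 : ℝ), ‖e‖ = 1 ∧
    0 < β ∧ 0 < C' ∧ 0 < r0 ∧ ∀ r, 0 < r → r ≤ r0 → Dxr (0 : E 4) r (msupp μ) {x : E 4 | ⟪kpL e x, x⟫ = 0} ≤ C' * r ^ β := by
  obtain ⟨e, κ, K, ρ, he, hκ, hκ1, hK, hρ, h, hS⟩ := R3 H hN
  obtain ⟨r1, hr1, h2⟩ := R4 H he hκ hκ1 hK hρ h hS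
  have h0 := H.2.1
  refine ⟨e, κ / 2, 4 * K + 2, min (min (ρ / 2) (r1 / 2)) (1 / 2), he, by positivity, by positivity, by positivity, fun r hr hr0 => ?_⟩
  have a1 : r < ρ := by have := hr0.trans ((min_le_left _ _).trans (min_le_left _ _)); linarith
  have a2 : r < r1 := by have := hr0.trans ((min_le_left _ _).trans (min_le_right _ _)); linarith
  have a3 : r < 1 := by have := hr0.trans (min_le_right _ _); linarith
  have hk : 0 < r ^ (κ / 2) := Real.rpow_pos_of_pos hr _
  set q := r ^ (κ / 2) with hq
  have hq1 : q ≤ 1 := Real.rpow_le_one hr.le a3.le (by positivity)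
  refine max_le (dxr_le hr (by positivity) ?_) (dxr_le hr (by positivity) ?_)
  · intro x hx hxr
    obtain ⟨y, hy, hy2, hd⟩ := cone_proj he (h x hx (by linarith))
    refine ⟨y, hy2, by rwa [hy], hd.trans ?_⟩
    have e1 : ‖x‖ ^ κ ≤ q := (Real.rpow_le_rpow (norm_nonneg _) hxr hκ.le).trans
      (Real.rpow_le_rpow_of_exponent_ge hr a3.le (by linarith))
    calc 4 * (K * ‖x‖ ^ κ) * ‖x‖ ≤ 4 * (K * q) * r := by gcongr
      _ ≤ (4 * K + 2) * q * r := by nlinarith [mul_pos hk hr]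
  · intro p hp hpr
    have hp' : ⟪kpL e p, p⟫ = 0 := hp
    have hn : ‖(1 - q) • p‖ = (1 - q) * ‖p‖ := by rw [norm_smul, Real.norm_eq_abs, abs_of_nonneg (by linarith)]
    have hpn := norm_nonneg p
    have hn1 : ‖(1 - q) • p‖ ≤ (1 - q) * r := by rw [hn]; exact mul_le_mul_of_nonneg_left hpr (by linarith)
    have hn2 : ‖(1 - q) • p‖ ≤ r := hn1.trans (by nlinarith)
    have h3 := h2 ((1 - q) • p) (by linarith) (by
      rw [map_smul, inner_smul_left, inner_smul_right, hp']; simp)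
    obtain ⟨b, hb, hd⟩ := (msupp_closed μ).exists_infDist_eq_dist ⟨0, h0⟩ ((1 - q) • p)
    rw [hd] at h3
    have e1 : ‖(1 - q) • p‖ ^ (κ / 2) ≤ q := Real.rpow_le_rpow (norm_nonneg _) hn2 (by positivity)
    have h4 : dist ((1 - q) • p) b ≤ q * ((1 - q) * r) := h3.trans (by gcongr)
    refine ⟨b, hb, ?_, ?_⟩
    · have : ‖b‖ ≤ ‖(1 - q) • p‖ + dist ((1 - q) • p) b := by
        rw [dist_comm, dist_eq_norm]
        have := norm_add_le ((1 - q) • p) (b - (1 - q) • p)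
        rwa [add_sub_cancel] at this
      nlinarith [mul_pos (mul_pos hk hk) hr]
    · have e2 : dist p ((1 - q) • p) ≤ q * r := by
        rw [dist_eq_norm, sub_smul, one_smul, sub_sub_cancel, norm_smul, Real.norm_eq_abs, abs_of_pos hk]
        gcongr
      have := dist_triangle p ((1 - q) • p) b
      nlinarith [mul_pos hk hr, mul_pos (mul_pos hk hk) hr, mul_pos hK (mul_pos hk hr)]

theorem final_kp (μ : Measure (E 4))
    (hRadon : IsLocallyFiniteMeasure μ) (S : Set (E 4)) (hS : S = msupp μ)
    (h0 : (0 : E 4) ∈ S)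
    (hnf : ¬ Tendsto (fun r : ℝ => thetaP 3 S 0 r) (nhdsWithin 0 (Set.Ioi 0)) (nhds 0))
    (α C₀ : ℝ) (hα : 0 < α)
    (hreg : ∀ x ∈ S ∩ closedBall (0 : E 4) 1, ∀ r : ℝ, 0 < r → r ≤ 1 →
      |(μ (closedBall x r)).toReal / (omega3 * r ^ 3) - 1| ≤ C₀ * r ^ α) :
    ∃ ε β₁ C r₀ : ℝ, 0 < ε ∧ 0 < β₁ ∧ 0 < C ∧ 0 < r₀ ∧
      (∀ x ∈ S ∩ closedBall (0 : E 4) r₀, ∀ r : ℝ, 0 < r → r ≤ r₀ →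
        varthetaC (le_refl 4) S x r < ε) ∧
      (∃! Cone : Set (E 4), IsKPCone (le_refl 4) 0 Cone ∧
        ∀ r : ℝ, 0 < r → r ≤ r₀ → Dxr (0 : E 4) r S Cone ≤ C * r ^ β₁) := by
  subst hS
  have hω := omega3_pos
  have H : HReg μ (omega3 * max C₀ 0) α := by
    refine ⟨hRadon, h0, hα, mul_nonneg hω.le (le_max_right _ _), fun x hx hx1 r hr hr1 => ?_⟩
    have h1 := hreg x ⟨hx, by simpa using hx1⟩ r hr hr1
    have hp : 0 < omega3 * r ^ 3 := by positivity
    have h2 : (μ (closedBall x r)).toReal - omega3 * r ^ 3 =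
      (omega3 * r ^ 3) * ((μ (closedBall x r)).toReal / (omega3 * r ^ 3) - 1) := by field_simp
    rw [h2, abs_mul, abs_of_pos hp]
    have hra : 0 < r ^ α := Real.rpow_pos_of_pos hr _
    calc _ ≤ (omega3 * r ^ 3) * (max C₀ 0 * r ^ α) := by
          gcongr
          exact h1.trans (by gcongr; exact le_max_left _ _)
      _ = _ := by ring
  rcases Gap H with ha | ⟨c, hc, s, hs, hP⟩
  · exact absurd (caseA H ha) hnf
  obtain ⟨e, β, C, r0, he, hβ, hC, hr0, h⟩ := R5 H ⟨hc, hs, hP⟩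
  refine ⟨3, β, C, r0, by norm_num, hβ, hC, hr0, fun x hx r hr _ => vartheta_lt hx.1 hr, _, ⟨kp_isKP he, h⟩, ?_⟩
  rintro D ⟨hD, hDr⟩
  exact Subset.antisymm (KP_sub h0 hC hβ hr0 hD (kp_isKP he) hDr h) (KP_sub h0 hC hβ hr0 (kp_isKP he) hD h hDr)

/-- Lemma 4.7 / `singularpart`: at a nonflat point of the support of a
Hölder asymptotically uniform measure on `ℝ⁴` there is a unique tangent KP cone based at the
origin, approximating the support at a Hölder rate. -/
theorem unique_tangent_kp_cone (μ : Measure (E 4))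
    (hRadon : IsLocallyFiniteMeasure μ) (S : Set (E 4)) (hS : S = msupp μ)
    (h0 : (0 : E 4) ∈ S)
    (hnf : ¬ Tendsto (fun r : ℝ => thetaP 3 S 0 r) (nhdsWithin 0 (Set.Ioi 0)) (nhds 0))
    (α C₀ : ℝ) (hα : 0 < α)
    (hreg : ∀ x ∈ S ∩ closedBall (0 : E 4) 1, ∀ r : ℝ, 0 < r → r ≤ 1 →
      |(μ (closedBall x r)).toReal / (omega3 * r ^ 3) - 1| ≤ C₀ * r ^ α) :
    ∃ ε β₁ C r₀ : ℝ, 0 < ε ∧ 0 < β₁ ∧ 0 < C ∧ 0 < r₀ ∧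
      (∀ x ∈ S ∩ closedBall (0 : E 4) r₀, ∀ r : ℝ, 0 < r → r ≤ r₀ →
        varthetaC (le_refl 4) S x r < ε) ∧
      (∃! Cone : Set (E 4), IsKPCone (le_refl 4) 0 Cone ∧
        ∀ r : ℝ, 0 < r → r ≤ r₀ → Dxr (0 : E 4) r S Cone ≤ C * r ^ β₁) := by
  exact final_kp μ hRadon S hS h0 hnf α C₀ hα hreg
end
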